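/- Let p, r ∈ (0,1) and let S, T ∈ TOEC(p,r). If the ring Z[p] is a principal ideal domain, then the self-similar sets E_S and E_T are Lipschitz equivalent. -/

import Mathlib

open MeasureTheory Metric Set Pointwise

noncomputable section

/-- An iterated function system (IFS) of contracting similarities on `ℝ^d`. -/
structure IFS (d : ℕ) : Type 1 where
  ι : Type
  fin : Fintype ι
  f : ι → EuclideanSpace ℝ (Fin d) → EuclideanSpace ℝ (Fin d)
  r : ι → ℝ
  r_pos : ∀ i, 0 < r i
  r_lt_one : ∀ i, r i < 1
  sim : ∀ i x y, dist (f i x) (f i y) = r i * dist x y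

attribute [instance] IFS.fin

namespace IFS

variable {d : ℕ}

/-- `E` is the self-similar set (attractor) of `S`: the unique nonempty compact set
with `E = ⋃ i, S.f i '' E`. -/
def IsAttractor (S : IFS d) (E : Set (EuclideanSpace ℝ (Fin d))) : Prop :=
  E.Nonempty ∧ IsCompact E ∧ E = ⋃ i, S.f i '' E

open scoped Classical in
/-- The self-similar set generated by `S`. -/
def attractor (S : IFS d) : Set (EuclideanSpace ℝ (Fin d)) :=
  if h : ∃ E, S.IsAttractor E then h.choose else ∅

/-- `O` is an open set witnessing the open set condition for `S`. -/
def OSCSet (S : IFS d) (O : Set (EuclideanSpace ℝ (Fin d))) : Prop :=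
  O.Nonempty ∧ IsOpen O ∧ Bornology.IsBounded O ∧
    (∀ i, S.f i '' O ⊆ O) ∧ ∀ i j, i ≠ j → Disjoint (S.f i '' O) (S.f j '' O)

/-- The open set condition. -/
def OSC (S : IFS d) : Prop := ∃ O, S.OSCSet O

/-- The strong separation condition. -/
def SSC (S : IFS d) : Prop :=
  ∀ i j : S.ι, i ≠ j → Disjoint (S.f i '' S.attractor) (S.f j '' S.attractor)

/-- `r` is the ratio root of `S`: the ratios are commensurable with common root `r`. -/
def IsRatioRoot (S : IFS d) (r : ℝ) : Prop :=
  0 < r ∧ r < 1 ∧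
    ∃ lam : S.ι → ℕ, (∀ i, 0 < lam i) ∧ (∀ i, S.r i = r ^ lam i) ∧ Finset.univ.gcd lam = 1

/-- The Hausdorff dimension of the attractor of `S`, as a real number. -/
def hdim (S : IFS d) : ℝ := (dimH S.attractor).toReal

/-- Membership in the class TOEC: OSC, commensurable ratios, totally disconnected attractor. -/
def MemTOEC (S : IFS d) : Prop :=
  S.OSC ∧ (∃ r, S.IsRatioRoot r) ∧ IsTotallyDisconnected S.attractor

/-- Membership in TOEC(p, r): measure root `p` and ratio root `r`. -/
def MemTOECpr (S : IFS d) (p r : ℝ) : Prop :=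
  S.MemTOEC ∧ S.IsRatioRoot r ∧ p = r ^ S.hdim

/-- The natural measure of a set: normalized `s`-dimensional Hausdorff measure, `s = dimH E_S`. -/
def natMeasure (S : IFS d) (F : Set (EuclideanSpace ℝ (Fin d))) : ℝ :=
  (μH[S.hdim] F / μH[S.hdim] S.attractor).toReal

/-- `F` is an interior separated set of `E_S`. -/
def IsIntSep (S : IFS d) (F : Set (EuclideanSpace ℝ (Fin d))) : Prop :=
  IsCompact F ∧ F ⊆ S.attractor ∧ IsCompact (S.attractor \ F) ∧ ∃ O, S.OSCSet O ∧ F ⊆ O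

end IFS

/-- The subring `ℤ[p]` of `ℝ` generated by `ℤ` and `p`. -/
def Zring (p : ℝ) : Subring ℝ := Subring.closure {p}

/-- The underlying set of reals of an ideal of a subring of `ℝ`. -/
def idealSet {R : Subring ℝ} (I : Ideal R) : Set ℝ := (fun x : R => (x : ℝ)) '' (I : Set R)

/-- The ideal `I_S` of `ℤ[p]` generated by the natural measures of interior separated sets. -/
def IFS.idealOf {d : ℕ} (S : IFS d) (p : ℝ) : Ideal (Zring p) :=
  Ideal.span {x : Zring p | ∃ F, S.IsIntSep F ∧ (x : ℝ) = S.natMeasure F}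

/-- Two ideals of a subring `R` of `ℝ` lie in the same ideal class: `a·I = b·J`
for some nonzero `a, b ∈ R`. -/
def SameIdealClass {R : Subring ℝ} (I J : Ideal R) : Prop :=
  ∃ a b : R, a ≠ 0 ∧ b ≠ 0 ∧ (a : ℝ) • idealSet I = (b : ℝ) • idealSet J

/-- Lipschitz equivalence of subsets of (possibly different) metric spaces. -/
def LipEquiv {X Y : Type*} [MetricSpace X] [MetricSpace Y] (A : Set X) (B : Set Y) : Prop :=
  ∃ (f : X → Y) (L : ℝ), 1 ≤ L ∧ Set.BijOn f A B ∧
    ∀ x ∈ A, ∀ y ∈ A, L⁻¹ * dist x y ≤ dist (f x) (f y) ∧ dist (f x) (f y) ≤ L * dist x y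

set_option linter.unusedSectionVars false

/-! ### Words and cuts -/

section Words

variable {ι : Type*}

/-- The total weight of a word. -/
def wordWt (lam : ι → ℕ) (w : List ι) : ℕ := (w.map lam).sum

/-- `IsCut lam w k` says that `w` is a shortest word of weight at least `k`. -/
def IsCut (lam : ι → ℕ) : List ι → ℕ → Prop
  | [], k => k = 0
  | i :: w, k => 0 < k ∧ IsCut lam w (k - lam i)

variable {lam : ι → ℕ}

@[simp] lemma wordWt_nil : wordWt lam [] = 0 := rfl

@[simp] lemma wordWt_cons (i : ι) (w : List ι) :
    wordWt lam (i :: w) = lam i + wordWt lam w := by simp [wordWt]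

@[simp] lemma wordWt_append (u v : List ι) :
    wordWt lam (u ++ v) = wordWt lam u + wordWt lam v := by simp [wordWt]

@[simp] lemma isCut_nil {k : ℕ} : IsCut lam [] k ↔ k = 0 := Iff.rfl

@[simp] lemma isCut_cons {i : ι} {w : List ι} {k : ℕ} :
    IsCut lam (i :: w) k ↔ 0 < k ∧ IsCut lam w (k - lam i) := Iff.rfl

lemma IsCut.le_wordWt {w : List ι} {k : ℕ} (h : IsCut lam w k) : k ≤ wordWt lam w := by
  induction w generalizing k with
  | nil => simp_all
  | cons i w ih => have := ih h.2; simp; omega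

lemma IsCut.wordWt_lt {l : ℕ} (hl : ∀ i, lam i ≤ l) (hl0 : 0 < l) {w : List ι} {k : ℕ}
    (h : IsCut lam w k) : wordWt lam w < k + l := by
  induction w generalizing k with
  | nil => simp_all
  | cons i w ih =>
    have h1 := ih h.2
    have h2 := h.1
    simp only [wordWt_cons]
    by_cases hk : lam i < k
    · omega
    · have : k - lam i = 0 := by omega
      have h3 := h.2
      rw [this] at h3
      cases w with
      | nil => have := hl i; simp; omega
      | cons j w => exact absurd h3.1 (lt_irrefl _)

lemma IsCut.append {u v : List ι} {k : ℕ} (hpos : ∀ i, 0 < lam i) (h : IsCut lam v k)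
    (hv : v ≠ [] ∨ u = []) :
    IsCut lam (u ++ v) (wordWt lam u + k) := by
  induction u with
  | nil => simpa using h
  | cons i u ih =>
    have hv' : v ≠ [] := by simpa using hv
    refine ⟨by have := hpos i; simp; omega, ?_⟩
    have := ih (Or.inl hv')
    have e : wordWt lam (i :: u) + k - lam i = wordWt lam u + k := by
      rw [wordWt_cons]; omega
    change IsCut lam (u ++ v) (wordWt lam (i :: u) + k - lam i)
    rwa [e]

lemma isCut_wordWt (hpos : ∀ i, 0 < lam i) (w : List ι) : IsCut lam w (wordWt lam w) := by
  induction w with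
  | nil => simp
  | cons i w ih =>
    refine ⟨by have := hpos i; simp; omega, ?_⟩
    simpa using ih

lemma IsCut.append' {u v : List ι} {k : ℕ} (hpos : ∀ i, 0 < lam i) (h : IsCut lam v k) :
    IsCut lam (u ++ v) (wordWt lam u + k) := by
  by_cases hv : v = []
  · subst hv
    have : k = 0 := h
    subst this
    simpa using isCut_wordWt hpos u
  · exact h.append hpos (Or.inl hv)

lemma isCut_append_singleton (hpos : ∀ i, 0 < lam i) {w : List ι} {j : ι} {k : ℕ}
    (h1 : wordWt lam w < k) (h2 : k ≤ wordWt lam w + lam j) : IsCut lam (w ++ [j]) k := by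
  have : IsCut lam [j] (k - wordWt lam w) := ⟨by omega, by simp; omega⟩
  have h := this.append' hpos (u := w)
  convert h using 1
  omega

lemma IsCut.length_le (hpos : ∀ i, 0 < lam i) {w : List ι} {k : ℕ} (h : IsCut lam w k) :
    w.length ≤ k := by
  induction w generalizing k with
  | nil => simp
  | cons i w ih =>
    have h1 := ih h.2
    have h2 := h.1
    have := hpos i
    simp only [List.length_cons]; omega

lemma isPrefix_total {u v w : List ι} (hu : u <+: w) (hv : v <+: w) :
    u <+: v ∨ v <+: u :=
  (le_total u.length v.length).imp (List.prefix_of_prefix_length_le hu hv)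
    (List.prefix_of_prefix_length_le hv hu)

lemma IsCut.eq_of_prefix_of_isCut {u w : List ι} {k : ℕ} (hu : IsCut lam u k) (hw : IsCut lam w k)
    (h : u <+: w) : u = w := by
  induction u generalizing w k with
  | nil =>
    cases w with
    | nil => rfl
    | cons i w => have h1 : k = 0 := hu; have h2 := hw.1; omega
  | cons i u ih =>
    obtain ⟨t, rfl⟩ := h
    have : u = u ++ t := ih hu.2 hw.2 ⟨t, rfl⟩
    rw [List.cons_append, ← this]

lemma exists_prefix_isCut {w : List ι} {k : ℕ} (h : k ≤ wordWt lam w) :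
    ∃ u, IsCut lam u k ∧ u <+: w := by
  induction w generalizing k with
  | nil => exact ⟨[], by simpa using h, List.prefix_refl _⟩
  | cons i w ih =>
    by_cases hk : k = 0
    · exact ⟨[], hk, ⟨_, rfl⟩⟩
    · obtain ⟨u, hu, t, rfl⟩ := ih (k := k - lam i) (by simp at h; omega)
      exact ⟨i :: u, ⟨by omega, hu⟩, t, rfl⟩

variable [Fintype ι]

open scoped Classical in
/-- The finite set of all shortest words of weight at least `k`. -/
def cutSet (lam : ι → ℕ) (k : ℕ) : Finset (List ι) :=
  (List.finite_length_le ι k).toFinset.filter (IsCut lam · k)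

lemma mem_cutSet (hpos : ∀ i, 0 < lam i) {w : List ι} {k : ℕ} :
    w ∈ cutSet lam k ↔ IsCut lam w k := by
  classical
  simp only [cutSet, Finset.mem_filter, Set.Finite.mem_toFinset, Set.mem_ofPred_eq]
  exact ⟨fun h => h.2, fun h => ⟨h.length_le hpos, h⟩⟩

lemma cutSet_zero (hpos : ∀ i, 0 < lam i) : cutSet lam 0 = {[]} := by
  ext w
  rw [mem_cutSet hpos]
  cases w <;> simp

lemma sum_cutSet {M : Type*} [AddCommMonoid M] (hpos : ∀ i, 0 < lam i) {k : ℕ} (hk : 0 < k)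
    (F : List ι → M) :
    ∑ w ∈ cutSet lam k, F w = ∑ i, ∑ w ∈ cutSet lam (k - lam i), F (i :: w) := by
  classical
  have : cutSet lam k = Finset.univ.biUnion
      fun i => (cutSet lam (k - lam i)).image (List.cons i) := by
    ext w
    simp only [mem_cutSet hpos, Finset.mem_biUnion, Finset.mem_univ, true_and, Finset.mem_image]
    cases w with
    | nil => simp; omega
    | cons i w => simp [hk]
  rw [this, Finset.sum_biUnion]
  · refine Finset.sum_congr rfl fun i _ => ?_
    rw [Finset.sum_image]
    intro a _ b _ h
    simpa using h
  · intro i _ j _ hij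
    rw [Function.onFun, Finset.disjoint_left]
    intro w hw hw'
    obtain ⟨a, _, rfl⟩ := Finset.mem_image.1 hw
    obtain ⟨b, _, h⟩ := Finset.mem_image.1 hw'
    simp at h
    exact hij h.1.symm

lemma sum_cutSet_pow (hpos : ∀ i, 0 < lam i) {p : ℝ} (hp : ∑ i, p ^ lam i = 1) (k : ℕ) :
    ∑ w ∈ cutSet lam k, p ^ wordWt lam w = 1 := by
  induction k using Nat.strong_induction_on with
  | _ k ih =>
    rcases Nat.eq_zero_or_pos k with rfl | hk
    · simp [cutSet_zero hpos]
    · rw [sum_cutSet hpos hk, ← hp]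
      refine Finset.sum_congr rfl fun i _ => ?_
      simp only [wordWt_cons, pow_add, ← Finset.mul_sum]
      rw [ih _ (by have := hpos i; omega), mul_one]

end Words

/-! ### Refinement of equal sums, discreteness -/

lemma exists_sub_weights {β : Type*} (G : AddSubgroup ℝ) (s : Finset β) (b : β → ℝ)
    (hb : ∀ j ∈ s, 0 ≤ b j ∧ b j ∈ G) (a : ℝ) (ha : 0 ≤ a) (haG : a ∈ G)
    (hab : a ≤ ∑ j ∈ s, b j) :
    ∃ c : β → ℝ, (∀ j ∈ s, 0 ≤ c j ∧ c j ≤ b j ∧ c j ∈ G) ∧ ∑ j ∈ s, c j = a := by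
  classical
  induction s using Finset.induction_on generalizing a with
  | empty => exact ⟨fun _ => 0, by simp, by simp at hab ⊢; linarith⟩
  | insert j s hj ih =>
    have hbj := hb j (Finset.mem_insert_self _ _)
    rw [Finset.sum_insert hj] at hab
    have hmem : min (b j) a ∈ G := by
      rcases min_choice (b j) a with h | h <;> rw [h]
      exacts [hbj.2, haG]
    obtain ⟨c, hc, hcs⟩ := ih (fun i hi => hb i (Finset.mem_insert_of_mem hi)) (a - min (b j) a)
      (by linarith [min_le_right (b j) a]) (G.sub_mem haG hmem)
      (by
        have := Finset.sum_nonneg fun i hi => (hb i (Finset.mem_insert_of_mem hi)).1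
        rcases min_choice (b j) a with h | h <;> rw [h] <;> linarith)
    refine ⟨fun i => if i = j then min (b j) a else c i, ?_, ?_⟩
    · intro i hi
      by_cases hij : i = j
      · subst hij
        simp only [if_true]
        exact ⟨le_min hbj.1 ha, min_le_left _ _, hmem⟩
      · simp only [hij, if_false]
        exact hc i (Finset.mem_of_mem_insert_of_ne hi hij)
    · rw [Finset.sum_insert hj, if_pos rfl]
      have : ∑ x ∈ s, (if x = j then min (b j) a else c x) = ∑ x ∈ s, c x :=
        Finset.sum_congr rfl fun x hx => if_neg fun h : x = j => hj (h ▸ hx)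
      rw [this, hcs]; ring

lemma exists_common_refinement {α β : Type*} [Fintype β] (G : AddSubgroup ℝ) (s : Finset α)
    (a : α → ℝ) (b : β → ℝ) (ha : ∀ i ∈ s, 0 ≤ a i ∧ a i ∈ G) (hb : ∀ j, 0 ≤ b j ∧ b j ∈ G)
    (hab : ∑ i ∈ s, a i = ∑ j, b j) :
    ∃ z : α → β → ℝ, (∀ i ∈ s, ∀ j, 0 ≤ z i j ∧ z i j ∈ G) ∧ (∀ i ∈ s, ∑ j, z i j = a i) ∧
      ∀ j, ∑ i ∈ s, z i j = b j := by
  classical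
  induction s using Finset.induction_on generalizing b with
  | empty =>
    refine ⟨fun _ _ => 0, by simp, by simp, ?_⟩
    simp only [Finset.sum_empty] at hab ⊢
    intro j
    exact ((Finset.sum_eq_zero_iff_of_nonneg fun j _ => (hb j).1).1 hab.symm j
      (Finset.mem_univ _)).symm
  | insert i s hi ih =>
    have hai := ha i (Finset.mem_insert_self _ _)
    rw [Finset.sum_insert hi] at hab
    have hs := Finset.sum_nonneg fun j hj => (ha j (Finset.mem_insert_of_mem hj)).1
    obtain ⟨c, hc, hcs⟩ := exists_sub_weights G Finset.univ b (fun j _ => hb j) (a i) hai.1 hai.2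
      (by linarith)
    obtain ⟨z, h1, h2, h3⟩ := ih (fun j => b j - c j)
      (fun j hj => ha j (Finset.mem_insert_of_mem hj))
      (fun j => ⟨by linarith [(hc j (Finset.mem_univ _)).2.1],
        G.sub_mem (hb j).2 (hc j (Finset.mem_univ _)).2.2⟩)
      (by rw [Finset.sum_sub_distrib, hcs]; linarith)
    have hne : ∀ x ∈ s, x ≠ i := fun x hx h => hi (h ▸ hx)
    refine ⟨fun x => if x = i then c else z x, ?_, ?_, ?_⟩
    · intro x hx j
      by_cases hxi : x = i
      · simp only [hxi, if_true]
        exact ⟨(hc j (Finset.mem_univ _)).1, (hc j (Finset.mem_univ _)).2.2⟩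
      · simp only [hxi, if_false]
        exact h1 x (Finset.mem_of_mem_insert_of_ne hx hxi) j
    · intro x hx
      by_cases hxi : x = i
      · simp only [hxi, if_true]; exact hcs
      · simp only [hxi, if_false]
        exact h2 x (Finset.mem_of_mem_insert_of_ne hx hxi)
    · intro j
      rw [Finset.sum_insert hi]
      simp only [if_true]
      have : ∑ x ∈ s, (if x = i then c else z x) j = ∑ x ∈ s, z x j :=
        Finset.sum_congr rfl fun x hx => by rw [if_neg (hne x hx)]
      rw [this, h3]; ring

lemma finite_nat_combinations_le {l : ℕ} (g : ℕ → ℝ) (hg : ∀ i, 0 < g i) (B : ℝ) :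
    {x : ℝ | x ≤ B ∧ ∃ N : ℕ → ℕ, x = ∑ i ∈ Finset.range l, N i * g i}.Finite := by
  classical
  let T : Set (Fin l → ℕ) := Set.Iic fun i => ⌊B / g i⌋₊
  refine ((Set.finite_Iic (fun i : Fin l => ⌊B / g i⌋₊)).image
    fun N => ∑ i : Fin l, (N i : ℝ) * g i).subset ?_
  rintro x ⟨hx, N, rfl⟩
  refine ⟨fun i => N i, fun i => ?_, ?_⟩
  · apply Nat.le_floor
    rw [le_div_iff₀ (hg i)]
    refine le_trans ?_ hx
    exact Finset.single_le_sum (f := fun i => (N i : ℝ) * g i)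
      (fun j _ => mul_nonneg (Nat.cast_nonneg _) (hg j).le) (Finset.mem_range.2 i.2)
  · exact Fin.sum_univ_eq_sum_range (fun i => (N i : ℝ) * g i) l

/-! ### A renewal theorem -/

section Renewal

variable {ι : Type*} [Fintype ι] {lam : ι → ℕ} {a : ι → ℝ} {l : ℕ} {h : ℕ → ℝ}

lemma renewal_le (hpos : ∀ i, 0 < lam i) (hl : ∀ i, lam i ≤ l) (ha : ∀ i, 0 < a i)
    (ha1 : ∑ i, a i = 1) (hh : ∀ n, l ≤ n → h n = ∑ i, a i * h (n - lam i)) {N : ℕ} {b : ℝ}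
    (hb : ∀ n, N ≤ n → n < N + l → h n ≤ b) (n : ℕ) (hn : N ≤ n) : h n ≤ b := by
  induction n using Nat.strong_induction_on with
  | _ n ih =>
    by_cases hn' : n < N + l
    · exact hb n hn hn'
    · rw [hh n (by omega), ← one_mul b, ← ha1, Finset.sum_mul]
      refine Finset.sum_le_sum fun i _ => mul_le_mul_of_nonneg_left ?_ (ha i).le
      have := hpos i; have := hl i
      exact ih _ (by omega) (by omega)

lemma renewal_word (hpos : ∀ i, 0 < lam i) (hl : ∀ i, lam i ≤ l) (ha : ∀ i, 0 < a i)
    (ha1 : ∑ i, a i = 1) (hh : ∀ n, l ≤ n → h n = ∑ i, a i * h (n - lam i)) (w : List ι) :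
    ∃ δ : ℝ, 0 < δ ∧ ∀ (N : ℕ) (b : ℝ), (∀ n, N ≤ n → h n ≤ b) →
      ∀ n, N + l ≤ n → ∀ η, h n ≤ b - η → h (n + wordWt lam w) ≤ b - δ * η := by
  classical
  induction w with
  | nil => exact ⟨1, one_pos, fun N b _ n _ η hn => by simpa using hn⟩
  | cons i w ih =>
    obtain ⟨δ, hδ, H⟩ := ih
    refine ⟨δ * a i, mul_pos hδ (ha i), fun N b hb n hn η hη => ?_⟩
    have key : h (n + lam i) ≤ b - a i * η := by
      have h1 := hpos i
      rw [hh _ (by omega), ← Finset.add_sum_erase _ _ (Finset.mem_univ i), Nat.add_sub_cancel]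
      have h2 : ∑ j ∈ Finset.univ.erase i, a j * h (n + lam i - lam j) ≤
          ∑ j ∈ Finset.univ.erase i, a j * b := by
        refine Finset.sum_le_sum fun j _ => mul_le_mul_of_nonneg_left ?_ (ha j).le
        have := hl j
        exact hb _ (by omega)
      rw [← Finset.sum_mul] at h2
      have h3 := Finset.add_sum_erase _ a (Finset.mem_univ i)
      rw [ha1] at h3
      have h4 : ∑ j ∈ Finset.univ.erase i, a j = 1 - a i := by linarith
      rw [h4] at h2
      nlinarith [mul_le_mul_of_nonneg_left hη (ha i).le]
    have := H N b hb _ (by omega) _ key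
    rw [wordWt_cons, ← add_assoc]
    linarith

lemma exists_word_of_mem_closure {ι : Type*} {lam : ι → ℕ} {j : ℕ}
    (h : j ∈ AddSubmonoid.closure (Set.range lam)) :
    ∃ w : List ι, wordWt lam w = j := by
  induction h using AddSubmonoid.closure_induction with
  | mem x hx => obtain ⟨i, rfl⟩ := hx; exact ⟨[i], by simp⟩
  | zero => exact ⟨[], rfl⟩
  | add x y _ _ hx hy =>
    obtain ⟨u, rfl⟩ := hx
    obtain ⟨v, rfl⟩ := hy
    exact ⟨u ++ v, by simp⟩

lemma exists_word_of_gcd (hgcd : Finset.univ.gcd lam = 1) :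
    ∃ J, ∀ j, J ≤ j → ∃ w : List ι, wordWt lam w = j := by
  obtain ⟨J, hJ⟩ := Nat.exists_mem_closure_of_ge (Set.range lam)
  refine ⟨J, fun j hj => exists_word_of_mem_closure (hJ j hj ?_)⟩
  have : Nat.setGcd (Set.range lam) ∣ Finset.univ.gcd lam :=
    Finset.dvd_gcd fun i _ => Nat.setGcd_dvd_of_mem (Set.mem_range_self i)
  rw [hgcd] at this
  exact this.trans (one_dvd _)

lemma renewal_drop (hpos : ∀ i, 0 < lam i) (hl : ∀ i, lam i ≤ l) (ha : ∀ i, 0 < a i)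
    (ha1 : ∑ i, a i = 1) (hh : ∀ n, l ≤ n → h n = ∑ i, a i * h (n - lam i))
    (hgcd : Finset.univ.gcd lam = 1) :
    ∃ (δ : ℝ) (J : ℕ), 0 < δ ∧ ∀ (N : ℕ) (b : ℝ), (∀ n, N ≤ n → h n ≤ b) →
      ∀ n, N + l ≤ n → ∀ η, 0 ≤ η → h n ≤ b - η → ∀ m, n + J ≤ m → h m ≤ b - δ * η := by
  obtain ⟨J, hJ⟩ := exists_word_of_gcd hgcd
  choose w hw using hJ
  choose δ hδ H using renewal_word hpos hl ha ha1 hh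
  let D : ℕ → ℝ := fun j => δ (w (J + j) (Nat.le_add_right _ _))
  have hne : (Finset.range (l + 1)).Nonempty := ⟨0, by simp⟩
  refine ⟨(Finset.range (l + 1)).inf' hne D, J, ?_, ?_⟩
  · rw [Finset.lt_inf'_iff]
    exact fun j _ => hδ _
  · intro N b hb n hn η hη hnη m hm
    refine renewal_le hpos hl ha ha1 hh (N := n + J) ?_ m hm
    intro k hk1 hk2
    obtain ⟨j, rfl⟩ := Nat.exists_eq_add_of_le hk1
    have h1 := H (w (J + j) (Nat.le_add_right _ _)) N b hb n hn η hnη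
    rw [hw, ← add_assoc] at h1
    have h2 : (Finset.range (l + 1)).inf' hne D ≤ D j :=
      Finset.inf'_le _ (Finset.mem_range.2 (by omega))
    have := mul_le_mul_of_nonneg_right h2 hη
    linarith

lemma renewal_tendsto (hpos : ∀ i, 0 < lam i) (hl : ∀ i, lam i ≤ l) (ha : ∀ i, 0 < a i)
    (ha1 : ∑ i, a i = 1) (hh : ∀ n, l ≤ n → h n = ∑ i, a i * h (n - lam i))
    (hgcd : Finset.univ.gcd lam = 1) (h0 : ∀ n, 0 ≤ h n) {B : ℝ} (hB : ∀ n, h n ≤ B)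
    (hev : ∀ᶠ n in Filter.atTop, 0 < h n) :
    ∃ L, 0 < L ∧ Filter.Tendsto h Filter.atTop (nhds L) := by
  have bdd1 : Filter.IsBoundedUnder (· ≤ ·) Filter.atTop h := ⟨B, by simp [hB]⟩
  have bdd2 : Filter.IsBoundedUnder (· ≥ ·) Filter.atTop h := ⟨0, by simp [h0]⟩
  have hlim : Filter.Tendsto h Filter.atTop (nhds (Filter.limsup h Filter.atTop)) := by
    refine tendsto_of_liminf_eq_limsup ?_ rfl bdd1 bdd2
    refine le_antisymm (Filter.liminf_le_limsup bdd1 bdd2) ?_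
    by_contra hlt
    push Not at hlt
    set A := Filter.liminf h Filter.atTop
    set C := Filter.limsup h Filter.atTop
    obtain ⟨δ, J, hδ, H⟩ := renewal_drop hpos hl ha ha1 hh hgcd
    set η := (C - A) / 2 with hη
    have hη0 : 0 < η := by linarith
    have hfreq : ∃ᶠ n in Filter.atTop, h n < C - η :=
      Filter.frequently_lt_of_liminf_lt bdd1.isCoboundedUnder_ge (by linarith)
    have hev2 : ∀ᶠ n in Filter.atTop, h n < C + δ * η / 2 :=
      Filter.eventually_lt_of_limsup_lt (by have := mul_pos hδ hη0; linarith) bdd1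
    obtain ⟨N, hN⟩ := Filter.eventually_atTop.1 hev2
    obtain ⟨n, hn1, hn2⟩ := (hfreq.and_eventually (Filter.eventually_ge_atTop (N + l))).exists
    have hδη := mul_pos hδ hη0
    have h3 := H N (C + δ * η / 2) (fun n hn => (hN n hn).le) n hn2 (η + δ * η / 2)
      (by positivity) (by linarith)
    have h4 : C ≤ C + δ * η / 2 - δ * (η + δ * η / 2) :=
      Filter.limsup_le_of_le bdd2.isCoboundedUnder_le (Filter.eventually_atTop.2 ⟨n + J, h3⟩)
    nlinarith [mul_pos hδ hδη]
  refine ⟨_, ?_, hlim⟩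
  obtain ⟨N, hN⟩ := Filter.eventually_atTop.1 hev
  have hne : (Finset.range (l + 1)).Nonempty := ⟨0, by simp⟩
  set m := (Finset.range (l + 1)).inf' hne fun j => h (N + j)
  have hm : 0 < m := by
    rw [Finset.lt_inf'_iff]
    exact fun j _ => hN _ (Nat.le_add_right _ _)
  refine hm.trans_le (ge_of_tendsto hlim (Filter.eventually_atTop.2 ⟨N, fun n hn => ?_⟩))
  have := renewal_le (h := fun n => - h n) (b := -m) (N := N) hpos hl ha ha1
    (fun n hn => by
      rw [hh n hn, ← Finset.sum_neg_distrib]; simp) ?_ n hn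
  · change - h n ≤ _ at this
    linarith
  · intro k h1 h2
    obtain ⟨j, rfl⟩ := Nat.exists_eq_add_of_le h1
    have : m ≤ h (N + j) := Finset.inf'_le _ (Finset.mem_range.2 (by omega))
    change - h (N + j) ≤ _
    linarith

end Renewal

/-! ### Counting words -/

section Count

variable {ι : Type*} [Fintype ι] {lam : ι → ℕ}

/-- Number of words in the cut at level `e` with overshoot `i`. -/
def cutCount (lam : ι → ℕ) (i e : ℕ) : ℕ :=
  ((cutSet lam e).filter fun w => wordWt lam w = e + i).card

lemma cutCount_eq (lam : ι → ℕ) (i e : ℕ) :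
    cutCount lam i e = ∑ w ∈ cutSet lam e, if wordWt lam w = e + i then 1 else 0 := by
  rw [cutCount, Finset.card_filter]

lemma cutCount_rec (hpos : ∀ i, 0 < lam i) {l : ℕ} (hl : ∀ i, lam i ≤ l) (hl0 : 0 < l) (i e : ℕ)
    (he : l ≤ e) :
    cutCount lam i e = ∑ j, cutCount lam i (e - lam j) := by
  rw [cutCount_eq, sum_cutSet hpos (by omega)]
  refine Finset.sum_congr rfl fun j _ => ?_
  rw [cutCount_eq]
  refine Finset.sum_congr rfl fun w _ => ?_
  have := hl j
  congr 1
  rw [wordWt_cons, eq_iff_iff]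
  omega

variable {p : ℝ}

lemma sum_cutCount (hpos : ∀ i, 0 < lam i) {l : ℕ} (hl : ∀ i, lam i ≤ l) (hl0 : 0 < l)
    (e : ℕ) (F : ℕ → ℝ) :
    ∑ i ∈ Finset.range l, cutCount lam i e * F (e + i) =
      ∑ w ∈ cutSet lam e, F (wordWt lam w) := by
  simp only [cutCount_eq, Nat.cast_sum, Finset.sum_mul]
  rw [Finset.sum_comm]
  refine Finset.sum_congr rfl fun w hw => ?_
  rw [mem_cutSet hpos] at hw
  have h1 := hw.le_wordWt
  have h2 := hw.wordWt_lt hl hl0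
  rw [Finset.sum_eq_single (wordWt lam w - e)]
  · rw [if_pos (by omega), Nat.cast_one, one_mul]
    congr 1; omega
  · intro b _ hb
    rw [if_neg (by omega)]; simp
  · intro h
    exact absurd (Finset.mem_range.2 (by omega)) h

lemma cutCount_tendsto (hpos : ∀ i, 0 < lam i) {l : ℕ} (hl : ∀ i, lam i ≤ l)
    (hl' : ∃ j, lam j = l) (hgcd : Finset.univ.gcd lam = 1)
    (hp0 : 0 < p) (hp : ∑ i, p ^ lam i = 1) {i : ℕ} (hi : i < l) :
    ∃ L, 0 < L ∧
      Filter.Tendsto (fun e => (cutCount lam i e : ℝ) * p ^ (e + i)) Filter.atTop (nhds L) := by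
  have hl0 : 0 < l := by omega
  refine renewal_tendsto (a := fun i => p ^ lam i) (l := l) (B := 1) hpos hl
    (fun i => pow_pos hp0 _) hp ?_ hgcd ?_ ?_ ?_
  · intro n hn
    rw [cutCount_rec hpos hl hl0 i n hn, Nat.cast_sum, Finset.sum_mul]
    refine Finset.sum_congr rfl fun j _ => ?_
    have := hl j
    have e : n + i = lam j + (n - lam j + i) := by omega
    rw [e, pow_add p (lam j)]; ring
  · intro n; positivity
  · intro n
    rw [← sum_cutSet_pow hpos hp n, ← sum_cutCount hpos hl hl0 n fun k => p ^ k]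
    exact Finset.single_le_sum (f := fun i => (cutCount lam i n : ℝ) * p ^ (n + i))
      (fun _ _ => by positivity) (Finset.mem_range.2 hi)
  · obtain ⟨J, hJ⟩ := exists_word_of_gcd hgcd
    obtain ⟨j, hj⟩ := hl'
    refine Filter.eventually_atTop.2 ⟨J + l, fun n hn => ?_⟩
    obtain ⟨w, hw⟩ := hJ (n + i - l) (by omega)
    have : 0 < cutCount lam i n := by
      refine Finset.card_pos.2 ⟨w ++ [j], ?_⟩
      rw [Finset.mem_filter, mem_cutSet hpos]
      exact ⟨isCut_append_singleton hpos (by omega) (by omega), by simp; omega⟩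
    positivity

/-- Words of weight exactly `k`. -/
def exactWords (lam : ι → ℕ) (k : ℕ) : Finset (List ι) :=
  (cutSet lam k).filter fun w => wordWt lam w = k

lemma mem_exactWords (hpos : ∀ i, 0 < lam i) {w : List ι} {k : ℕ} :
    w ∈ exactWords lam k ↔ wordWt lam w = k := by
  rw [exactWords, Finset.mem_filter, mem_cutSet hpos]
  exact ⟨fun h => h.2, fun h => ⟨h ▸ isCut_wordWt hpos w, h⟩⟩

lemma exists_card_exactWords_ge (hpos : ∀ i, 0 < lam i) {l : ℕ} (hl : ∀ i, lam i ≤ l)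
    (hl' : ∃ j, lam j = l) (hgcd : Finset.univ.gcd lam = 1)
    (hp0 : 0 < p) (hp : ∑ i, p ^ lam i = 1) :
    ∃ (δ : ℝ) (J : ℕ), 0 < δ ∧ ∀ j, J ≤ j → δ ≤ (exactWords lam j).card * p ^ j := by
  obtain ⟨j, hj⟩ := hl'
  obtain ⟨L, hL, hlim⟩ := cutCount_tendsto hpos hl ⟨j, hj⟩ hgcd hp0 hp (i := 0)
    (by have := hpos j; omega)
  have := hlim.eventually (lt_mem_nhds (half_lt_self hL))
  obtain ⟨J, hJ⟩ := Filter.eventually_atTop.1 this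
  exact ⟨L / 2, J, half_pos hL, fun j hj => (hJ j hj).le⟩

/-! ### Positive elements of `ℤ[p]` -/

lemma mem_Zring_self (p : ℝ) : p ∈ Zring p := Subring.subset_closure rfl

lemma inv_mem_Zring (hpos : ∀ i, 0 < lam i) (hp : ∑ i, p ^ lam i = 1) :
    p⁻¹ ∈ Zring p := by
  have : p⁻¹ = ∑ i, p ^ (lam i - 1) := by
    refine inv_eq_of_mul_eq_one_right ?_
    rw [Finset.mul_sum, ← hp]
    refine Finset.sum_congr rfl fun i _ => ?_
    rw [← pow_succ']
    congr 1
    have := hpos i; omega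
  rw [this]
  exact Subring.sum_mem _ fun i _ => Subring.pow_mem _ (mem_Zring_self p) _

lemma exists_int_repr (hpos : ∀ i, 0 < lam i) {l : ℕ} (hl : ∀ i, lam i ≤ l) (hl0 : 0 < l)
    (hp : ∑ i, p ^ lam i = 1) {π : ℕ → ℝ}
    (hπ : ∀ i, i < l → Filter.Tendsto (fun e => (cutCount lam i e : ℝ) * p ^ (e + i))
      Filter.atTop (nhds (π i))) {z : ℝ} (hz : z ∈ Zring p) :
    ∃ N : ℕ → ℕ → ℤ, (∀ᶠ e in Filter.atTop, z = ∑ i ∈ Finset.range l, N i e * p ^ (e + i)) ∧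
      ∀ i, i < l → Filter.Tendsto (fun e => (N i e : ℝ) * p ^ (e + i))
        Filter.atTop (nhds (z * π i)) := by
  rw [Zring, Subring.mem_closure_iff] at hz
  induction hz using AddSubgroup.closure_induction with
  | mem x hx =>
    obtain ⟨k, rfl⟩ := Submonoid.mem_closure_singleton.1 hx
    refine ⟨fun i e => cutCount lam i (e - k), ?_, ?_⟩
    · refine Filter.eventually_atTop.2 ⟨k, fun e he => ?_⟩
      have h1 := sum_cutSet_pow hpos hp (e - k)
      rw [← sum_cutCount hpos hl hl0 _ fun k => p ^ k] at h1
      rw [← mul_one (p ^ k), ← h1, Finset.mul_sum]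
      refine Finset.sum_congr rfl fun i _ => ?_
      have e1 : e + i = k + (e - k + i) := by omega
      rw [e1, pow_add p k]; push_cast; ring
    · intro i hi
      have h1 := ((hπ i hi).comp (Filter.tendsto_sub_atTop_nat k)).const_mul (p ^ k)
      refine h1.congr' (Filter.eventually_atTop.2 ⟨k, fun e he => ?_⟩)
      have e1 : e + i = k + (e - k + i) := by omega
      simp only [Function.comp]; rw [e1, pow_add p k]; push_cast; ring
  | zero => exact ⟨0, by simp, by simp⟩
  | add x y _ _ hx hy =>
    obtain ⟨N, h1, h2⟩ := hx
    obtain ⟨M, h3, h4⟩ := hy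
    refine ⟨fun i e => N i e + M i e, ?_, fun i hi => ?_⟩
    · filter_upwards [h1, h3] with e he1 he2
      conv_lhs => rw [he1, he2]
      rw [← Finset.sum_add_distrib]
      exact Finset.sum_congr rfl fun i _ => by push_cast; ring
    · rw [add_mul]
      refine ((h2 i hi).add (h4 i hi)).congr fun e => ?_
      push_cast; ring
  | neg x _ hx =>
    obtain ⟨N, h1, h2⟩ := hx
    refine ⟨fun i e => - N i e, ?_, fun i hi => ?_⟩
    · filter_upwards [h1] with e he
      conv_lhs => rw [he]
      rw [← Finset.sum_neg_distrib]
      exact Finset.sum_congr rfl fun i _ => by push_cast; ring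
    · rw [neg_mul]
      refine (h2 i hi).neg.congr fun e => ?_
      push_cast; ring

lemma exists_nat_repr (hpos : ∀ i, 0 < lam i) {l : ℕ} (hl : ∀ i, lam i ≤ l)
    (hl' : ∃ j, lam j = l) (hgcd : Finset.univ.gcd lam = 1)
    (hp0 : 0 < p) (hp : ∑ i, p ^ lam i = 1) {z : ℝ} (hz : z ∈ Zring p) (hz0 : 0 < z) :
    ∀ᶠ e in Filter.atTop, ∃ N : ℕ → ℕ, z = ∑ i ∈ Finset.range l, N i * p ^ (e + i) := by
  have hl0 : 0 < l := by obtain ⟨j, rfl⟩ := hl'; exact hpos j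
  choose! π hπ0 hπ using fun i (hi : i < l) => cutCount_tendsto hpos hl hl' hgcd hp0 hp hi
  obtain ⟨N, h1, h2⟩ := exists_int_repr hpos hl hl0 hp hπ hz
  have h3 : ∀ᶠ e in Filter.atTop, ∀ i ∈ Finset.range l, (0 : ℝ) < N i e * p ^ (e + i) := by
    rw [Filter.eventually_all_finset]
    intro i hi
    have hi := Finset.mem_range.1 hi
    exact (h2 i hi).eventually (lt_mem_nhds (mul_pos hz0 (hπ0 i hi)))
  filter_upwards [h1, h3] with e he1 he2
  refine ⟨fun i => (N i e).toNat, ?_⟩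
  rw [he1]
  refine Finset.sum_congr rfl fun i hi => ?_
  have h4 := pos_of_mul_pos_left (he2 i hi) (pow_pos hp0 _).le
  have h5 : 0 ≤ N i e := by exact_mod_cast h4.le
  have h6 : (((N i e).toNat : ℤ) : ℝ) = N i e := by rw [Int.toNat_of_nonneg h5]
  rw [← h6, Int.cast_natCast]

end Count

/-! ### Bilipschitz bijections -/

section BiLip

variable {X Y Z : Type*} [MetricSpace X] [MetricSpace Y] [MetricSpace Z]

/-- `f` is a bilipschitz bijection from `A` onto `B` with constant `L`. -/
structure IsBiLip (L : ℝ) (f : X → Y) (A : Set X) (B : Set Y) : Prop where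
  bijOn : BijOn f A B
  le_mul : ∀ x ∈ A, ∀ y ∈ A, dist x y ≤ L * dist (f x) (f y)
  mul_le : ∀ x ∈ A, ∀ y ∈ A, dist (f x) (f y) ≤ L * dist x y

lemma IsBiLip.mono {L L' : ℝ} (hL : L ≤ L') {f : X → Y} {A : Set X} {B : Set Y}
    (h : IsBiLip L f A B) : IsBiLip L' f A B where
  bijOn := h.bijOn
  le_mul x hx y hy := (h.le_mul x hx y hy).trans
    (mul_le_mul_of_nonneg_right hL dist_nonneg)
  mul_le x hx y hy := (h.mul_le x hx y hy).trans
    (mul_le_mul_of_nonneg_right hL dist_nonneg)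

lemma IsBiLip.lipEquiv {L : ℝ} {f : X → Y} {A : Set X} {B : Set Y}
    (h : IsBiLip L f A B) : LipEquiv A B := by
  have h' := h.mono (le_max_left L 1)
  have h1 : (1 : ℝ) ≤ max L 1 := le_max_right _ _
  refine ⟨f, max L 1, h1, h.bijOn, fun x hx y hy => ⟨?_, h'.mul_le x hx y hy⟩⟩
  rw [inv_mul_le_iff₀ (by linarith)]
  exact h'.le_mul x hx y hy

lemma LipEquiv.exists_isBiLip {A : Set X} {B : Set Y} (h : LipEquiv A B) :
    ∃ (f : X → Y) (L : ℝ), 1 ≤ L ∧ IsBiLip L f A B := by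
  obtain ⟨f, L, hL, hf, h⟩ := h
  refine ⟨f, L, hL, hf, fun x hx y hy => ?_, fun x hx y hy => (h x hx y hy).2⟩
  rw [← inv_mul_le_iff₀ (by linarith)]
  exact (h x hx y hy).1

lemma IsBiLip.trans {L L' : ℝ} (hL : 0 ≤ L) (hL' : 0 ≤ L') {f : X → Y} {g : Y → Z} {A : Set X}
    {B : Set Y} {C : Set Z} (hf : IsBiLip L f A B) (hg : IsBiLip L' g B C) :
    IsBiLip (L * L') (g ∘ f) A C where
  bijOn := hg.bijOn.comp hf.bijOn
  le_mul x hx y hy := by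
    have h1 := hf.le_mul x hx y hy
    have h2 := hg.le_mul _ (hf.bijOn.mapsTo hx) _ (hf.bijOn.mapsTo hy)
    have := mul_le_mul_of_nonneg_left h2 hL
    simp only [Function.comp]
    linarith
  mul_le x hx y hy := by
    have h1 := hf.mul_le x hx y hy
    have h2 := hg.mul_le _ (hf.bijOn.mapsTo hx) _ (hf.bijOn.mapsTo hy)
    have := mul_le_mul_of_nonneg_left h1 hL'
    simp only [Function.comp]
    linarith

lemma IsBiLip.symm {L : ℝ} [Nonempty X] {f : X → Y} {A : Set X}
    {B : Set Y} (hf : IsBiLip L f A B) : IsBiLip L (Function.invFunOn f A) B A := by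
  have hinv : InvOn (Function.invFunOn f A) f A B := hf.bijOn.invOn_invFunOn
  have hb : BijOn (Function.invFunOn f A) B A :=
    hinv.symm.bijOn hf.bijOn.surjOn.mapsTo_invFunOn hf.bijOn.mapsTo
  refine ⟨hb, fun x hx y hy => ?_, fun x hx y hy => ?_⟩
  · have := hf.mul_le _ (hb.mapsTo hx) _ (hb.mapsTo hy)
    rwa [hinv.2 hx, hinv.2 hy] at this
  · have := hf.le_mul _ (hb.mapsTo hx) _ (hb.mapsTo hy)
    rwa [hinv.2 hx, hinv.2 hy] at this

lemma LipEquiv.symm [Nonempty X] {A : Set X} {B : Set Y} (h : LipEquiv A B) : LipEquiv B A := by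
  obtain ⟨f, L, _, hf⟩ := h.exists_isBiLip
  exact hf.symm.lipEquiv

lemma LipEquiv.trans {A : Set X} {B : Set Y} {C : Set Z} (h : LipEquiv A B) (h' : LipEquiv B C) :
    LipEquiv A C := by
  obtain ⟨f, L, hL, hf⟩ := h.exists_isBiLip
  obtain ⟨g, L', hL', hg⟩ := h'.exists_isBiLip
  exact (hf.trans (by linarith) (by linarith) hg).lipEquiv

end BiLip

lemma Set.Finite.exists_pos_le {α : Type*} {s : Set α} (hs : s.Finite) {η : α → ℝ}
    (h : ∀ x ∈ s, 0 < η x) : ∃ ε : ℝ, 0 < ε ∧ ∀ x ∈ s, ε ≤ η x := by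
  induction s, hs using Set.Finite.induction_on with
  | empty => exact ⟨1, one_pos, by simp⟩
  | @insert a s _ _ ih =>
    obtain ⟨ε, hε, h'⟩ := ih fun x hx => h x (Set.mem_insert_of_mem _ hx)
    refine ⟨min ε (η a), lt_min hε (h a (Set.mem_insert _ _)), ?_⟩
    rintro x (rfl | hx)
    · exact min_le_right _ _
    · exact (min_le_left _ _).trans (h' x hx)

lemma Set.Finite.exists_forall_le {α : Type*} {s : Set α} (hs : s.Finite) {P : α → ℕ → Prop}
    (h : ∀ x ∈ s, ∃ n, ∀ m, n ≤ m → P x m) : ∃ n, ∀ x ∈ s, ∀ m, n ≤ m → P x m := by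
  induction s, hs using Set.Finite.induction_on with
  | empty => exact ⟨0, by simp⟩
  | @insert a s _ _ ih =>
    obtain ⟨n, hn⟩ := ih fun x hx => h x (Set.mem_insert_of_mem _ hx)
    obtain ⟨n', hn'⟩ := h a (Set.mem_insert _ _)
    refine ⟨max n n', ?_⟩
    rintro x (rfl | hx) m hm
    · exact hn' m ((le_max_right _ _).trans hm)
    · exact hn x hx m ((le_max_left _ _).trans hm)

/-! ### Chains -/

section Chains

variable {X : Type*} [MetricSpace X]

/-- One step of size less than `ε` inside `A`. -/
def ChainStep (ε : ℝ) (A : Set X) (x y : X) : Prop := x ∈ A ∧ y ∈ A ∧ dist x y < ε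

/-- Chains in `A` of steps less than `e δ * s` have endpoints at distance at most `δ * s`. -/
def HasChainModulus (e : ℝ → ℝ) (s : ℝ) (A : Set X) : Prop :=
  ∀ δ, 0 < δ → ∀ x ∈ A, ∀ y, Relation.ReflTransGen (ChainStep (e δ * s) A) x y →
    dist x y ≤ δ * s

lemma ChainStep.mono {ε ε' : ℝ} (h : ε ≤ ε') {A : Set X} {x y : X} (hs : ChainStep ε A x y) :
    ChainStep ε' A x y := ⟨hs.1, hs.2.1, hs.2.2.trans_le h⟩

lemma chain_mono {ε ε' : ℝ} (h : ε ≤ ε') {A : Set X} {x y : X}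
    (hs : Relation.ReflTransGen (ChainStep ε A) x y) :
    Relation.ReflTransGen (ChainStep ε' A) x y :=
  Relation.ReflTransGen.mono (fun _ _ => ChainStep.mono h) _ _ hs

lemma exists_chainModulus_union (e : ℝ → ℝ) (he : ∀ δ, 0 < δ → 0 < e δ) (M : ℕ) :
    ∃ e' : ℝ → ℝ, (∀ δ, 0 < δ → 0 < e' δ) ∧ ∀ s, 0 < s → ∀ L : List (Set X), L.length ≤ M →
      (∀ K ∈ L, HasChainModulus e s K) → HasChainModulus e' s {x | ∃ K ∈ L, x ∈ K} := by
  induction M with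
  | zero =>
    refine ⟨fun _ => 1, fun _ _ => one_pos, fun s _ L hL _ => ?_⟩
    have : L = [] := List.length_eq_zero_iff.1 (by omega)
    subst this
    rintro δ _ x ⟨K, hK, _⟩
    exact absurd hK (List.not_mem_nil)
  | succ M ih =>
    obtain ⟨e₁, he₁, H⟩ := ih
    let d : ℝ → ℝ := fun δ => min (e (δ / 4) / 4) (δ / 8)
    have hd : ∀ δ, 0 < δ → 0 < d δ := fun δ hδ => by
      have := he (δ / 4) (by positivity)
      exact lt_min (by positivity) (by positivity)
    refine ⟨fun δ => min (e₁ (d δ)) (d δ), fun δ hδ => lt_min (he₁ _ (hd δ hδ)) (hd δ hδ), ?_⟩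
    intro s hs L hL hK
    match L with
    | [] =>
      rintro δ _ x ⟨K, hK, _⟩
      exact absurd hK (List.not_mem_nil)
    | K :: L =>
      have HU := H s hs L (by simpa using hL) fun K' hK' => hK K' (List.mem_cons_of_mem _ hK')
      have HK := hK K List.mem_cons_self
      set U : Set X := {x | ∃ K ∈ L, x ∈ K} with hU
      intro δ hδ x hx y hxy
      have hmem : ∀ z : X, z ∈ {x | ∃ K' ∈ K :: L, x ∈ K'} → z ∈ K ∨ z ∈ U := by
        rintro z ⟨K', hK', hz⟩
        rcases List.mem_cons.1 hK' with rfl | h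
        · exact Or.inl hz
        · exact Or.inr ⟨K', h, hz⟩
      set ε := min (e₁ (d δ)) (d δ) * s with hε
      have hε1 : ε ≤ e₁ (d δ) * s := mul_le_mul_of_nonneg_right (min_le_left _ _) hs.le
      have hε2 : ε ≤ d δ * s := mul_le_mul_of_nonneg_right (min_le_right _ _) hs.le
      have hds : 0 < d δ * s := mul_pos (hd δ hδ) hs
      have hd1 : 4 * (d δ * s) ≤ e (δ / 4) * s := by
        have : d δ ≤ e (δ / 4) / 4 := min_le_left _ _
        nlinarith
      have hd2 : 8 * (d δ * s) ≤ δ * s := by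
        have : d δ ≤ δ / 8 := min_le_right _ _
        nlinarith
      have hUd : ∀ u ∈ U, ∀ v, Relation.ReflTransGen (ChainStep ε U) u v →
          dist u v ≤ d δ * s := fun u hu v huv => HU (d δ) (hd δ hδ) u hu v (chain_mono hε1 huv)
      have key : (x ∈ U ∧ Relation.ReflTransGen (ChainStep ε U) x y) ∨
          ∃ k₀ ∈ K, ∃ k₁ ∈ K, dist x k₀ ≤ d δ * s + ε ∧
            Relation.ReflTransGen (ChainStep (e (δ / 4) * s) K) k₀ k₁ ∧
            (y = k₁ ∨ ∃ u ∈ U, dist k₁ u < ε ∧ Relation.ReflTransGen (ChainStep ε U) u y) := by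
        have hε0 : 0 < ε := mul_pos (lt_min (he₁ _ (hd δ hδ)) (hd δ hδ)) hs
        induction hxy with
        | refl =>
          rcases hmem x hx with h | h
          · exact Or.inr ⟨x, h, x, h, by simp; positivity, .refl, Or.inl rfl⟩
          · exact Or.inl ⟨h, .refl⟩
        | tail hab hbc ihc =>
          rename_i b c
          have hbc' := hbc.2.2
          have memU : ∀ v ∈ U, ∀ t, Relation.ReflTransGen (ChainStep ε U) v t → t ∈ U := by
            intro v hv t ht
            cases ht with
            | refl => exact hv
            | tail _ h => exact h.2.1
          rcases ihc with ⟨hxU, hxb⟩ | ⟨k₀, hk₀, k₁, hk₁, h1, h2, h3⟩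
          · by_cases hcU : c ∈ U
            · exact Or.inl ⟨hxU, hxb.tail ⟨memU x hxU b hxb, hcU, hbc'⟩⟩
            · have hcK := (hmem c hbc.2.1).resolve_right hcU
              refine Or.inr ⟨c, hcK, c, hcK, ?_, .refl, Or.inl rfl⟩
              have := dist_triangle x b c
              have := hUd x hxU b hxb
              linarith
          · refine Or.inr ?_
            by_cases hcU : c ∈ U
            · refine ⟨k₀, hk₀, k₁, hk₁, h1, h2, Or.inr ?_⟩
              rcases h3 with rfl | ⟨u, hu, h4, h5⟩
              · exact ⟨c, hcU, hbc', .refl⟩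
              · exact ⟨u, hu, h4, h5.tail ⟨memU u hu b h5, hcU, hbc'⟩⟩
            · have hcK := (hmem c hbc.2.1).resolve_right hcU
              refine ⟨k₀, hk₀, c, hcK, h1, h2.tail ⟨hk₁, hcK, ?_⟩, Or.inl rfl⟩
              rcases h3 with rfl | ⟨u, hu, h4, h5⟩
              · linarith
              · have := dist_triangle4 k₁ u b c
                have := hUd u hu b h5
                linarith
      rcases key with ⟨hxU, hxy'⟩ | ⟨k₀, hk₀, k₁, hk₁, h1, h2, h3⟩
      · have := hUd x hxU y hxy'
        nlinarith
      · have h4 := HK (δ / 4) (by positivity) k₀ hk₀ k₁ h2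
        have h5 : dist k₁ y ≤ d δ * s + ε := by
          rcases h3 with rfl | ⟨u, hu, h4, h5⟩
          · simp; have : 0 < ε := mul_pos (lt_min (he₁ _ (hd δ hδ)) (hd δ hδ)) hs
            positivity
          · have := dist_triangle k₁ u y
            have := hUd u hu y h5
            linarith
        have := dist_triangle4 x k₀ k₁ y
        linarith

lemma IsClopen.exists_dist_lt [CompactSpace X] {U : Set X} (hU : IsClopen U) :
    ∃ ε : ℝ, 0 < ε ∧ ∀ x ∈ U, ∀ y, dist x y < ε → y ∈ U := by
  obtain ⟨ε, hε, h⟩ := hU.1.isCompact.exists_thickening_subset_open hU.2 subset_rfl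
  refine ⟨ε, hε, fun x hx y hxy => h ?_⟩
  rw [mem_thickening_iff]
  exact ⟨x, hx, by rwa [dist_comm]⟩

lemma exists_chain_dist_le [CompactSpace X] [TotallyDisconnectedSpace X] {δ : ℝ} (hδ : 0 < δ) :
    ∃ ε : ℝ, 0 < ε ∧ ∀ x y : X, Relation.ReflTransGen (ChainStep ε univ) x y → dist x y ≤ δ := by
  have hU : ∀ x : X, ∃ U : Set X, IsClopen U ∧ x ∈ U ∧ U ⊆ ball x (δ / 2) := fun x => by
    obtain ⟨U, hU, hx, hs⟩ := compact_exists_isClopen_in_isOpen (isOpen_ball (x := x) (ε := δ / 2))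
      (mem_ball_self (half_pos hδ))
    exact ⟨U, hU, hx, hs⟩
  choose U hUc hUx hUs using hU
  choose η hη hηU using fun x => (hUc x).exists_dist_lt
  obtain ⟨t, ht⟩ := isCompact_univ.elim_finite_subcover U (fun x => (hUc x).2)
    (fun x _ => mem_iUnion.2 ⟨x, hUx x⟩)
  obtain ⟨ε, hε, hεt⟩ := t.finite_toSet.exists_pos_le fun x _ => hη x
  refine ⟨ε, hε, fun x y hxy => ?_⟩
  obtain ⟨a, hat, hxa⟩ := mem_iUnion₂.1 (ht (mem_univ x))
  have : y ∈ U a := by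
    induction hxy with
    | refl => exact hxa
    | tail _ h ih => exact hηU a _ ih _ (h.2.2.trans_le (hεt a hat))
  have h1 := mem_ball.1 (hUs a this)
  have h2 := mem_ball.1 (hUs a hxa)
  have := dist_triangle_right x y a
  linarith

end Chains

/-! ### Self-similar systems -/

/-- Composition of the maps along a word. -/
def wordMap {ι X : Type*} (f : ι → X → X) : List ι → X → X
  | [] => id
  | i :: w => f i ∘ wordMap f w

/-- A self-similar structure with commensurable ratios on a metric space, together with its
natural measure and bounded overlaps at every scale. -/
structure SimSys (X : Type*) [MetricSpace X] [MeasurableSpace X] (r p : ℝ) where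
  ι : Type
  fin : Fintype ι
  lam : ι → ℕ
  lam_pos : ∀ i, 0 < lam i
  gcd_lam : Finset.univ.gcd lam = 1
  r_pos : 0 < r
  r_lt_one : r < 1
  p_pos : 0 < p
  p_lt_one : p < 1
  sum_p : ∑ i, p ^ lam i = 1
  f : ι → X → X
  dist_f : ∀ i x y, dist (f i x) (f i y) = r ^ lam i * dist x y
  cover : ∀ x, ∃ i y, f i y = x
  μ : Measure X
  prob : IsProbabilityMeasure μ
  inv : ∀ A, MeasurableSet A → μ.real A = ∑ i, p ^ lam i * μ.real (f i ⁻¹' A)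
  overlap : ∀ C : ℝ, ∃ M : ℕ, ∀ (k : ℕ) (x : X) (s : Finset (List ι)),
    (∀ w ∈ s, IsCut lam w k ∧ ∃ y, dist (wordMap f w y) x ≤ C * r ^ k) → s.card ≤ M

namespace SimSys

attribute [instance] SimSys.fin SimSys.prob

variable {X : Type*} [MetricSpace X] [MeasurableSpace X] {r p : ℝ} (D : SimSys X r p)

/-- The weight of a word. -/
abbrev wt (w : List D.ι) : ℕ := wordWt D.lam w

@[simp] lemma wt_nil : D.wt [] = 0 := rfl

@[simp] lemma wt_cons (i : D.ι) (w : List D.ι) : D.wt (i :: w) = D.lam i + D.wt w :=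
  wordWt_cons i w

@[simp] lemma wt_append (u v : List D.ι) : D.wt (u ++ v) = D.wt u + D.wt v :=
  wordWt_append u v

/-- The similarity attached to a word. -/
abbrev S (w : List D.ι) : X → X := wordMap D.f w

/-- The cylinder of a word. -/
abbrev cyl (w : List D.ι) : Set X := range (D.S w)

/-- The largest exponent. -/
def l : ℕ := Finset.univ.sup D.lam

/-- The measure of a set as a real number. -/
def m (A : Set X) : ℝ := D.μ.real A

lemma lam_le (i : D.ι) : D.lam i ≤ D.l := Finset.le_sup (Finset.mem_univ i)

lemma nonempty_index : Nonempty D.ι := by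
  by_contra h
  rw [not_nonempty_iff] at h
  have := D.sum_p
  simp at this

lemma exists_lam_eq : ∃ j, D.lam j = D.l := by
  have := D.nonempty_index
  obtain ⟨j, -, hj⟩ := Finset.exists_mem_eq_sup Finset.univ Finset.univ_nonempty D.lam
  exact ⟨j, hj.symm⟩

lemma l_pos : 0 < D.l := by
  obtain ⟨j, hj⟩ := D.exists_lam_eq
  exact hj ▸ D.lam_pos j

lemma exists_ne_index (i : D.ι) : ∃ j, j ≠ i := by
  by_contra h
  push Not at h
  have h1 := D.sum_p
  have h2 : (Finset.univ : Finset D.ι) = {i} := by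
    ext j; simp [h j]
  rw [h2, Finset.sum_singleton] at h1
  have := pow_lt_one₀ D.p_pos.le D.p_lt_one (D.lam_pos i).ne'
  linarith

lemma S_append (u v : List D.ι) (x : X) : D.S (u ++ v) x = D.S u (D.S v x) := by
  induction u with
  | nil => rfl
  | cons i u ih => exact congrArg (D.f i) ih

lemma dist_S (w : List D.ι) (x y : X) : dist (D.S w x) (D.S w y) = r ^ D.wt w * dist x y := by
  induction w with
  | nil => simp [wordMap]
  | cons i w ih =>
    have : dist (D.S (i :: w) x) (D.S (i :: w) y) = dist (D.f i (D.S w x)) (D.f i (D.S w y)) := rfl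
    rw [this, D.dist_f, ih, wt_cons, pow_add, mul_assoc]

lemma rpow_pos (D : SimSys X r p) (k : ℕ) : 0 < r ^ k := pow_pos D.r_pos k

lemma ppow_pos (D : SimSys X r p) (k : ℕ) : 0 < p ^ k := pow_pos D.p_pos k

lemma rpow_le (D : SimSys X r p) {j k : ℕ} (h : j ≤ k) : r ^ k ≤ r ^ j :=
  pow_le_pow_of_le_one D.r_pos.le D.r_lt_one.le h

lemma ppow_le (D : SimSys X r p) {j k : ℕ} (h : j ≤ k) : p ^ k ≤ p ^ j :=
  pow_le_pow_of_le_one D.p_pos.le D.p_lt_one.le h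

lemma rpow_le_one (D : SimSys X r p) (k : ℕ) : r ^ k ≤ 1 := pow_le_one₀ D.r_pos.le D.r_lt_one.le

lemma injective_S (w : List D.ι) : Function.Injective (D.S w) := by
  intro x y h
  have := D.dist_S w x y
  rw [h, dist_self] at this
  exact dist_eq_zero.1 ((mul_eq_zero.1 this.symm).resolve_left (D.rpow_pos _).ne')

lemma continuous_S (w : List D.ι) : Continuous (D.S w) := by
  refine (LipschitzWith.of_dist_le_mul (K := ⟨r ^ D.wt w, (D.rpow_pos _).le⟩)
    fun x y => ?_).continuous
  exact (D.dist_S w x y).le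

lemma cyl_append_subset (u v : List D.ι) : D.cyl (u ++ v) ⊆ D.cyl u := by
  rintro _ ⟨x, rfl⟩
  exact ⟨D.S v x, (D.S_append u v x).symm⟩

lemma exists_cut_mem (k : ℕ) (x : X) : ∃ w, IsCut D.lam w k ∧ x ∈ D.cyl w := by
  induction k using Nat.strong_induction_on generalizing x with
  | _ k ih =>
    rcases Nat.eq_zero_or_pos k with rfl | hk
    · exact ⟨[], rfl, x, rfl⟩
    · obtain ⟨i, y, rfl⟩ := D.cover x
      obtain ⟨w, hw, z, rfl⟩ := ih (k - D.lam i) (by have := D.lam_pos i; omega) y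
      exact ⟨i :: w, ⟨hk, hw⟩, z, rfl⟩

lemma cut_le_wt {w : List D.ι} {k : ℕ} (h : IsCut D.lam w k) : k ≤ D.wt w := h.le_wordWt

lemma cut_wt_lt {w : List D.ι} {k : ℕ} (h : IsCut D.lam w k) : D.wt w < k + D.l :=
  h.wordWt_lt D.lam_le D.l_pos

/-! #### Measure -/

lemma m_nonneg (A : Set X) : 0 ≤ D.m A := measureReal_nonneg

lemma m_univ : D.m univ = 1 := by simp [m]

lemma m_empty : D.m ∅ = 0 := by simp [m]

lemma m_mono {A B : Set X} (h : A ⊆ B) : D.m A ≤ D.m B := measureReal_mono h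

lemma m_union {A B : Set X} (h : Disjoint A B) (hB : MeasurableSet B) :
    D.m (A ∪ B) = D.m A + D.m B := measureReal_union h hB

lemma m_diff {A B : Set X} (h : B ⊆ A) (hB : MeasurableSet B) :
    D.m (A \ B) = D.m A - D.m B := measureReal_sdiff h hB

lemma m_biUnion {α : Type*} (s : Finset α) (A : α → Set X)
    (h : ∀ i ∈ s, ∀ j ∈ s, i ≠ j → Disjoint (A i) (A j)) (hA : ∀ i ∈ s, MeasurableSet (A i)) :
    D.m (⋃ i ∈ s, A i) = ∑ i ∈ s, D.m (A i) :=
  measureReal_biUnion_finset (fun i hi j hj hij => h i hi j hj hij) hA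

variable [BorelSpace X]

lemma m_eq_sum_cut (k : ℕ) {A : Set X} (hA : MeasurableSet A) :
    D.m A = ∑ w ∈ cutSet D.lam k, p ^ D.wt w * D.m (D.S w ⁻¹' A) := by
  induction k using Nat.strong_induction_on generalizing A with
  | _ k ih =>
    rcases Nat.eq_zero_or_pos k with rfl | hk
    · rw [cutSet_zero D.lam_pos]
      simp [wordMap]
    · rw [sum_cutSet D.lam_pos hk, m, D.inv A hA]
      refine Finset.sum_congr rfl fun i _ => ?_
      have hi : MeasurableSet (D.f i ⁻¹' A) := (D.continuous_S [i]).measurable hA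
      have := ih (k - D.lam i) (by have := D.lam_pos i; omega) hi
      rw [← m, this, Finset.mul_sum]
      refine Finset.sum_congr rfl fun w _ => ?_
      rw [wt_cons, pow_add, mul_assoc]
      rfl

lemma le_m_cyl [CompactSpace X] (w : List D.ι) : p ^ D.wt w ≤ D.m (D.cyl w) := by
  have hc : MeasurableSet (D.cyl w) := (isCompact_range (D.continuous_S w)).isClosed.measurableSet
  rw [D.m_eq_sum_cut (D.wt w) hc]
  have hw : w ∈ cutSet D.lam (D.wt w) :=
    (mem_cutSet D.lam_pos).2 (isCut_wordWt D.lam_pos w)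
  refine le_trans (le_of_eq ?_) (Finset.single_le_sum
    (f := fun w' => p ^ D.wt w' * D.m (D.S w' ⁻¹' D.cyl w))
    (fun w' _ => mul_nonneg (D.ppow_pos _).le (D.m_nonneg _)) hw)
  rw [show D.S w ⁻¹' D.cyl w = univ by ext x; simp, D.m_univ, mul_one]

/-! #### Uniform disconnectedness -/

variable [CompactSpace X]

lemma exists_dist_le (X : Type*) [MetricSpace X] [CompactSpace X] :
    ∃ C : ℝ, 1 ≤ C ∧ ∀ x y : X, dist x y ≤ C :=
  ⟨Metric.diam (univ : Set X) + 1, by linarith [Metric.diam_nonneg (s := (univ : Set X))],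
    fun x y => by
      have := Metric.dist_le_diam_of_mem (isCompact_univ (X := X)).isBounded (mem_univ x)
        (mem_univ y)
      linarith⟩

variable [TotallyDisconnectedSpace X]

lemma exists_chain_const (D : SimSys X r p) : ∃ c : ℝ, 0 < c ∧ c ≤ 1 ∧ ∀ (k : ℕ) (x y : X),
    Relation.ReflTransGen (ChainStep (c * r ^ k) univ) x y → dist x y ≤ r ^ k := by
  have hbase : ∀ δ : ℝ, ∃ ε : ℝ, 0 < δ → 0 < ε ∧ ∀ x y : X,
      Relation.ReflTransGen (ChainStep ε univ) x y → dist x y ≤ δ := fun δ => by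
    by_cases hδ : 0 < δ
    · obtain ⟨ε, h⟩ := exists_chain_dist_le (X := X) hδ
      exact ⟨ε, fun _ => h⟩
    · exact ⟨0, fun h => absurd h hδ⟩
  choose ε₀ hε₀ using hbase
  have hlpos := D.rpow_pos D.l
  have hcyl : ∀ k w, IsCut D.lam w k →
      HasChainModulus (fun δ => r ^ D.l * ε₀ δ) (r ^ k) (D.cyl w) := by
    rintro k w hw δ hδ _ ⟨a, rfl⟩ y hy
    have hwt := D.rpow_pos (D.wt w)
    obtain ⟨b, rfl, hb⟩ : ∃ b, D.S w b = y ∧ Relation.ReflTransGen (ChainStep (ε₀ δ) univ) a b := by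
      induction hy with
      | refl => exact ⟨a, rfl, .refl⟩
      | tail _ h ih =>
        obtain ⟨b, rfl, hb⟩ := ih
        obtain ⟨-, ⟨c, rfl⟩, hbc⟩ := h
        refine ⟨c, rfl, hb.tail ⟨mem_univ _, mem_univ _, ?_⟩⟩
        rw [D.dist_S] at hbc
        have h1 : r ^ D.l * r ^ k ≤ r ^ D.wt w := by
          rw [← pow_add]
          exact D.rpow_le (by have := D.cut_wt_lt hw; omega)
        have h2 := mul_le_mul_of_nonneg_right h1 (hε₀ δ hδ).1.le
        have h3 : r ^ D.wt w * dist b c < r ^ D.wt w * ε₀ δ := by linarith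
        exact lt_of_mul_lt_mul_left h3 hwt.le
    rw [D.dist_S, mul_comm]
    exact mul_le_mul ((hε₀ δ hδ).2 _ _ hb) (D.rpow_le (D.cut_le_wt hw)) hwt.le hδ.le
  obtain ⟨M, hM⟩ := D.overlap 2
  obtain ⟨e', he', H⟩ := exists_chainModulus_union (X := X) (fun δ => r ^ D.l * ε₀ δ)
    (fun δ hδ => mul_pos hlpos (hε₀ δ hδ).1) M
  refine ⟨min (e' 1) 1, lt_min (he' 1 one_pos) one_pos, min_le_right _ _, fun k x y hxy => ?_⟩
  have hk := D.rpow_pos k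
  classical
  let F := (cutSet D.lam k).filter fun w => ∃ y, dist (D.S w y) x ≤ 2 * r ^ k
  have hF : F.card ≤ M := hM k x F fun w hw => by
    obtain ⟨h1, h2⟩ := Finset.mem_filter.1 hw
    exact ⟨(mem_cutSet D.lam_pos).1 h1, h2⟩
  have hmod := H (r ^ k) hk (F.toList.map D.cyl) (by simpa using hF) (by
    intro K hK
    obtain ⟨w, hw, rfl⟩ := List.mem_map.1 hK
    rw [Finset.mem_toList] at hw
    exact hcyl k w ((mem_cutSet D.lam_pos).1 (Finset.mem_filter.1 hw).1))
  set U := {x | ∃ K ∈ F.toList.map D.cyl, x ∈ K} with hU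
  have hmemU : ∀ z, dist z x ≤ 2 * r ^ k → z ∈ U := by
    intro z hz
    obtain ⟨w, hw, y, rfl⟩ := D.exists_cut_mem k z
    refine ⟨D.cyl w, List.mem_map.2 ⟨w, Finset.mem_toList.2 ?_, rfl⟩, ⟨y, rfl⟩⟩
    exact Finset.mem_filter.2 ⟨(mem_cutSet D.lam_pos).2 hw, y, hz⟩
  have hxU := hmemU x (by simp; positivity)
  have key : Relation.ReflTransGen (ChainStep (e' 1 * r ^ k) U) x y ∧ dist x y ≤ 1 * r ^ k := by
    induction hxy with
    | refl => exact ⟨.refl, by simp; positivity⟩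
    | @tail b c _ h ih =>
      have h1 : min (e' 1) 1 * r ^ k ≤ e' 1 * r ^ k :=
        mul_le_mul_of_nonneg_right (min_le_left _ _) hk.le
      have h2 : min (e' 1) 1 * r ^ k ≤ 1 * r ^ k :=
        mul_le_mul_of_nonneg_right (min_le_right _ _) hk.le
      have h3 := h.2.2
      have h4 := dist_triangle x b c
      have h5 := ih.2
      have hb := hmemU b (by rw [dist_comm]; linarith)
      have hc := hmemU c (by rw [dist_comm]; linarith)
      have := ih.1.tail (c := c) ⟨hb, hc, by linarith⟩
      exact ⟨this, hmod 1 one_pos x hxU c this⟩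
  simpa using key.2

end SimSys

namespace SimSys

variable {X : Type*} [MetricSpace X] [MeasurableSpace X] {r p : ℝ} (D : SimSys X r p)
  [BorelSpace X] [CompactSpace X] [TotallyDisconnectedSpace X]

/-! #### Separated sets -/

/-- The constant of uniform disconnectedness. -/
def c : ℝ := D.exists_chain_const.choose

lemma c_pos : 0 < D.c := D.exists_chain_const.choose_spec.1

lemma c_le_one : D.c ≤ 1 := D.exists_chain_const.choose_spec.2.1

lemma dist_le_of_chain {k : ℕ} {x y : X}
    (h : Relation.ReflTransGen (ChainStep (D.c * r ^ k) univ) x y) : dist x y ≤ r ^ k :=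
  D.exists_chain_const.choose_spec.2.2 k x y h

/-- A bound for the diameter of the space. -/
def diamBd (_ : SimSys X r p) : ℝ := (exists_dist_le X).choose

lemma one_le_diamBd : 1 ≤ D.diamBd := (exists_dist_le X).choose_spec.1

lemma dist_le_diamBd (x y : X) : dist x y ≤ D.diamBd := (exists_dist_le X).choose_spec.2 x y

lemma dist_le_of_mem_cyl {w : List D.ι} {x y : X} (hx : x ∈ D.cyl w) (hy : y ∈ D.cyl w) :
    dist x y ≤ D.diamBd * r ^ D.wt w := by
  obtain ⟨a, rfl⟩ := hx
  obtain ⟨b, rfl⟩ := hy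
  rw [D.dist_S, mul_comm]
  exact mul_le_mul_of_nonneg_right (D.dist_le_diamBd a b) (D.rpow_pos _).le

/-- The set `A` is separated from its complement at scale `r ^ k`. -/
def Sat (k : ℕ) (A : Set X) : Prop := ∀ x ∈ A, ∀ y, dist x y < D.c * r ^ k → y ∈ A

variable {D}

lemma Sat.mono {j k : ℕ} (h : j ≤ k) {A : Set X} (hA : D.Sat j A) : D.Sat k A :=
  fun x hx y hy => hA x hx y (hy.trans_le (mul_le_mul_of_nonneg_left (D.rpow_le h) D.c_pos.le))

lemma Sat.compl {k : ℕ} {A : Set X} (hA : D.Sat k A) : D.Sat k Aᶜ :=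
  fun x hx y hy hyA => hx (hA y hyA x (by rwa [dist_comm]))

lemma Sat.inter {k : ℕ} {A B : Set X} (hA : D.Sat k A) (hB : D.Sat k B) : D.Sat k (A ∩ B) :=
  fun x hx y hy => ⟨hA x hx.1 y hy, hB x hx.2 y hy⟩

lemma Sat.diff {k : ℕ} {A B : Set X} (hA : D.Sat k A) (hB : D.Sat k B) : D.Sat k (A \ B) :=
  hA.inter hB.compl

lemma Sat.union {k : ℕ} {A B : Set X} (hA : D.Sat k A) (hB : D.Sat k B) : D.Sat k (A ∪ B) :=
  fun x hx y hy => hx.imp (fun h => hA x h y hy) (fun h => hB x h y hy)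

lemma Sat.biUnion {α : Type*} {s : Set α} {k : ℕ} {A : α → Set X}
    (h : ∀ i ∈ s, D.Sat k (A i)) : D.Sat k (⋃ i ∈ s, A i) := by
  intro x hx y hy
  obtain ⟨i, hi, hx⟩ := mem_iUnion₂.1 hx
  exact mem_iUnion₂.2 ⟨i, hi, h i hi x hx y hy⟩

lemma Sat.isOpen {k : ℕ} {A : Set X} (hA : D.Sat k A) : IsOpen A := by
  rw [Metric.isOpen_iff]
  refine fun x hx => ⟨D.c * r ^ k, mul_pos D.c_pos (D.rpow_pos k), fun y hy => hA x hx y ?_⟩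
  rwa [dist_comm]

lemma Sat.isClosed {k : ℕ} {A : Set X} (hA : D.Sat k A) : IsClosed A :=
  isOpen_compl_iff.1 hA.compl.isOpen

lemma Sat.isClopen {k : ℕ} {A : Set X} (hA : D.Sat k A) : IsClopen A := ⟨hA.isClosed, hA.isOpen⟩

lemma Sat.measurableSet {k : ℕ} {A : Set X} (hA : D.Sat k A) : MeasurableSet A :=
  hA.isClosed.measurableSet

lemma Sat.le_dist {k : ℕ} {A : Set X} (hA : D.Sat k A) {x y : X} (hx : x ∈ A) (hy : y ∉ A) :
    D.c * r ^ k ≤ dist x y := by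
  by_contra h
  exact hy (hA x hx y (not_le.1 h))

variable (D)

lemma sat_univ (k : ℕ) : D.Sat k univ := fun _ _ _ _ => mem_univ _

lemma sat_empty (k : ℕ) : D.Sat k ∅ := fun _ h => h.elim

lemma exists_rpow_lt (D : SimSys X r p) {ε : ℝ} (hε : 0 < ε) : ∃ n, ∀ m, n ≤ m → r ^ m < ε := by
  obtain ⟨n, hn⟩ := exists_pow_lt_of_lt_one hε D.r_lt_one
  exact ⟨n, fun m hm => (D.rpow_le hm).trans_lt hn⟩

lemma exists_sat_of_isClopen {A : Set X} (hA : IsClopen A) : ∃ n, ∀ k, n ≤ k → D.Sat k A := by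
  obtain ⟨ε, hε, h⟩ := hA.exists_dist_lt
  obtain ⟨n, hn⟩ := D.exists_rpow_lt hε
  refine ⟨n, fun k hk x hx y hxy => h x hx y (hxy.trans_le ?_)⟩
  have := hn k hk
  nlinarith [D.c_le_one, D.rpow_pos k]

lemma exists_cyl_scale : ∃ n, D.diamBd * r ^ n < D.c := by
  have h := one_pos.trans_le D.one_le_diamBd
  obtain ⟨n, hn⟩ := D.exists_rpow_lt (div_pos D.c_pos h)
  exact ⟨n, by have := hn n le_rfl; rwa [lt_div_iff₀ h, mul_comm] at this⟩

/-- Cylinders `n₀` levels below are smaller than the separation. -/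
def n₀ : ℕ := D.exists_cyl_scale.choose

lemma n₀_spec : D.diamBd * r ^ D.n₀ < D.c := D.exists_cyl_scale.choose_spec

variable {D}

lemma Sat.cyl_subset {k : ℕ} {A : Set X} (hA : D.Sat k A) {w : List D.ι} (hw : k + D.n₀ ≤ D.wt w)
    {x : X} (hx : x ∈ D.cyl w) (hxA : x ∈ A) : D.cyl w ⊆ A := by
  intro y hy
  refine hA x hxA y ((D.dist_le_of_mem_cyl hx hy).trans_lt ?_)
  have h1 := D.rpow_le hw
  rw [pow_add] at h1
  have h2 := mul_lt_mul_of_pos_right D.n₀_spec (D.rpow_pos k)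
  have h3 := mul_le_mul_of_nonneg_left h1 (by linarith [D.one_le_diamBd] : 0 ≤ D.diamBd)
  linarith

open scoped Classical in
lemma Sat.m_eq {k : ℕ} {A : Set X} (hA : D.Sat k A) :
    D.m A = ∑ w ∈ (cutSet D.lam (k + D.n₀)).filter (fun w => D.cyl w ⊆ A), p ^ D.wt w := by
  rw [D.m_eq_sum_cut (k + D.n₀) hA.measurableSet, Finset.sum_filter]
  refine Finset.sum_congr rfl fun w hw => ?_
  rw [mem_cutSet D.lam_pos] at hw
  split_ifs with h
  · have : D.S w ⁻¹' A = univ := eq_univ_of_forall fun x => h ⟨x, rfl⟩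
    rw [this, D.m_univ, mul_one]
  · have : D.S w ⁻¹' A = ∅ := by
      by_contra hne
      obtain ⟨x, hx⟩ := nonempty_iff_ne_empty.2 hne
      exact h (hA.cyl_subset (D.cut_le_wt hw) ⟨x, rfl⟩ hx)
    rw [this, D.m_empty, mul_zero]

lemma Sat.eq_biUnion {k : ℕ} {A : Set X} (hA : D.Sat k A) :
    A = ⋃ w ∈ {w | IsCut D.lam w (k + D.n₀) ∧ D.cyl w ⊆ A}, D.cyl w := by
  refine Subset.antisymm (fun x hx => ?_) (iUnion₂_subset fun w hw => hw.2)
  obtain ⟨w, hw, hxw⟩ := D.exists_cut_mem (k + D.n₀) x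
  exact mem_iUnion₂.2 ⟨w, ⟨hw, hA.cyl_subset (D.cut_le_wt hw) hxw hx⟩, hxw⟩

variable (D)

lemma finite_sat (k : ℕ) : {A | D.Sat k A}.Finite := by
  have h1 : {w | IsCut D.lam w (k + D.n₀)}.Finite := by
    refine (cutSet D.lam (k + D.n₀)).finite_toSet.subset fun w hw => ?_
    exact (mem_cutSet D.lam_pos).2 hw
  refine (h1.finite_subsets.image fun s => ⋃ w ∈ s, D.cyl w).subset fun A hA => ?_
  exact ⟨_, fun w hw => hw.1, (Sat.eq_biUnion hA).symm⟩

variable {D}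

lemma Sat.m_eq_comb {k : ℕ} {A : Set X} (hA : D.Sat k A) :
    ∃ N : ℕ → ℕ, D.m A = p ^ k * ∑ i ∈ Finset.range D.l, N i * p ^ (D.n₀ + i) := by
  classical
  rw [hA.m_eq]
  set F := (cutSet D.lam (k + D.n₀)).filter fun w => D.cyl w ⊆ A
  refine ⟨fun i => (F.filter fun w => D.wt w = k + D.n₀ + i).card, ?_⟩
  have hF : ∀ w ∈ F, ∃ i < D.l, D.wt w = k + D.n₀ + i := fun w hw => by
    have hw := (mem_cutSet D.lam_pos).1 (Finset.mem_filter.1 hw).1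
    have h1 := D.cut_le_wt hw
    have h2 := D.cut_wt_lt hw
    exact ⟨D.wt w - (k + D.n₀), by omega, by omega⟩
  rw [Finset.mul_sum]
  have : ∀ i, p ^ k * (((F.filter fun w => D.wt w = k + D.n₀ + i).card : ℝ) * p ^ (D.n₀ + i)) =
      ∑ w ∈ F, if D.wt w = k + D.n₀ + i then p ^ D.wt w else 0 := fun i => by
    rw [← Finset.sum_filter, Finset.sum_congr rfl (g := fun _ => p ^ (k + D.n₀ + i)),
      Finset.sum_const, nsmul_eq_mul, add_assoc, pow_add p k]
    · ring
    · intro w hw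
      rw [(Finset.mem_filter.1 hw).2]
  simp only [this]
  rw [Finset.sum_comm]
  refine Finset.sum_congr rfl fun w hw => ?_
  obtain ⟨i, hi, hwi⟩ := hF w hw
  rw [Finset.sum_eq_single i]
  · rw [if_pos hwi]
  · intro j _ hj
    rw [if_neg (by omega)]
  · intro h
    exact absurd (Finset.mem_range.2 hi) h

lemma Sat.le_m {k : ℕ} {A : Set X} (hA : D.Sat k A) (hne : A.Nonempty) :
    p ^ (k + D.n₀ + D.l) ≤ D.m A := by
  obtain ⟨x, hx⟩ := hne
  obtain ⟨w, hw, hxw⟩ := D.exists_cut_mem (k + D.n₀) x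
  have h1 := D.m_mono (hA.cyl_subset (D.cut_le_wt hw) hxw hx)
  have h2 := D.le_m_cyl w
  exact (D.ppow_le (D.cut_wt_lt hw).le).trans (h2.trans h1)

lemma Sat.m_pos {k : ℕ} {A : Set X} (hA : D.Sat k A) (hne : A.Nonempty) : 0 < D.m A :=
  (D.ppow_pos _).trans_le (hA.le_m hne)

lemma Sat.mem_Zring {k : ℕ} {A : Set X} (hA : D.Sat k A) : D.m A ∈ Zring p := by
  classical
  rw [hA.m_eq]
  exact Subring.sum_mem _ fun w _ => Subring.pow_mem _ (mem_Zring_self p) _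

variable (D)

lemma exists_m_le (C : ℝ) : ∃ M : ℝ, 0 < M ∧ ∀ (k : ℕ) (A : Set X), MeasurableSet A →
    (∀ x ∈ A, ∀ y ∈ A, dist x y ≤ C * r ^ k) → D.m A ≤ M * p ^ k := by
  classical
  obtain ⟨M, hM⟩ := D.overlap C
  refine ⟨M + 1, by positivity, fun k A hA hd => ?_⟩
  have hk := D.ppow_pos k
  rcases A.eq_empty_or_nonempty with rfl | ⟨x, hx⟩
  · rw [D.m_empty]; positivity
  rw [D.m_eq_sum_cut k hA]
  let F := (cutSet D.lam k).filter fun w => ∃ y, D.S w y ∈ A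
  have hF : F.card ≤ M := hM k x F fun w hw => by
    obtain ⟨h1, y, h2⟩ := Finset.mem_filter.1 hw
    exact ⟨(mem_cutSet D.lam_pos).1 h1, y, hd _ h2 _ hx⟩
  calc ∑ w ∈ cutSet D.lam k, p ^ D.wt w * D.m (D.S w ⁻¹' A)
      ≤ ∑ w ∈ cutSet D.lam k, if ∃ y, D.S w y ∈ A then p ^ k else 0 := by
        refine Finset.sum_le_sum fun w hw => ?_
        rw [mem_cutSet D.lam_pos] at hw
        split_ifs with h
        · have h1 : D.m (D.S w ⁻¹' A) ≤ 1 := D.m_univ ▸ D.m_mono (subset_univ _)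
          have h2 := D.ppow_le (D.cut_le_wt hw)
          nlinarith [D.ppow_pos (D.wt w)]
        · have : D.S w ⁻¹' A = ∅ := by
            by_contra hne
            obtain ⟨y, hy⟩ := nonempty_iff_ne_empty.2 hne
            exact h ⟨y, hy⟩
          rw [this, D.m_empty, mul_zero]
    _ = F.card * p ^ k := by rw [← Finset.sum_filter, Finset.sum_const, nsmul_eq_mul]
    _ ≤ (M + 1) * p ^ k := by
        have : (F.card : ℝ) ≤ M := by exact_mod_cast hF
        nlinarith

/-! #### Classes -/

/-- The chain class of a point at level `k`. -/
def cls (k : ℕ) (x : X) : Set X :=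
  {y | Relation.ReflTransGen (ChainStep (D.c * r ^ k) univ) x y}

lemma mem_cls_self (k : ℕ) (x : X) : x ∈ D.cls k x := Relation.ReflTransGen.refl

lemma sat_cls (k : ℕ) (x : X) : D.Sat k (D.cls k x) :=
  fun _ hy _ hyz => Relation.ReflTransGen.tail hy ⟨mem_univ _, mem_univ _, hyz⟩

lemma mem_cls_symm {k : ℕ} {x y : X} (h : y ∈ D.cls k x) : x ∈ D.cls k y := by
  induction h with
  | refl => exact D.mem_cls_self k x
  | tail _ h ih =>
    exact Relation.ReflTransGen.head ⟨h.2.1, h.1, by rw [dist_comm]; exact h.2.2⟩ ih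

lemma cls_eq_of_mem {k : ℕ} {x y : X} (h : y ∈ D.cls k x) : D.cls k y = D.cls k x := by
  ext z
  exact ⟨fun hz => Relation.ReflTransGen.trans h hz,
    fun hz => Relation.ReflTransGen.trans (D.mem_cls_symm h) hz⟩

lemma dist_le_of_mem_cls {k : ℕ} {x y z : X} (hy : y ∈ D.cls k x) (hz : z ∈ D.cls k x) :
    dist y z ≤ r ^ k :=
  D.dist_le_of_chain (Relation.ReflTransGen.trans (D.mem_cls_symm hy) hz)

variable {D} in
lemma Sat.cls_subset {k : ℕ} {A : Set X} (hA : D.Sat k A) {x : X} (hx : x ∈ A) :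
    D.cls k x ⊆ A := by
  intro y hy
  induction hy with
  | refl => exact hx
  | tail _ h ih => exact hA _ ih _ h.2.2

/-- The finite set of classes of level `k` meeting `A`. -/
def classes (k : ℕ) (A : Set X) : Finset (Set X) :=
  ((D.finite_sat k).subset (fun _ hR => by
    obtain ⟨x, -, rfl⟩ := hR
    exact D.sat_cls k x : D.cls k '' A ⊆ {A | D.Sat k A})).toFinset

lemma mem_classes {k : ℕ} {A R : Set X} : R ∈ D.classes k A ↔ ∃ x ∈ A, D.cls k x = R := by
  simp [classes]

lemma sat_of_mem_classes {k : ℕ} {A R : Set X} (h : R ∈ D.classes k A) : D.Sat k R := by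
  obtain ⟨x, -, rfl⟩ := D.mem_classes.1 h
  exact D.sat_cls k x

lemma nonempty_of_mem_classes {k : ℕ} {A R : Set X} (h : R ∈ D.classes k A) : R.Nonempty := by
  obtain ⟨x, -, rfl⟩ := D.mem_classes.1 h
  exact ⟨x, D.mem_cls_self k x⟩

lemma dist_le_of_mem_classes {k : ℕ} {A R : Set X} (h : R ∈ D.classes k A) {y z : X} (hy : y ∈ R)
    (hz : z ∈ R) : dist y z ≤ r ^ k := by
  obtain ⟨x, -, rfl⟩ := D.mem_classes.1 h
  exact D.dist_le_of_mem_cls hy hz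

lemma disjoint_of_mem_classes {k : ℕ} {A B R R' : Set X} (h : R ∈ D.classes k A)
    (h' : R' ∈ D.classes k B) (hne : R ≠ R') : Disjoint R R' := by
  obtain ⟨x, -, rfl⟩ := D.mem_classes.1 h
  obtain ⟨y, -, rfl⟩ := D.mem_classes.1 h'
  rw [Set.disjoint_left]
  intro z hz hz'
  exact hne ((D.cls_eq_of_mem hz).symm.trans (D.cls_eq_of_mem hz'))

variable {D} in
lemma Sat.subset_of_mem_classes {k : ℕ} {A R : Set X} (hA : D.Sat k A) (h : R ∈ D.classes k A) :
    R ⊆ A := by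
  obtain ⟨x, hx, rfl⟩ := D.mem_classes.1 h
  exact hA.cls_subset hx

variable {D} in
lemma Sat.biUnion_classes {k : ℕ} {A : Set X} (hA : D.Sat k A) : ⋃ R ∈ D.classes k A, R = A := by
  refine Subset.antisymm (iUnion₂_subset fun R hR => hA.subset_of_mem_classes hR) fun x hx => ?_
  exact mem_iUnion₂.2 ⟨_, D.mem_classes.2 ⟨x, hx, rfl⟩, D.mem_cls_self k x⟩

variable {D} in
lemma Sat.m_eq_sum_classes {k : ℕ} {A : Set X} (hA : D.Sat k A) :
    D.m A = ∑ R ∈ D.classes k A, D.m R := by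
  conv_lhs => rw [← hA.biUnion_classes]
  exact D.m_biUnion _ _ (fun R hR R' hR' h => D.disjoint_of_mem_classes hR hR' h)
    fun R hR => (D.sat_of_mem_classes hR).measurableSet

/-- The number of sets of level `k` in a disjoint family is controlled by measure. -/
lemma card_mul_le {k : ℕ} (s : Finset (Set X)) {B : Set X} (hB : ∀ R ∈ s, R ⊆ B)
    (hs : ∀ R ∈ s, D.Sat k R ∧ R.Nonempty) (hd : ∀ R ∈ s, ∀ R' ∈ s, R ≠ R' → Disjoint R R') :
    s.card * p ^ (k + D.n₀ + D.l) ≤ D.m B := by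
  have h1 : D.m (⋃ R ∈ s, R) ≤ D.m B := D.m_mono (iUnion₂_subset hB)
  rw [D.m_biUnion s _ hd fun R hR => (hs R hR).1.measurableSet] at h1
  refine le_trans ?_ h1
  rw [← nsmul_eq_mul]
  exact Finset.card_nsmul_le_sum _ _ _ fun R hR => (hs R hR).1.le_m (hs R hR).2

end SimSys

/-! ### Bilipschitz maps from matching tree structures -/

/-- A family of pairs of sets of comparable size, any of which splits into uniformly separated
pairs of the family at a fixed number of levels below. -/
structure IsSplitting {X Y : Type*} [MetricSpace X] [MetricSpace Y]
    (R : ℕ → Set X → Set Y → Prop) (ρ c C : ℝ) (h : ℕ) : Prop where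
  closed : ∀ k A B, R k A B → IsClosed A ∧ IsClosed B
  nonempty : ∀ k A B, R k A B → A.Nonempty ∧ B.Nonempty
  dist_le_left : ∀ k A B, R k A B → ∀ x ∈ A, ∀ y ∈ A, dist x y ≤ C * ρ ^ k
  dist_le_right : ∀ k A B, R k A B → ∀ x ∈ B, ∀ y ∈ B, dist x y ≤ C * ρ ^ k
  split : ∀ k A B, R k A B → ∃ (J : Type) (a : J → Set X) (b : J → Set Y),
    A = ⋃ j, a j ∧ B = ⋃ j, b j ∧
    (∀ i j, i ≠ j → ∀ x ∈ a i, ∀ y ∈ a j, c * ρ ^ k ≤ dist x y) ∧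
    (∀ i j, i ≠ j → ∀ x ∈ b i, ∀ y ∈ b j, c * ρ ^ k ≤ dist x y) ∧
    ∀ j, R (k + h) (a j) (b j)

namespace IsSplitting

variable {X Y : Type*} [MetricSpace X] [MetricSpace Y]
  {R : ℕ → Set X → Set Y → Prop} {ρ c C : ℝ} {h : ℕ}

/-- Choice of the pieces as a relation between pairs. -/
def Child (H : IsSplitting R ρ c C h) (N M : {N : ℕ × Set X × Set Y // R N.1 N.2.1 N.2.2}) :
    Prop :=
  ∃ j : (H.split _ _ _ N.2).choose, M.1 = (N.1.1 + h, (H.split _ _ _ N.2).choose_spec.choose j,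
    (H.split _ _ _ N.2).choose_spec.choose_spec.choose j)

variable (H : IsSplitting R ρ c C h) {N M M' : {N : ℕ × Set X × Set Y // R N.1 N.2.1 N.2.2}}

lemma Child.level {H : IsSplitting R ρ c C h} (hM : H.Child N M) : M.1.1 = N.1.1 + h := by
  obtain ⟨j, hj⟩ := hM
  rw [hj]

lemma Child.subset {H : IsSplitting R ρ c C h} (hM : H.Child N M) :
    M.1.2.1 ⊆ N.1.2.1 ∧ M.1.2.2 ⊆ N.1.2.2 := by
  obtain ⟨j, hj⟩ := hM
  have hs := (H.split _ _ _ N.2).choose_spec.choose_spec.choose_spec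
  rw [hj]
  exact ⟨(subset_iUnion _ j).trans hs.1.symm.subset, (subset_iUnion _ j).trans hs.2.1.symm.subset⟩

lemma Child.le_dist {H : IsSplitting R ρ c C h} (hM : H.Child N M) (hM' : H.Child N M')
    (hne : M ≠ M') :
    (∀ x ∈ M.1.2.1, ∀ y ∈ M'.1.2.1, c * ρ ^ N.1.1 ≤ dist x y) ∧
    (∀ x ∈ M.1.2.2, ∀ y ∈ M'.1.2.2, c * ρ ^ N.1.1 ≤ dist x y) := by
  obtain ⟨j, hj⟩ := hM
  obtain ⟨j', hj'⟩ := hM'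
  have hs := (H.split _ _ _ N.2).choose_spec.choose_spec.choose_spec
  have hjj : j ≠ j' := by
    rintro rfl
    exact hne (Subtype.ext (hj.trans hj'.symm))
  rw [hj, hj']
  exact ⟨hs.2.2.1 j j' hjj, hs.2.2.2.1 j j' hjj⟩

lemma exists_child_left (N : {N : ℕ × Set X × Set Y // R N.1 N.2.1 N.2.2}) {x : X}
    (hx : x ∈ N.1.2.1) : ∃ M, H.Child N M ∧ x ∈ M.1.2.1 := by
  have hs := (H.split _ _ _ N.2).choose_spec.choose_spec.choose_spec
  rw [hs.1] at hx
  obtain ⟨j, hj⟩ := mem_iUnion.1 hx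
  exact ⟨⟨_, hs.2.2.2.2 j⟩, ⟨j, rfl⟩, hj⟩

lemma exists_child_right (N : {N : ℕ × Set X × Set Y // R N.1 N.2.1 N.2.2}) {x : Y}
    (hx : x ∈ N.1.2.2) : ∃ M, H.Child N M ∧ x ∈ M.1.2.2 := by
  have hs := (H.split _ _ _ N.2).choose_spec.choose_spec.choose_spec
  rw [hs.2.1] at hx
  obtain ⟨j, hj⟩ := mem_iUnion.1 hx
  exact ⟨⟨_, hs.2.2.2.2 j⟩, ⟨j, rfl⟩, hj⟩

/-- A branch of the tree of pairs. -/
def Branch (N : {N : ℕ × Set X × Set Y // R N.1 N.2.1 N.2.2})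
    (s : ℕ → {N : ℕ × Set X × Set Y // R N.1 N.2.1 N.2.2}) : Prop :=
  s 0 = N ∧ ∀ n, H.Child (s n) (s (n + 1))

variable {s t : ℕ → {N : ℕ × Set X × Set Y // R N.1 N.2.1 N.2.2}}

lemma Branch.level {H : IsSplitting R ρ c C h} (hs : H.Branch N s) (n : ℕ) :
    (s n).1.1 = N.1.1 + n * h := by
  induction n with
  | zero => rw [hs.1]; simp
  | succ n ih => rw [(hs.2 n).level, ih]; ring

lemma exists_branch (P : {N : ℕ × Set X × Set Y // R N.1 N.2.1 N.2.2} → Prop)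
    (hP : ∀ N, P N → ∃ M, H.Child N M ∧ P M) (hN : P N) :
    ∃ s, H.Branch N s ∧ ∀ n, P (s n) := by
  choose! g hg using hP
  have hPs : ∀ n, P (g^[n] N) := fun n => by
    induction n with
    | zero => exact hN
    | succ n ih =>
      rw [Function.iterate_succ_apply']
      exact (hg _ ih).2
  refine ⟨fun n => g^[n] N, ⟨rfl, fun n => ?_⟩, hPs⟩
  simp only [Function.iterate_succ_apply']
  exact (hg _ (hPs n)).1

lemma Branch.exists_mem [CompactSpace X] [CompactSpace Y] {H : IsSplitting R ρ c C h}
    (hs : H.Branch N s) :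
    (∃ x, ∀ n, x ∈ (s n).1.2.1) ∧ (∃ y, ∀ n, y ∈ (s n).1.2.2) := by
  constructor
  · have := IsCompact.nonempty_iInter_of_sequence_nonempty_isCompact_isClosed
      (fun n => (s n).1.2.1) (fun n => (hs.2 n).subset.1) (fun n => (H.nonempty _ _ _ (s n).2).1)
      (H.closed _ _ _ (s 0).2).1.isCompact fun n => (H.closed _ _ _ (s n).2).1
    obtain ⟨x, hx⟩ := this
    exact ⟨x, mem_iInter.1 hx⟩
  · have := IsCompact.nonempty_iInter_of_sequence_nonempty_isCompact_isClosed
      (fun n => (s n).1.2.2) (fun n => (hs.2 n).subset.2) (fun n => (H.nonempty _ _ _ (s n).2).2)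
      (H.closed _ _ _ (s 0).2).2.isCompact fun n => (H.closed _ _ _ (s n).2).2
    obtain ⟨x, hx⟩ := this
    exact ⟨x, mem_iInter.1 hx⟩

lemma Branch.ne {H : IsSplitting R ρ c C h} (hs : H.Branch N s) (ht : H.Branch N t) (hne : s ≠ t) :
    ∃ n, s n = t n ∧ s (n + 1) ≠ t (n + 1) := by
  by_contra! hc
  refine hne (funext fun n => ?_)
  induction n with
  | zero => rw [hs.1, ht.1]
  | succ n ih => exact hc n ih

lemma Branch.eq {H : IsSplitting R ρ c C h} (hρ : 0 < ρ) (hρ1 : ρ < 1) (hh : 0 < h)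
    (hC : 0 < C) (hs : H.Branch N s) {Z : Type*} [MetricSpace Z] {x y : Z}
    (hd : ∀ n, dist x y ≤ C * ρ ^ (s n).1.1) : x = y := by
  by_contra hne
  obtain ⟨n, hn⟩ := exists_pow_lt_of_lt_one (div_pos (dist_pos.2 hne) hC) hρ1
  have h1 := hd n
  rw [hs.level] at h1
  have h2 : ρ ^ (N.1.1 + n * h) ≤ ρ ^ n :=
    pow_le_pow_of_le_one hρ.le hρ1.le (by nlinarith)
  rw [lt_div_iff₀ hC] at hn
  nlinarith

theorem exists_isBiLip [CompactSpace X] [CompactSpace Y] (H : IsSplitting R ρ c C h)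
    (hρ : 0 < ρ) (hρ1 : ρ < 1) (hh : 0 < h) (hc : 0 < c) (hC : 0 < C) {k : ℕ}
    {A : Set X} {B : Set Y} (hAB : R k A B) :
    ∃ φ : X → Y, IsBiLip (C / c) φ A B := by
  classical
  let N : {N : ℕ × Set X × Set Y // R N.1 N.2.1 N.2.2} := ⟨(k, A, B), hAB⟩
  have hbr : ∀ x, ∃ s, x ∈ A → H.Branch N s ∧ ∀ n, x ∈ (s n).1.2.1 := fun x => by
    by_cases hx : x ∈ A
    · obtain ⟨s, hs⟩ := H.exists_branch (N := N) (fun M => x ∈ M.1.2.1)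
        (fun M hM => H.exists_child_left M hM) hx
      exact ⟨s, fun _ => hs⟩
    · exact ⟨fun _ => N, fun h => absurd h hx⟩
  choose s hs using hbr
  obtain ⟨y₀, -⟩ := (H.nonempty _ _ _ hAB).2
  have hphi : ∀ x, ∃ y, x ∈ A → ∀ n, y ∈ (s x n).1.2.2 := fun x => by
    by_cases hx : x ∈ A
    · obtain ⟨y, hy⟩ := ((hs x hx).1.exists_mem).2
      exact ⟨y, fun _ => hy⟩
    · exact ⟨y₀, fun h => absurd h hx⟩
  choose φ hφ using hphi
  have hρk : ∀ j, 0 < ρ ^ j := fun j => pow_pos hρ j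
  have key : ∀ x ∈ A, ∀ x' ∈ A, s x ≠ s x' → ∃ n, c * ρ ^ n ≤ dist x x' ∧ dist x x' ≤ C * ρ ^ n ∧
      c * ρ ^ n ≤ dist (φ x) (φ x') ∧ dist (φ x) (φ x') ≤ C * ρ ^ n := by
    intro x hx x' hx' hne
    obtain ⟨n, hn, hn'⟩ := (hs x hx).1.ne (hs x' hx').1 hne
    have h1 := (hs x hx).1.2 n
    have h2 := (hs x' hx').1.2 n
    rw [← hn] at h2
    have h3 := h1.le_dist h2 hn'
    refine ⟨_, h3.1 _ ((hs x hx).2 _) _ ((hs x' hx').2 _),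
      H.dist_le_left _ _ _ (s x n).2 _ ((hs x hx).2 _) _ (hn ▸ (hs x' hx').2 _),
      h3.2 _ (hφ x hx _) _ (hφ x' hx' _),
      H.dist_le_right _ _ _ (s x n).2 _ (hφ x hx _) _ (hn ▸ hφ x' hx' _)⟩
  have key' : ∀ x ∈ A, ∀ x' ∈ A, s x = s x' → x = x' := fun x hx x' hx' he =>
    (hs x hx).1.eq hρ hρ1 hh hC fun n => H.dist_le_left _ _ _ (s x n).2 _ ((hs x hx).2 _) _
      (he ▸ (hs x' hx').2 _)
  have hdiv : ∀ {a b d : ℝ}, a ≤ C * d → c * d ≤ b → a ≤ C / c * b := fun {a b d} h1 h2 => by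
    rw [div_mul_eq_mul_div, le_div_iff₀ hc]
    nlinarith
  refine ⟨φ, ⟨?_, ?_, ?_⟩, ?_, ?_⟩
  · intro x hx
    have := hφ x hx 0
    rwa [(hs x hx).1.1] at this
  · intro x hx x' hx' he
    by_contra hne
    obtain ⟨n, -, -, h3, -⟩ := key x hx x' hx' fun h => hne (key' x hx x' hx' h)
    rw [he, dist_self] at h3
    have := mul_pos hc (hρk n)
    linarith
  · intro y hy
    obtain ⟨t, ht, hty⟩ := H.exists_branch (N := N) (fun M => y ∈ M.1.2.2)
      (fun M hM => H.exists_child_right M hM) hy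
    obtain ⟨x, hx⟩ := ht.exists_mem.1
    have hxA : x ∈ A := by
      have := hx 0
      rwa [ht.1] at this
    have hst : s x = t := by
      by_contra hne
      obtain ⟨n, hn, hn'⟩ := (hs x hxA).1.ne ht hne
      have h1 := (hs x hxA).1.2 n
      have h2 := ht.2 n
      rw [← hn] at h2
      have h3 := (h1.le_dist h2 hn').1 _ ((hs x hxA).2 _) _ (hx _)
      rw [dist_self] at h3
      have := mul_pos hc (hρk (s x n).1.1)
      linarith
    refine ⟨x, hxA, ?_⟩
    exact ht.eq hρ hρ1 hh hC fun n => H.dist_le_right _ _ _ (t n).2 _ (hst ▸ hφ x hxA n) _ (hty n)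
  · intro x hx x' hx'
    by_cases he : s x = s x'
    · rw [key' x hx x' hx' he]; simp
    · obtain ⟨n, h1, h2, h3, h4⟩ := key x hx x' hx' he
      exact hdiv h2 h3
  · intro x hx x' hx'
    by_cases he : s x = s x'
    · rw [key' x hx x' hx' he]; simp
    · obtain ⟨n, h1, h2, h3, h4⟩ := key x hx x' hx' he
      exact hdiv h4 h1

end IsSplitting

/-! ### Islands -/

namespace SimSys

variable {X : Type*} [MetricSpace X] [MeasurableSpace X] {r p : ℝ} (D : SimSys X r p)

/-- A clopen set, containing a cylinder, whose copies are uniformly separated from their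
complements. -/
structure Island where
  F : Set X
  word : List D.ι
  c : ℝ
  c_pos : 0 < c
  isClopen : IsClopen F
  cyl_subset : D.cyl word ⊆ F
  le_dist : ∀ u, ∀ x ∈ F, ∀ y, y ∉ D.S u '' F → c * r ^ D.wt u ≤ dist (D.S u x) y
  disjoint : ∀ u u', ¬ u <+: u' → ¬ u' <+: u → Disjoint (D.S u '' F) (D.cyl u')

open scoped Classical in
/-- The words of level `k` whose cylinders are close to a given cylinder of that level. -/
def near (w : List D.ι) : Finset (List D.ι) :=
  (cutSet D.lam (D.wt w)).filter fun v => ∃ a b, dist (D.S v a) (D.S w b) < r ^ D.wt w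

lemma mem_near {w v : List D.ι} : v ∈ D.near w ↔
    IsCut D.lam v (D.wt w) ∧ ∃ a b, dist (D.S v a) (D.S w b) < r ^ D.wt w := by
  classical
  simp [near, mem_cutSet D.lam_pos]

lemma append_mem_near (u : List D.ι) {w v : List D.ι} (h : v ∈ D.near w) :
    u ++ v ∈ D.near (u ++ w) := by
  obtain ⟨h1, a, b, hab⟩ := D.mem_near.1 h
  refine D.mem_near.2 ⟨?_, a, b, ?_⟩
  · rw [wt_append]
    exact h1.append' D.lam_pos
  · rw [D.S_append, D.S_append, D.dist_S, wt_append, pow_add]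
    exact mul_lt_mul_of_pos_left hab (D.rpow_pos _)

lemma exists_card_near_le [BorelSpace X] [CompactSpace X] [TotallyDisconnectedSpace X]
    [Nonempty X] :
    ∃ M, ∀ w, (D.near w).card ≤ M := by
  obtain ⟨M, hM⟩ := D.overlap (1 + D.diamBd)
  refine ⟨M, fun w => ?_⟩
  obtain ⟨b₀⟩ := ‹Nonempty X›
  refine hM (D.wt w) (D.S w b₀) _ fun v hv => ?_
  obtain ⟨h1, a, b, hab⟩ := D.mem_near.1 hv
  refine ⟨h1, a, ?_⟩
  have h2 := dist_triangle (D.S v a) (D.S w b) (D.S w b₀)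
  have h3 := D.dist_le_of_mem_cyl (w := w) ⟨b, rfl⟩ ⟨b₀, rfl⟩
  linarith

lemma exists_near_append [BorelSpace X] [CompactSpace X] [TotallyDisconnectedSpace X] [Nonempty X] :
    ∃ w, ∀ u v, v ∈ D.near (u ++ w) → u <+: v := by
  classical
  obtain ⟨M, hM⟩ := D.exists_card_near_le
  have hbdd : BddAbove (range fun w => (D.near w).card) := ⟨M, by rintro _ ⟨w, rfl⟩; exact hM w⟩
  obtain ⟨w, hw⟩ := Nat.sSup_mem (range_nonempty fun w : List D.ι => (D.near w).card) hbdd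
  refine ⟨w, fun u v hv => ?_⟩
  have h1 : (D.near w).image (u ++ ·) ⊆ D.near (u ++ w) := by
    intro v hv
    obtain ⟨v', hv', rfl⟩ := Finset.mem_image.1 hv
    exact D.append_mem_near u hv'
  have h2 : (D.near (u ++ w)).card ≤ ((D.near w).image (u ++ ·)).card := by
    rw [Finset.card_image_of_injective _ (List.append_right_injective u)]
    exact (le_csSup hbdd ⟨u ++ w, rfl⟩).trans hw.ge
  rw [← Finset.eq_of_subset_of_card_le h1 h2] at hv
  obtain ⟨v', -, rfl⟩ := Finset.mem_image.1 hv
  exact List.prefix_append u v'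

variable [BorelSpace X] [CompactSpace X] [TotallyDisconnectedSpace X]

lemma nonempty_island [Nonempty X] : Nonempty D.Island := by
  obtain ⟨w, hw⟩ := D.exists_near_append
  obtain ⟨a, ha⟩ := D.exists_rpow_lt (one_half_pos (α := ℝ))
  have ha := ha a le_rfl
  set k := D.wt w + a with hk
  let F : Set X := {x | ∃ b, x ∈ D.cls k (D.S w b)}
  have hF : D.Sat k F := by
    rintro x ⟨b, hb⟩ y hxy
    exact ⟨b, D.sat_cls k _ x hb y hxy⟩
  have hd : ∀ u, ∀ x ∈ F, ∃ b, dist (D.S u x) (D.S (u ++ w) b) < r ^ D.wt (u ++ w) / 2 := by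
    rintro u x ⟨b, hb⟩
    refine ⟨b, ?_⟩
    have h1 := D.dist_le_of_mem_cls hb (D.mem_cls_self k _)
    rw [hk, pow_add] at h1
    rw [D.S_append, D.dist_S, wt_append, pow_add, mul_div_assoc]
    refine mul_lt_mul_of_pos_left (h1.trans_lt ?_) (D.rpow_pos _)
    rw [div_eq_mul_one_div]
    exact mul_lt_mul_of_pos_left ha (D.rpow_pos _)
  have hpre : ∀ u z v, IsCut D.lam v (D.wt (u ++ w)) → z ∈ D.cyl v →
      (∃ b, dist z (D.S (u ++ w) b) < r ^ D.wt (u ++ w)) → u <+: v := by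
    rintro u _ v hv ⟨y, rfl⟩ ⟨b, hb⟩
    exact hw u v (D.mem_near.2 ⟨hv, y, b, hb⟩)
  refine ⟨⟨F, w, D.c * r ^ k, mul_pos D.c_pos (D.rpow_pos k), hF.isClopen, ?_, ?_, ?_⟩⟩
  · rintro _ ⟨b, rfl⟩
    exact ⟨b, D.mem_cls_self _ _⟩
  · intro u x hx y hy
    by_contra! hlt
    obtain ⟨b, hb⟩ := hd u x hx
    have h1 := D.rpow_pos (D.wt u)
    have h2 : D.c * r ^ k ≤ r ^ D.wt w / 2 := by
      rw [hk, pow_add]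
      have := mul_lt_mul_of_pos_left ha (D.rpow_pos (D.wt w))
      have := mul_le_mul_of_nonneg_right D.c_le_one
        (mul_pos (D.rpow_pos (D.wt w)) (D.rpow_pos a)).le
      linarith
    have h3 : dist y (D.S (u ++ w) b) < r ^ D.wt (u ++ w) := by
      have h4 := dist_triangle y (D.S u x) (D.S (u ++ w) b)
      rw [dist_comm y (D.S u x)] at h4
      have h5 := mul_le_mul_of_nonneg_right h2 h1.le
      rw [wt_append, pow_add] at hb ⊢
      linarith
    obtain ⟨v, hv, hyv⟩ := D.exists_cut_mem (D.wt (u ++ w)) y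
    obtain ⟨t, rfl⟩ := hpre u y v hv hyv ⟨b, h3⟩
    obtain ⟨y', rfl⟩ := D.cyl_append_subset u t hyv
    refine hy ⟨y', hF x hx y' ?_, rfl⟩
    rw [D.dist_S, mul_comm] at hlt
    exact lt_of_mul_lt_mul_right hlt h1.le
  · intro u u' h1 h2
    rw [Set.disjoint_left]
    rintro _ ⟨x, hx, rfl⟩ ⟨b, hbz⟩
    obtain ⟨d, hdx⟩ := hd u x hx
    have hlt : dist (D.S u x) (D.S (u ++ w) d) < r ^ D.wt (u ++ w) :=
      hdx.trans (half_lt_self (D.rpow_pos _))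
    rcases le_total (D.wt (u ++ w)) (D.wt u') with hle | hle
    · obtain ⟨v, hv, s, rfl⟩ := exists_prefix_isCut hle
      have := hpre u _ v hv (D.cyl_append_subset v s ⟨b, hbz⟩) ⟨d, hlt⟩
      exact h1 (this.trans (List.prefix_append v s))
    · obtain ⟨v, hv, y, rfl⟩ := D.exists_cut_mem (D.wt (u ++ w) - D.wt u') b
      have hv' := hv.append' D.lam_pos (u := u')
      rw [show wordWt D.lam u' = D.wt u' from rfl, Nat.add_sub_cancel' hle] at hv'
      have := hpre u _ _ hv' ⟨y, by rw [D.S_append]; exact hbz⟩ ⟨d, hlt⟩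
      exact (isPrefix_total this (List.prefix_append u' v)).elim h1 h2

namespace Island

variable {D} (I : D.Island)

lemma nonempty [Nonempty X] : I.F.Nonempty := (range_nonempty _).mono I.cyl_subset

lemma exists_level : ∃ j, D.Sat j I.F ∧ D.c * r ^ j ≤ I.c := by
  obtain ⟨n, hn⟩ := D.exists_sat_of_isClopen I.isClopen
  obtain ⟨m, hm⟩ := D.exists_rpow_lt I.c_pos
  refine ⟨n + m, hn _ (by omega), ?_⟩
  have := hm (n + m) (by omega)
  nlinarith [D.c_le_one, D.rpow_pos (n + m)]

/-- A level at which the island and its copies are separated. -/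
def j : ℕ := I.exists_level.choose

lemma sat_F : D.Sat I.j I.F := I.exists_level.choose_spec.1

lemma c_mul_le : D.c * r ^ I.j ≤ I.c := I.exists_level.choose_spec.2

lemma sat_image {u : List D.ι} {k : ℕ} (hk : I.j ≤ k) {A : Set X} (hA : D.Sat k A)
    (hAF : A ⊆ I.F) : D.Sat (D.wt u + k) (D.S u '' A) := by
  rintro _ ⟨x, hx, rfl⟩ y hy
  have hu := D.rpow_pos (D.wt u)
  have hyF : y ∈ D.S u '' I.F := by
    by_contra h
    have h1 := I.le_dist u x (hAF hx) y h
    have h2 := I.c_mul_le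
    have h3 := mul_le_mul_of_nonneg_left (D.rpow_le hk) D.c_pos.le
    have h4 := mul_le_mul_of_nonneg_right (h3.trans h2) hu.le
    rw [pow_add] at hy
    linarith
  obtain ⟨y', -, rfl⟩ := hyF
  refine ⟨y', hA x hx y' ?_, rfl⟩
  rw [D.dist_S, pow_add] at hy
  refine lt_of_mul_lt_mul_left (a := r ^ D.wt u) ?_ hu.le
  linarith

lemma m_image (u : List D.ι) {A : Set X} (hA : IsClosed A) (hAF : A ⊆ I.F) :
    D.m (D.S u '' A) = p ^ D.wt u * D.m A := by
  have hc : MeasurableSet (D.S u '' A) :=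
    (hA.isCompact.image (D.continuous_S u)).isClosed.measurableSet
  rw [D.m_eq_sum_cut (D.wt u) hc, Finset.sum_eq_single u]
  · rw [preimage_image_eq _ (D.injective_S u)]
  · intro v hv hne
    have hv := (mem_cutSet D.lam_pos).1 hv
    have hu : IsCut D.lam u (D.wt u) := isCut_wordWt D.lam_pos u
    have hd := I.disjoint u v (fun h => hne (hu.eq_of_prefix_of_isCut hv h).symm)
      fun h => hne (hv.eq_of_prefix_of_isCut hu h)
    have : D.S v ⁻¹' (D.S u '' A) = ∅ := by
      by_contra h
      obtain ⟨x, hx⟩ := nonempty_iff_ne_empty.2 h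
      exact Set.disjoint_left.1 hd (image_mono hAF hx) ⟨x, rfl⟩
    rw [this, D.m_empty, mul_zero]
  · intro h
    exact absurd ((mem_cutSet D.lam_pos).2 (isCut_wordWt D.lam_pos u)) h

lemma disjoint_image {u u' : List D.ι} (h : ¬ u <+: u') (h' : ¬ u' <+: u) :
    Disjoint (D.S u '' I.F) ((D.S u') '' I.F) :=
  (I.disjoint u u' h h').mono_right (image_subset_range _ _)

lemma disjoint_image_of_wt_eq {u u' : List D.ι} (h : D.wt u = D.wt u') (hne : u ≠ u') :
    Disjoint (D.S u '' I.F) ((D.S u') '' I.F) := by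
  have hu : IsCut D.lam u (D.wt u) := isCut_wordWt D.lam_pos u
  have hu' : IsCut D.lam u' (D.wt u) := h ▸ isCut_wordWt D.lam_pos u'
  exact I.disjoint_image (fun hp => hne (hu.eq_of_prefix_of_isCut hu' hp))
    fun hp => hne (hu'.eq_of_prefix_of_isCut hu hp).symm

end Island

variable {D} in
lemma Sat.preimage {u : List D.ι} {k : ℕ} {A : Set X} (hA : D.Sat (D.wt u + k) A) :
    D.Sat k (D.S u ⁻¹' A) := by
  intro x hx y hy
  refine hA _ hx _ ?_
  rw [D.dist_S, pow_add]
  have := mul_lt_mul_of_pos_left hy (D.rpow_pos (D.wt u))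
  linarith

variable {D} in
/-- A nonempty separated set has many pieces at fine scales. -/
lemma Sat.exists_le_card_classes {k : ℕ} {A : Set X} (hA : D.Sat k A) (hne : A.Nonempty) (q : ℕ) :
    ∃ n, k ≤ n ∧ q ≤ (D.classes n A).card := by
  obtain ⟨M, hM, h⟩ := D.exists_m_le 1
  have hpos := hA.m_pos hne
  obtain ⟨n, hn⟩ := exists_pow_lt_of_lt_one (div_pos hpos (by positivity : 0 < (q + 1) * M))
    D.p_lt_one
  refine ⟨k + n, by omega, ?_⟩
  by_contra! hlt
  have h1 := (hA.mono (Nat.le_add_right k n)).m_eq_sum_classes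
  have h2 : D.m A ≤ (D.classes (k + n) A).card * (M * p ^ n) := by
    rw [h1, ← nsmul_eq_mul]
    refine Finset.sum_le_card_nsmul _ _ _ fun R hR => ?_
    refine (h (k + n) R (D.sat_of_mem_classes hR).measurableSet fun x hx y hy => ?_).trans ?_
    · rw [one_mul]; exact D.dist_le_of_mem_classes hR hx hy
    · exact mul_le_mul_of_nonneg_left (D.ppow_le (by omega)) hM.le
  have h3 : ((D.classes (k + n) A).card : ℝ) ≤ q + 1 := by
    exact_mod_cast (hlt.le.trans (Nat.le_succ q))
  rw [lt_div_iff₀ (by positivity)] at hn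
  have := mul_le_mul_of_nonneg_right h3 (mul_pos hM (D.ppow_pos n)).le
  linarith

variable {D} in
lemma Sat.exists_partition {k : ℕ} {A : Set X} (hA : D.Sat k A) (hne : A.Nonempty) {q : ℕ}
    (hq : 0 < q) : ∃ H : Fin q → Set X, ⋃ i, H i = A ∧
      (∀ i j, i ≠ j → Disjoint (H i) (H j)) ∧ ∀ i, (H i).Nonempty ∧ IsClopen (H i) := by
  classical
  obtain ⟨n, hn, hc⟩ := hA.exists_le_card_classes hne q
  have hA' := hA.mono hn
  have : Nonempty (Fin q) := ⟨⟨0, hq⟩⟩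
  obtain ⟨g⟩ : Nonempty (Fin q ↪ D.classes n A) :=
    Function.Embedding.nonempty_of_card_le (by simpa using hc)
  let e : Set X → Fin q := fun R =>
    if h : R ∈ D.classes n A then Function.invFun g ⟨R, h⟩ else ⟨0, hq⟩
  have hH : ∀ i, D.Sat n (⋃ R ∈ {R | R ∈ D.classes n A ∧ e R = i}, R) := fun i =>
    Sat.biUnion fun R hR => D.sat_of_mem_classes hR.1
  refine ⟨fun i => ⋃ R ∈ {R | R ∈ D.classes n A ∧ e R = i}, R, ?_, ?_, fun i =>
    ⟨?_, (hH i).isClopen⟩⟩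
  · conv_rhs => rw [← hA'.biUnion_classes]
    ext x
    simp
  · intro i j hij
    rw [Set.disjoint_left]
    intro x hx hx'
    obtain ⟨R, ⟨hR, rfl⟩, hxR⟩ := mem_iUnion₂.1 hx
    obtain ⟨R', ⟨hR', rfl⟩, hxR'⟩ := mem_iUnion₂.1 hx'
    have hne : R ≠ R' := by rintro rfl; exact hij rfl
    exact Set.disjoint_left.1 (D.disjoint_of_mem_classes hR hR' hne) hxR hxR'
  · obtain ⟨x, hx⟩ := D.nonempty_of_mem_classes (g i).2
    refine ⟨x, mem_iUnion₂.2 ⟨(g i).1, ⟨(g i).2, ?_⟩, hx⟩⟩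
    simp [e, Function.leftInverse_invFun g.injective i]

end SimSys

/-! ### Absorbing clopen pieces by shifting -/

/-- A bilipschitz bijection removing the first of a sequence of disjoint similar copies. -/
lemma exists_isBiLip_shift {X : Type*} [MetricSpace X] {K F : Set X} {T : ℕ → X → X} {ρ : ℕ → ℝ}
    {c C Λ : ℝ} (hc : 0 < c) (hC : 0 ≤ C) (hρ : ∀ n, 0 < ρ n)
    (hT : ∀ n x y, dist (T n x) (T n y) = ρ n * dist x y) (hanti : Antitone ρ)
    (hΛ : ∀ n, ρ n ≤ Λ * ρ (n + 1))
    (hsep : ∀ n, ∀ x ∈ K, ∀ y, y ∉ T n '' K → c * ρ n ≤ dist (T n x) y)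
    (hdisj : ∀ m n, m ≠ n → Disjoint (T m '' K) (T n '' K))
    (hmv : ∀ n, ∀ x ∈ K, dist (T n x) (T (n + 1) x) ≤ C * ρ n) (hF : ∀ n, T n '' K ⊆ F) :
    ∃ (φ : X → X) (L : ℝ), IsBiLip L φ F (F \ T 0 '' K) := by
  classical
  have hinj : ∀ n, Function.Injective (T n) := fun n x y h => by
    have := hT n x y
    rw [h, dist_self] at this
    exact dist_eq_zero.1 ((mul_eq_zero.1 this.symm).resolve_left (hρ n).ne')
  have hφ : ∀ x, ∃ z, (∀ n, ∀ a ∈ K, T n a = x → z = T (n + 1) a) ∧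
      ((∀ n, x ∉ T n '' K) → z = x) := fun x => by
    by_cases h : ∃ n, x ∈ T n '' K
    · obtain ⟨n, a, ha, rfl⟩ := h
      refine ⟨T (n + 1) a, fun m b hb hab => ?_, fun h => absurd ⟨a, ha, rfl⟩ (h n)⟩
      obtain rfl : m = n := by
        by_contra hne
        exact Set.disjoint_left.1 (hdisj m n hne) ⟨b, hb, rfl⟩ (hab ▸ ⟨a, ha, rfl⟩)
      rw [hinj m hab]
    · push Not at h
      exact ⟨x, fun n a ha hx => absurd ⟨a, ha, hx⟩ (h n), fun _ => rfl⟩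
  choose φ hφ1 hφ2 using hφ
  have hφT : ∀ n, ∀ a ∈ K, φ (T n a) = T (n + 1) a := fun n a ha => hφ1 _ n a ha rfl
  have hΛ1 : 1 ≤ Λ := by
    have h1 := hanti (Nat.le_succ 0)
    have h2 := hΛ 0
    have h3 := hρ 1
    simp only [zero_add, Nat.succ_eq_add_one] at h1 h2
    nlinarith
  have hnot : ∀ n y, y ∉ T n '' K → φ y ∉ T (n + 1) '' K := by
    rintro n y hy ⟨b, hb, hby⟩
    by_cases h : ∃ m, y ∈ T m '' K
    · obtain ⟨m, a, ha, rfl⟩ := h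
      rw [hφT m a ha] at hby
      have hmn : m ≠ n := by rintro rfl; exact hy ⟨a, ha, rfl⟩
      exact Set.disjoint_left.1 (hdisj (m + 1) (n + 1) (by omega)) ⟨a, ha, rfl⟩ ⟨b, hb, hby⟩
    · push Not at h
      rw [hφ2 y h] at hby
      exact h (n + 1) ⟨b, hb, hby⟩
  -- points in different copies
  have hcross : ∀ n, ∀ a ∈ K, ∀ y, y ∉ T n '' K → dist y (φ y) ≤ C * ρ n →
      dist (T n a) y ≤ (Λ + 2 * C * Λ / c) * dist (φ (T n a)) (φ y) ∧
      dist (φ (T n a)) (φ y) ≤ (Λ + 2 * C * Λ / c) * dist (T n a) y := by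
    intro n a ha y hy hmy
    have h1 := hsep n a ha y hy
    have h2 := hsep (n + 1) a ha _ (hnot n y hy)
    rw [hφT n a ha]
    have h3 := hmv n a ha
    have h4 := dist_triangle4 (T n a) (T (n + 1) a) (φ y) y
    have h5 := dist_triangle4 (T (n + 1) a) (T n a) y (φ y)
    rw [dist_comm (φ y) y] at h4
    rw [dist_comm (T (n + 1) a) (T n a)] at h5
    have h6 : ρ n ≤ Λ / c * dist (T (n + 1) a) (φ y) := by
      rw [div_mul_eq_mul_div, le_div_iff₀ hc]
      nlinarith [hΛ n]
    have h7 : ρ n ≤ Λ / c * dist (T n a) y := by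
      rw [div_mul_eq_mul_div, le_div_iff₀ hc]
      linarith [mul_le_mul_of_nonneg_right hΛ1 (dist_nonneg (x := T n a) (y := y))]
    have e : ∀ d, (Λ + 2 * C * Λ / c) * d = Λ * d + 2 * (C * (Λ / c * d)) := fun d => by ring
    rw [e, e]
    have h8 := mul_le_mul_of_nonneg_left h6 hC
    have h9 := mul_le_mul_of_nonneg_left h7 hC
    have h10 : ∀ d : ℝ, 0 ≤ d → d ≤ Λ * d := fun d hd => by nlinarith
    have h11 := h10 _ (dist_nonneg (x := T n a) (y := y))
    have h12 := h10 _ (dist_nonneg (x := T (n + 1) a) (y := φ y))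
    constructor <;> linarith
  have hL0 : 0 ≤ 2 * C * Λ / c := by positivity
  have hall : ∀ x y, dist x y ≤ (Λ + 2 * C * Λ / c) * dist (φ x) (φ y) ∧
      dist (φ x) (φ y) ≤ (Λ + 2 * C * Λ / c) * dist x y := by
    intro x y
    by_cases hx : ∃ n, x ∈ T n '' K
    · obtain ⟨n, a, ha, rfl⟩ := hx
      by_cases hy : ∃ m, y ∈ T m '' K
      · obtain ⟨m, b, hb, rfl⟩ := hy
        have hmv' : ∀ n m, n ≤ m → ∀ b ∈ K, dist (T m b) (φ (T m b)) ≤ C * ρ n :=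
            fun n m h b hb => by
          rw [hφT m b hb]
          exact (hmv m b hb).trans (mul_le_mul_of_nonneg_left (hanti h) hC)
        rcases lt_trichotomy n m with h | rfl | h
        · exact hcross n a ha _ (fun h' => Set.disjoint_left.1 (hdisj m n h.ne') ⟨b, hb, rfl⟩ h')
            (hmv' n m h.le b hb)
        · rw [hφT n a ha, hφT n b hb, hT, hT]
          have h1 := hΛ n
          have h2 := hanti (Nat.le_succ n)
          have h3 := dist_nonneg (x := a) (y := b)
          have h4 := mul_le_mul_of_nonneg_right h1 h3
          have h5 := mul_le_mul_of_nonneg_right h2 h3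
          have h6 := mul_nonneg (hρ n).le h3
          have h7 := mul_nonneg (hρ (n + 1)).le h3
          have h8 := mul_nonneg hL0 h6
          have h9 := mul_nonneg hL0 h7
          simp only [Nat.succ_eq_add_one] at h5
          constructor <;> nlinarith
        · have := hcross m b hb _ (fun h' => Set.disjoint_left.1 (hdisj n m h.ne') ⟨a, ha, rfl⟩ h')
            (hmv' m n h.le a ha)
          rw [dist_comm (T n a), dist_comm (φ (T n a))]
          exact this
      · push Not at hy
        refine hcross n a ha y (hy n) ?_
        rw [hφ2 y hy, dist_self]
        exact mul_nonneg hC (hρ n).le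
    · push Not at hx
      by_cases hy : ∃ m, y ∈ T m '' K
      · obtain ⟨m, b, hb, rfl⟩ := hy
        rw [dist_comm x, dist_comm (φ x)]
        refine hcross m b hb x (hx m) ?_
        rw [hφ2 x hx, dist_self]
        exact mul_nonneg hC (hρ m).le
      · push Not at hy
        rw [hφ2 x hx, hφ2 y hy]
        have h3 := dist_nonneg (x := x) (y := y)
        have h8 := mul_nonneg hL0 h3
        constructor <;> nlinarith
  refine ⟨φ, Λ + 2 * C * Λ / c, ⟨?_, ?_, ?_⟩, fun x _ y _ => (hall x y).1,
    fun x _ y _ => (hall x y).2⟩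
  · intro x hx
    by_cases h : ∃ n, x ∈ T n '' K
    · obtain ⟨n, a, ha, rfl⟩ := h
      rw [hφT n a ha]
      exact ⟨hF _ ⟨a, ha, rfl⟩, fun h' =>
        Set.disjoint_left.1 (hdisj (n + 1) 0 (by omega)) ⟨a, ha, rfl⟩ h'⟩
    · push Not at h
      rw [hφ2 x h]
      exact ⟨hx, h 0⟩
  · intro x _ y _ hxy
    have := (hall x y).1
    rw [hxy, dist_self, mul_zero] at this
    exact dist_le_zero.1 this
  · rintro y ⟨hy, hy0⟩
    by_cases h : ∃ n, y ∈ T n '' K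
    · obtain ⟨n, a, ha, rfl⟩ := h
      cases n with
      | zero => exact absurd ⟨a, ha, rfl⟩ hy0
      | succ n => exact ⟨T n a, hF n ⟨a, ha, rfl⟩, hφT n a ha⟩
    · push Not at h
      exact ⟨y, hy, hφ2 y h⟩

namespace SimSys

variable {X : Type*} [MetricSpace X] [MeasurableSpace X] {r p : ℝ} {D : SimSys X r p}
  [BorelSpace X] [CompactSpace X] [TotallyDisconnectedSpace X]

lemma Island.lipEquiv_of_isClopen (I : D.Island) {R : Set X} (hR : IsClopen R) (hne : R.Nonempty)
    (hRF : R ⊆ I.F) : LipEquiv R I.F := by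
  obtain ⟨x, hx⟩ := hne
  have : Nonempty X := ⟨x⟩
  obtain ⟨k, hk⟩ := D.exists_sat_of_isClopen hR
  have hk := hk k le_rfl
  obtain ⟨u, hu, hxu⟩ := D.exists_cut_mem (k + D.n₀) x
  have huR : D.cyl u ⊆ R := hk.cyl_subset (D.cut_le_wt hu) hxu hx
  obtain ⟨i⟩ := D.nonempty_index
  obtain ⟨j, hji⟩ := D.exists_ne_index i
  let wd : ℕ → List D.ι := fun n => Nat.casesOn n [] fun n => u ++ (List.replicate n i ++ [j])
  have hwd : ∀ n, wd (n + 1) = (u ++ List.replicate n i) ++ [j] := fun n => by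
    simp [wd]
  have hrep : ∀ n, D.wt (List.replicate n i) = n * D.lam i := fun n => by
    induction n with
    | zero => simp
    | succ n ih => rw [List.replicate_succ, wt_cons, ih]; ring
  have hwt : ∀ n, D.wt (wd (n + 1)) = D.wt u + n * D.lam i + D.lam j := fun n => by
    rw [hwd, wt_append, wt_append, hrep]; simp
  have hinc : ∀ m n, m < n → ¬ wd (m + 1) <+: wd (n + 1) ∧ ¬ wd (n + 1) <+: wd (m + 1) := by
    intro m n hmn
    obtain ⟨d, rfl⟩ := Nat.exists_eq_add_of_lt hmn
    rw [hwd, hwd]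
    constructor
    · rw [List.append_assoc, List.append_assoc, List.prefix_append_right_inj,
        show m + d + 1 = m + (d + 1) by ring, List.replicate_add, List.append_assoc,
        List.prefix_append_right_inj, List.replicate_succ, List.cons_append,
        List.cons_prefix_cons]
      exact fun h => hji h.1
    · intro h
      have := h.length_le
      simp at this
  set K := I.F \ R with hK
  have hKc : IsClopen K := I.isClopen.diff hR
  have hKF : K ⊆ I.F := sdiff_subset
  obtain ⟨a, ha⟩ := D.exists_sat_of_isClopen hKc
  have ha1 := ha (I.j + a) (by omega)
  have hwu : ∀ n, D.S (wd (n + 1)) '' K ⊆ D.cyl u := fun n => by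
    refine (image_subset_range _ _).trans ?_
    rw [hwd, List.append_assoc]
    exact D.cyl_append_subset u _
  have hdlt : ∀ m n, m < n → Disjoint (D.S (wd m) '' K) (D.S (wd n) '' K) := by
    intro m n hmn
    obtain ⟨n, rfl⟩ : ∃ n', n = n' + 1 := ⟨n - 1, by omega⟩
    cases m with
    | zero =>
      rw [Set.disjoint_left]
      rintro _ ⟨y, hy, rfl⟩ hy'
      exact hy.2 (huR (hwu n hy'))
    | succ m =>
      obtain ⟨h1, h2⟩ := hinc m n (by omega)
      exact (I.disjoint_image h1 h2).mono (image_mono hKF) (image_mono hKF)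
  have hle : ∀ n, D.wt (wd n) ≤ D.wt (wd (n + 1)) := fun n => by
    cases n with
    | zero => simp [wd]
    | succ n => rw [hwt, hwt]; nlinarith
  have hup : ∀ n, D.wt (wd (n + 1)) ≤ D.wt (wd n) + (D.wt u + D.lam i + D.lam j) := fun n => by
    cases n with
    | zero => rw [hwt]; omega
    | succ n => rw [hwt, hwt]; nlinarith
  set e := D.wt u + D.lam i + D.lam j with he
  obtain ⟨φ, L, hφ⟩ := exists_isBiLip_shift (K := K) (F := I.F) (T := fun n => D.S (wd n))
    (ρ := fun n => r ^ D.wt (wd n)) (c := D.c * r ^ (I.j + a)) (C := D.diamBd * (r ^ e)⁻¹)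
    (Λ := (r ^ e)⁻¹) (mul_pos D.c_pos (D.rpow_pos _))
    (mul_nonneg (zero_le_one.trans D.one_le_diamBd) (inv_nonneg.2 (D.rpow_pos e).le))
    (fun n => D.rpow_pos _) (fun n => D.dist_S (wd n))
    (antitone_nat_of_succ_le fun n => D.rpow_le (hle n))
    (fun n => by
      rw [le_inv_mul_iff₀ (D.rpow_pos e), ← pow_add, add_comm]
      exact D.rpow_le (hup n))
    (fun n x hx y hy => by
      have := (I.sat_image (u := wd n) (by omega) ha1 hKF).le_dist ⟨x, hx, rfl⟩ hy
      rw [pow_add] at this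
      calc _ = D.c * (r ^ D.wt (wd n) * r ^ (I.j + a)) := by ring
        _ ≤ _ := this)
    (fun m n hmn => (lt_or_gt_of_ne hmn).elim (hdlt m n) fun h => (hdlt n m h).symm)
    (fun n x hx => by
      have hb : 0 ≤ D.diamBd := zero_le_one.trans D.one_le_diamBd
      cases n with
      | zero =>
        have h1 := D.dist_le_diamBd (D.S (wd 0) x) (D.S (wd (0 + 1)) x)
        have h2 : (1 : ℝ) ≤ (r ^ e)⁻¹ := (one_le_inv₀ (D.rpow_pos e)).2 (D.rpow_le_one e)
        have h3 : D.wt (wd 0) = 0 := rfl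
        rw [h3, pow_zero, mul_one]
        exact h1.trans (le_mul_of_one_le_right hb h2)
      | succ n =>
        have h1 : D.S (wd (n + 1)) x ∈ D.cyl (u ++ List.replicate n i) := by
          rw [hwd]; exact D.cyl_append_subset _ _ ⟨x, rfl⟩
        have h2 : D.S (wd (n + 1 + 1)) x ∈ D.cyl (u ++ List.replicate n i) := by
          rw [hwd, List.replicate_succ', ← List.append_assoc, List.append_assoc]
          exact D.cyl_append_subset _ _ ⟨x, rfl⟩
        refine (D.dist_le_of_mem_cyl h1 h2).trans ?_
        rw [mul_assoc]
        refine mul_le_mul_of_nonneg_left ?_ hb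
        rw [le_inv_mul_iff₀ (D.rpow_pos e), ← pow_add]
        refine D.rpow_le ?_
        rw [hwt, wt_append, hrep]
        omega)
    (fun n => by
      cases n with
      | zero => exact (image_id _).subset.trans hKF
      | succ n => exact (hwu n).trans (huR.trans hRF))
  have h0 : I.F \ D.S (wd 0) '' K = R := by
    have : D.S (wd 0) '' K = K := image_id _
    rw [this, hK, sdiff_sdiff_cancel_left hRF]
  rw [h0] at hφ
  exact hφ.lipEquiv.symm

end SimSys

namespace SimSys

variable {X : Type*} [MetricSpace X] [MeasurableSpace X] {r p : ℝ} {D : SimSys X r p}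
  [BorelSpace X] [CompactSpace X] [TotallyDisconnectedSpace X]

namespace Island

variable (I : D.Island)

/-! #### Copies of the island exhaust the space in measure -/

/-- The points not covered by the copies of the island of level at most `n`. -/
def rest (n : ℕ) : Set X := {x | ∀ u, D.wt u ≤ n → x ∉ D.S u '' I.F}

lemma isOpen_image (u : List D.ι) : IsOpen (D.S u '' I.F) :=
  (I.sat_image le_rfl I.sat_F Subset.rfl).isOpen

lemma isClosed_rest (n : ℕ) : IsClosed (I.rest n) := by
  have : I.rest n = (⋃ u ∈ {u | D.wt u ≤ n}, D.S u '' I.F)ᶜ := by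
    ext x
    simp only [rest, mem_ofPred_eq, mem_compl_iff, mem_iUnion₂, not_exists]
  rw [this, isClosed_compl_iff]
  exact isOpen_biUnion fun u _ => I.isOpen_image u

lemma exists_m_rest_lt {ε : ℝ} (hε : 0 < ε) : ∃ n, D.m (I.rest n) < ε := by
  classical
  have hanti : Antitone I.rest := fun a b hab x hx u hu => hx u (hu.trans hab)
  set Z := ⋂ n, I.rest n with hZ
  have hZc : IsClosed Z := isClosed_iInter I.isClosed_rest
  have hpre : ∀ w, D.S w ⁻¹' Z ⊆ Z := by
    intro w x hx
    refine mem_iInter.2 fun n u _ => ?_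
    rintro ⟨y, hy, rfl⟩
    refine mem_iInter.1 hx (D.wt (w ++ u)) (w ++ u) le_rfl ⟨y, hy, ?_⟩
    rw [D.S_append]
  have hw : D.S I.word ⁻¹' Z = ∅ := by
    by_contra h
    obtain ⟨x, hx⟩ := nonempty_iff_ne_empty.2 h
    refine mem_iInter.1 hx 0 [] le_rfl ?_
    exact ⟨_, I.cyl_subset ⟨x, rfl⟩, rfl⟩
  have hcut : I.word ∈ cutSet D.lam (D.wt I.word) :=
    (mem_cutSet D.lam_pos).2 (isCut_wordWt D.lam_pos _)
  have h0 : D.m Z = 0 := by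
    have h1 := D.m_eq_sum_cut (D.wt I.word) hZc.measurableSet
    have h2 := sum_cutSet_pow D.lam_pos D.sum_p (D.wt I.word)
    rw [← Finset.add_sum_erase _ _ hcut] at h1 h2
    rw [hw, D.m_empty, mul_zero, zero_add] at h1
    have h3 : D.m Z ≤ (∑ w ∈ (cutSet D.lam (D.wt I.word)).erase I.word, p ^ D.wt w) * D.m Z := by
      rw [Finset.sum_mul]
      conv_lhs => rw [h1]
      exact Finset.sum_le_sum fun w _ =>
        mul_le_mul_of_nonneg_left (D.m_mono (hpre w)) (D.ppow_pos _).le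
    have h4 := D.ppow_pos (D.wt I.word)
    have h5 := D.m_nonneg Z
    have h6 : ∑ w ∈ (cutSet D.lam (D.wt I.word)).erase I.word, p ^ D.wt w
        = 1 - p ^ D.wt I.word := by linarith
    rw [h6] at h3
    nlinarith
  have ht : Filter.Tendsto (fun n => D.m (I.rest n)) Filter.atTop (nhds (D.m Z)) := by
    have := tendsto_measure_iInter_atTop (μ := D.μ)
      (fun n => (I.isClosed_rest n).measurableSet.nullMeasurableSet) hanti
      ⟨0, measure_ne_top _ _⟩
    exact (ENNReal.tendsto_toReal (measure_ne_top _ _)).comp this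
  rw [h0] at ht
  exact (ht.eventually_lt_const hε).exists

lemma exists_m_bad_le {ε : ℝ} (hε : 0 < ε) : ∃ n, ∀ (k : ℕ) (A B : Set X),
    (∀ x ∈ A, ∀ y ∈ A, dist x y ≤ D.diamBd * r ^ k) → B ⊆ A → MeasurableSet B →
    (∀ x ∈ B, ∀ u, k ≤ D.wt u → D.wt u ≤ k + n → x ∉ D.S u '' I.F) → D.m B ≤ ε * p ^ k := by
  classical
  obtain ⟨M, hM⟩ := D.overlap D.diamBd
  obtain ⟨n, hn⟩ := I.exists_m_rest_lt (div_pos hε (by positivity : (0 : ℝ) < M + 1))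
  refine ⟨D.l + n, fun k A B hA hBA hB hbad => ?_⟩
  rcases B.eq_empty_or_nonempty with rfl | ⟨x, hx⟩
  · rw [D.m_empty]
    exact (mul_pos hε (D.ppow_pos k)).le
  rw [D.m_eq_sum_cut k hB]
  let F := (cutSet D.lam k).filter fun w => ∃ y, D.S w y ∈ B
  have hF : F.card ≤ M := hM k x F fun w hw => by
    obtain ⟨h1, y, h2⟩ := Finset.mem_filter.1 hw
    exact ⟨(mem_cutSet D.lam_pos).1 h1, y, hA _ (hBA h2) _ (hBA hx)⟩
  have hk := D.ppow_pos k
  have hm0 := D.m_nonneg (I.rest n)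
  calc ∑ w ∈ cutSet D.lam k, p ^ D.wt w * D.m (D.S w ⁻¹' B)
      ≤ ∑ w ∈ cutSet D.lam k, if ∃ y, D.S w y ∈ B then p ^ k * D.m (I.rest n) else 0 := by
        refine Finset.sum_le_sum fun w hw => ?_
        rw [mem_cutSet D.lam_pos] at hw
        split_ifs with h
        · refine mul_le_mul (D.ppow_le (D.cut_le_wt hw)) (D.m_mono fun y hy u hu => ?_)
            (D.m_nonneg _) hk.le
          rintro ⟨z, hz, rfl⟩
          have h1 := D.cut_le_wt hw
          have h2 := D.cut_wt_lt hw
          refine hbad _ hy (w ++ u) ?_ ?_ ⟨z, hz, D.S_append w u z⟩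
          · rw [wt_append]; omega
          · rw [wt_append]; omega
        · have : D.S w ⁻¹' B = ∅ := by
            by_contra hne
            obtain ⟨y, hy⟩ := nonempty_iff_ne_empty.2 hne
            exact h ⟨y, hy⟩
          rw [this, D.m_empty, mul_zero]
    _ = F.card * (p ^ k * D.m (I.rest n)) := by
        rw [← Finset.sum_filter, Finset.sum_const, nsmul_eq_mul]
    _ ≤ (M + 1) * (p ^ k * D.m (I.rest n)) := by
        have : (F.card : ℝ) ≤ M + 1 := by exact_mod_cast hF.trans (Nat.le_succ M)
        exact mul_le_mul_of_nonneg_right this (mul_nonneg hk.le hm0)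
    _ ≤ ε * p ^ k := by
        rw [lt_div_iff₀ (by positivity)] at hn
        nlinarith

lemma exists_words_image_subset : ∃ (δ : ℝ) (J : ℕ), 0 < δ ∧ ∀ h, J ≤ h →
    ∃ V : Finset (List D.ι), δ ≤ V.card * p ^ h ∧ ∀ v ∈ V, D.wt v = h ∧ D.S v '' I.F ⊆ I.F := by
  classical
  obtain ⟨δ, J, hδ, hJ⟩ := exists_card_exactWords_ge D.lam_pos D.lam_le D.exists_lam_eq D.gcd_lam
    D.p_pos D.sum_p
  set K := D.wt I.word
  refine ⟨δ * p ^ K, J + K, mul_pos hδ (D.ppow_pos K), fun h hh => ?_⟩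
  refine ⟨(exactWords D.lam (h - K)).image (I.word ++ ·), ?_, ?_⟩
  · rw [Finset.card_image_of_injective _ (List.append_right_injective _)]
    have h1 := hJ (h - K) (by omega)
    have h2 := mul_le_mul_of_nonneg_right h1 (D.ppow_pos K).le
    rwa [mul_assoc, ← pow_add, Nat.sub_add_cancel (by omega)] at h2
  · intro v hv
    obtain ⟨v', hv', rfl⟩ := Finset.mem_image.1 hv
    have hv' := (mem_exactWords D.lam_pos).1 hv'
    refine ⟨?_, ?_⟩
    · rw [wt_append, show D.wt v' = h - K from hv']; omega
    · exact (image_subset_range _ _).trans ((D.cyl_append_subset _ _).trans I.cyl_subset)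

/-- A piece is good if it lies in a copy of the island of comparable size. -/
def Good (k h : ℕ) (R : Set X) : Prop := ∃ u, k ≤ D.wt u ∧ D.wt u ≤ k + h ∧ R ⊆ D.S u '' I.F

open scoped Classical in
lemma exists_good_scale : ∃ (h : ℕ) (V : Finset (List D.ι)) (Q : ℕ), 0 < h ∧
    (∀ v ∈ V, D.wt v = h ∧ D.S v '' I.F ⊆ I.F) ∧
    ∀ (k : ℕ) (A : Set X), A.Nonempty → D.Sat k A →
      (∀ x ∈ A, ∀ y ∈ A, dist x y ≤ D.diamBd * r ^ k) →
      ((D.classes (k + h) A).filter fun R => ¬ I.Good k h R).card < V.card ∧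
      ((D.classes (k + h) A).filter fun R => I.Good k h R).card ≤ Q ∧
      0 < ((D.classes (k + h) A).filter fun R => I.Good k h R).card := by
  obtain ⟨δ, J, hδ, hJ⟩ := I.exists_words_image_subset
  obtain ⟨M, hM0, hM⟩ := D.exists_m_le D.diamBd
  set e := D.n₀ + D.l with he
  have hpe := D.ppow_pos e
  set ε := p ^ e * min (δ / 2) (1 / 2) with hε
  have hmin : 0 < min (δ / 2) (1 / 2 : ℝ) := lt_min (by positivity) (by positivity)
  have hε0 : 0 < ε := mul_pos hpe hmin
  obtain ⟨n, hn⟩ := I.exists_m_bad_le hε0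
  obtain ⟨J', hJ'⟩ := exists_pow_lt_of_lt_one (half_pos hδ) D.p_lt_one
  set h := J + n + I.j + J' + 1 with hh
  obtain ⟨V, hV, hVs⟩ := hJ h (by omega)
  obtain ⟨Q, hQ⟩ := exists_nat_ge (M / p ^ (h + e))
  refine ⟨h, V, Q, by omega, hVs, fun k A hne hA hd => ?_⟩
  have hk := D.ppow_pos k
  have hph := D.ppow_pos h
  have hA' : D.Sat (k + h) A := hA.mono (by omega)
  set bad := (D.classes (k + h) A).filter fun R => ¬ I.Good k h R with hbaddef
  set good := (D.classes (k + h) A).filter fun R => I.Good k h R with hgooddef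
  have hprops : ∀ s, s ⊆ D.classes (k + h) A → (s.card : ℝ) * p ^ (k + h + D.n₀ + D.l) ≤
      D.m (⋃ R ∈ s, R) := fun s hs => D.card_mul_le s
    (fun R hR => subset_biUnion_of_mem (u := fun R => R) hR)
    (fun R hR => ⟨D.sat_of_mem_classes (hs hR), D.nonempty_of_mem_classes (hs hR)⟩)
    fun R hR R' hR' => D.disjoint_of_mem_classes (hs hR) (hs hR')
  have hpow : p ^ (k + h + D.n₀ + D.l) = p ^ k * (p ^ h * p ^ e) := by
    rw [he]; ring
  have hsub : ∀ s, s ⊆ D.classes (k + h) A → ⋃ R ∈ s, R ⊆ A := fun s hs =>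
    iUnion₂_subset fun R hR => hA'.subset_of_mem_classes (hs hR)
  have hbm : D.m (⋃ R ∈ bad, R) ≤ ε * p ^ k := by
    refine hn k A _ hd (hsub bad (Finset.filter_subset _ _)) ?_ ?_
    · exact Finset.measurableSet_biUnion _ fun R hR =>
        (D.sat_of_mem_classes (Finset.mem_filter.1 hR).1).measurableSet
    · intro x hx u hku hun hxu
      obtain ⟨R, hR, hxR⟩ := mem_iUnion₂.1 hx
      obtain ⟨hR1, hR2⟩ := Finset.mem_filter.1 hR
      refine hR2 ⟨u, hku, by omega, ?_⟩
      have hs : D.Sat (k + h) (D.S u '' I.F) :=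
        (I.sat_image le_rfl I.sat_F Subset.rfl).mono (by omega)
      obtain ⟨a, -, rfl⟩ := D.mem_classes.1 hR1
      rw [← D.cls_eq_of_mem hxR]
      exact hs.cls_subset hxu
  have hcb := (hprops bad (Finset.filter_subset _ _)).trans hbm
  rw [hpow, hε] at hcb
  have hcb' : (bad.card : ℝ) * p ^ h ≤ min (δ / 2) (1 / 2) := by
    have hpp : 0 < p ^ k * p ^ e := mul_pos hk hpe
    refine le_of_mul_le_mul_right ?_ hpp
    linarith
  refine ⟨?_, ?_, ?_⟩
  · have h1 := hcb'.trans (min_le_left _ _)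
    have h2 : p ^ h < δ / 2 := (D.ppow_le (by omega)).trans_lt hJ'
    have h3 : ((bad.card : ℝ) + 1) * p ^ h < V.card * p ^ h := by linarith
    have h4 := lt_of_mul_lt_mul_right h3 hph.le
    have : (bad.card : ℝ) < V.card := by linarith
    exact_mod_cast this
  · have h1 := (hprops good (Finset.filter_subset _ _)).trans
      (D.m_mono (hsub good (Finset.filter_subset _ _)))
    have h2 := h1.trans (hM k A hA.measurableSet hd)
    rw [hpow, ← pow_add, mul_comm M, mul_left_comm] at h2
    have h3 := le_of_mul_le_mul_left h2 hk
    rw [← le_div_iff₀ (D.ppow_pos _)] at h3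
    exact_mod_cast h3.trans hQ
  · by_contra h0
    have h0 : good = ∅ := Finset.card_eq_zero.1 (by omega)
    have hall : bad = D.classes (k + h) A := by
      rw [hbaddef]
      refine Finset.filter_true_of_mem fun R hR hg => ?_
      have : R ∈ good := Finset.mem_filter.2 ⟨hR, hg⟩
      rw [h0] at this
      exact absurd this (Finset.notMem_empty R)
    rw [hall, hA'.biUnion_classes] at hbm
    have h1 := (hA.le_m hne).trans hbm
    rw [add_assoc, ← he, pow_add, hε] at h1
    have h2 : min (δ / 2) (1 / 2 : ℝ) ≤ 1 / 2 := min_le_right _ _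
    have h3 := mul_pos hk hpe
    nlinarith

end Island
end SimSys

lemma IsBiLip.isClosed {X Y : Type*} [MetricSpace X] [MetricSpace Y] [CompactSpace X] {L : ℝ}
    (hL : 0 ≤ L) {f : X → Y} {A : Set X} {B : Set Y} (hf : IsBiLip L f A B) (hA : IsClosed A) :
    IsClosed B := by
  have h : LipschitzOnWith ⟨L, hL⟩ f A := LipschitzOnWith.of_dist_le_mul hf.mul_le
  rw [← hf.bijOn.image_eq]
  exact (hA.isCompact.image_of_continuousOn h.continuousOn).isClosed

namespace SimSys

section

variable {X : Type*} [MetricSpace X] [MeasurableSpace X] {r p : ℝ} {D : SimSys X r p}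
  [BorelSpace X] [CompactSpace X] [TotallyDisconnectedSpace X]

lemma exists_isBiLip_image {u u' : List D.ι} {h : ℕ} (h1 : D.wt u ≤ D.wt u')
    (h2 : D.wt u' ≤ D.wt u + h) {L : ℝ} (hL : 0 ≤ L) {g : X → X} {A B : Set X}
    (hg : IsBiLip L g A B) :
    ∃ g', IsBiLip (L / r ^ h) g' ((D.S u') '' A) (D.S u '' B) := by
  rcases A.eq_empty_or_nonempty with rfl | ⟨x₀, -⟩
  · have : B = ∅ := by rw [← hg.bijOn.image_eq, image_empty]
    subst this
    simp only [image_empty]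
    exact ⟨id, bijOn_empty _, by simp, by simp⟩
  have : Nonempty X := ⟨x₀⟩
  have hinv : ∀ a, Function.invFun (D.S u') (D.S u' a) = a :=
    Function.leftInverse_invFun (D.injective_S u')
  have hr := D.rpow_pos h
  have h3 := D.rpow_le h1
  have h4 := D.rpow_le h2
  rw [pow_add] at h4
  have hu := D.rpow_pos (D.wt u)
  have hu' := D.rpow_pos (D.wt u')
  refine ⟨fun x => D.S u (g (Function.invFun (D.S u') x)), ⟨?_, ?_, ?_⟩, ?_, ?_⟩
  · rintro _ ⟨a, ha, rfl⟩
    simp only [hinv]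
    exact ⟨_, hg.bijOn.mapsTo ha, rfl⟩
  · rintro _ ⟨a, ha, rfl⟩ _ ⟨b, hb, rfl⟩ hab
    simp only [hinv] at hab
    rw [hg.bijOn.injOn ha hb (D.injective_S u hab)]
  · rintro _ ⟨y, hy, rfl⟩
    obtain ⟨a, ha, rfl⟩ := hg.bijOn.surjOn hy
    exact ⟨_, ⟨a, ha, rfl⟩, by simp only [hinv]⟩
  · rintro _ ⟨a, ha, rfl⟩ _ ⟨b, hb, rfl⟩
    simp only [hinv, D.dist_S]
    have h5 := hg.le_mul a ha b hb
    have hd := dist_nonneg (x := g a) (y := g b)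
    calc r ^ D.wt u' * dist a b ≤ r ^ D.wt u * (L * dist (g a) (g b)) :=
          mul_le_mul h3 h5 dist_nonneg hu.le
      _ = L * (r ^ D.wt u * dist (g a) (g b)) := by ring
      _ ≤ L / r ^ h * (r ^ D.wt u * dist (g a) (g b)) := by
          refine mul_le_mul_of_nonneg_right ?_ (mul_nonneg hu.le hd)
          exact le_div_self hL hr (D.rpow_le_one h)
  · rintro _ ⟨a, ha, rfl⟩ _ ⟨b, hb, rfl⟩
    simp only [hinv, D.dist_S]
    have h5 := hg.mul_le a ha b hb
    have hd := dist_nonneg (x := a) (y := b)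
    rw [div_mul_eq_mul_div, le_div_iff₀ hr]
    calc r ^ D.wt u * dist (g a) (g b) * r ^ h = (r ^ D.wt u * r ^ h) * dist (g a) (g b) := by ring
      _ ≤ r ^ D.wt u' * (L * dist a b) := mul_le_mul h4 h5 dist_nonneg hu'.le
      _ = _ := by ring

namespace Island

variable (I : D.Island)

lemma exists_uniform_isBiLip (J : ℕ) : ∃ L : ℝ, 1 ≤ L ∧ ∀ A B, D.Sat J A → A.Nonempty → A ⊆ I.F →
    D.Sat J B → B.Nonempty → B ⊆ I.F → ∃ g, IsBiLip L g A B := by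
  obtain ⟨n, hn⟩ := ((D.finite_sat J).prod (D.finite_sat J)).exists_forall_le
    (P := fun x n => x.1.Nonempty → x.1 ⊆ I.F → x.2.Nonempty → x.2 ⊆ I.F →
      ∃ g, IsBiLip (n : ℝ) g x.1 x.2) (by
    rintro ⟨A, B⟩ ⟨hA, hB⟩
    by_cases h : A.Nonempty ∧ A ⊆ I.F ∧ B.Nonempty ∧ B ⊆ I.F
    · obtain ⟨h1, h2, h3, h4⟩ := h
      have : Nonempty X := ⟨h1.some⟩
      obtain ⟨g, L, -, hg⟩ := ((I.lipEquiv_of_isClopen hA.isClopen h1 h2).trans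
        (I.lipEquiv_of_isClopen hB.isClopen h3 h4).symm).exists_isBiLip
      obtain ⟨n, hn⟩ := exists_nat_ge L
      exact ⟨n, fun m hm _ _ _ _ => ⟨g, hg.mono (hn.trans (by exact_mod_cast hm))⟩⟩
    · exact ⟨0, fun m _ h1 h2 h3 h4 => absurd ⟨h1, h2, h3, h4⟩ h⟩)
  refine ⟨(n + 1 : ℕ), by simp, fun A B h1 h2 h3 h4 h5 h6 => ?_⟩
  exact hn (A, B) ⟨h1, h4⟩ (n + 1) (Nat.le_succ n) h2 h3 h5 h6

lemma exists_uniform_partition {h : ℕ} {V : Finset (List D.ι)}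
    (hV : ∀ v ∈ V, D.wt v = h ∧ D.S v '' I.F ⊆ I.F) (hne : I.F.Nonempty) (Q : ℕ) :
    ∃ J, ∀ V', V' ⊆ V → V'.card < V.card → ∀ q, 0 < q → q ≤ Q → ∃ H : Fin q → Set X,
      ⋃ i, H i = I.F \ ⋃ v ∈ V', D.S v '' I.F ∧ (∀ i j, i ≠ j → Disjoint (H i) (H j)) ∧
      ∀ i, (H i).Nonempty ∧ D.Sat J (H i) := by
  classical
  obtain ⟨J, hJ⟩ := (V.powerset ×ˢ Finset.range (Q + 1)).finite_toSet.exists_forall_le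
    (P := fun x n => x.1.card < V.card → 0 < x.2 → ∃ H : Fin x.2 → Set X,
      ⋃ i, H i = I.F \ ⋃ v ∈ x.1, D.S v '' I.F ∧ (∀ i j, i ≠ j → Disjoint (H i) (H j)) ∧
      ∀ i, (H i).Nonempty ∧ D.Sat n (H i)) (by
    rintro ⟨V', q⟩ hx
    have hV' : V' ⊆ V := by simp at hx; exact hx.1
    by_cases hcq : V'.card < V.card ∧ 0 < q
    · have hcl : IsClopen (I.F \ ⋃ v ∈ V', D.S v '' I.F) :=
        I.isClopen.diff (V'.finite_toSet.isClopen_biUnion fun v _ =>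
          (I.sat_image le_rfl I.sat_F Subset.rfl).isClopen)
      have hnem : (I.F \ ⋃ v ∈ V', D.S v '' I.F).Nonempty := by
        obtain ⟨v, hv, hvV'⟩ := Finset.exists_mem_notMem_of_card_lt_card hcq.1
        obtain ⟨x, hx⟩ := hne
        refine ⟨D.S v x, (hV v hv).2 ⟨x, hx, rfl⟩, fun hmem => ?_⟩
        obtain ⟨v', hv', hmem⟩ := mem_iUnion₂.1 hmem
        have hneq : v ≠ v' := by rintro rfl; exact hvV' hv'
        exact Set.disjoint_left.1 (I.disjoint_image_of_wt_eq
          ((hV v hv).1.trans (hV v' (hV' hv')).1.symm) hneq) ⟨x, hx, rfl⟩ hmem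
      obtain ⟨k, hk⟩ := D.exists_sat_of_isClopen hcl
      obtain ⟨H, h1, h2, h3⟩ := (hk k le_rfl).exists_partition hnem hcq.2
      obtain ⟨n, hn⟩ := (finite_univ (α := Fin q)).exists_forall_le
        (P := fun i n => D.Sat n (H i)) fun i _ => D.exists_sat_of_isClopen (h3 i).2
      exact ⟨n, fun m hm _ _ => ⟨H, h1, h2, fun i => ⟨(h3 i).1, hn i (mem_univ i) m hm⟩⟩⟩
    · exact ⟨0, fun m _ h1 h2 => absurd ⟨h1, h2⟩ hcq⟩)
  refine ⟨J, fun V' h1 h2 q h3 h4 => hJ (V', q) ?_ J le_rfl h2 h3⟩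
  simp only [Finset.coe_product, mem_prod, Finset.mem_coe, Finset.mem_powerset, Finset.mem_range]
  exact ⟨h1, by omega⟩

end Island

end

section

variable {X : Type} [MetricSpace X] [MeasurableSpace X] {r p : ℝ} {D : SimSys X r p}
  [BorelSpace X] [CompactSpace X] [TotallyDisconnectedSpace X]

theorem Island.lipEquiv_univ [Nonempty X] (I : D.Island) : LipEquiv (univ : Set X) I.F := by
  classical
  obtain ⟨h, V, Q, hh, hV, hgood⟩ := I.exists_good_scale
  obtain ⟨J₀, hJ₀⟩ := I.exists_uniform_partition hV I.nonempty Q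
  set J := J₀ + h + I.j with hJ
  obtain ⟨L₁, hL₁, hbl⟩ := I.exists_uniform_isBiLip J
  set L := L₁ / r ^ h with hL
  have hL1 : 1 ≤ L := hL₁.trans (le_div_self (by linarith) (D.rpow_pos h) (D.rpow_le_one h))
  have hL0 : 0 < L := by linarith
  have hd1 := D.one_le_diamBd
  have hc0 := D.c_pos
  let R : ℕ → Set X → Set X → Prop := fun k A B => A.Nonempty ∧ D.Sat k A ∧
    (∀ x ∈ A, ∀ y ∈ A, dist x y ≤ D.diamBd * r ^ k) ∧
    ((∃ u, D.wt u = k ∧ B = D.S u '' I.F) ∨ ∃ g, IsBiLip L g A B)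
  have hcle : ∀ k j, j ≤ J → D.c * r ^ J / L * r ^ k ≤ D.c * r ^ (k + j) := fun k j hj => by
    have h1 : D.c * r ^ J / L ≤ D.c * r ^ J :=
      div_le_self (mul_pos hc0 (D.rpow_pos J)).le hL1
    have h2 := mul_le_mul_of_nonneg_right h1 (D.rpow_pos k).le
    have h3 := mul_le_mul_of_nonneg_left (D.rpow_le (by omega : k + j ≤ k + J)) hc0.le
    rw [pow_add r k J] at h3
    linarith
  have hS : IsSplitting R r (D.c * r ^ J / L) (D.diamBd * L) h := by
    refine ⟨?_, ?_, ?_, ?_, ?_⟩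
    · rintro k A B ⟨hne, hA, hd, ⟨u, rfl, rfl⟩ | ⟨g, hg⟩⟩
      · exact ⟨hA.isClosed, (I.sat_image le_rfl I.sat_F Subset.rfl).isClosed⟩
      · exact ⟨hA.isClosed, hg.isClosed hL0.le hA.isClosed⟩
    · rintro k A B ⟨hne, hA, hd, ⟨u, rfl, rfl⟩ | ⟨g, hg⟩⟩
      · exact ⟨hne, I.nonempty.image _⟩
      · exact ⟨hne, hg.bijOn.image_eq ▸ hne.image g⟩
    · rintro k A B ⟨hne, hA, hd, -⟩ x hx y hy
      refine (hd x hx y hy).trans (mul_le_mul_of_nonneg_right ?_ (D.rpow_pos k).le)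
      nlinarith
    · rintro k A B ⟨hne, hA, hd, ⟨u, rfl, rfl⟩ | ⟨g, hg⟩⟩ x hx y hy
      · refine (D.dist_le_of_mem_cyl (image_subset_range _ _ hx) (image_subset_range _ _ hy)).trans
          (mul_le_mul_of_nonneg_right ?_ (D.rpow_pos _).le)
        nlinarith
      · obtain ⟨a, ha, rfl⟩ := hg.bijOn.surjOn hx
        obtain ⟨b, hb, rfl⟩ := hg.bijOn.surjOn hy
        have h1 := hg.mul_le a ha b hb
        have h2 := mul_le_mul_of_nonneg_left (hd a ha b hb) hL0.le
        linarith
    rintro k A B ⟨hne, hA, hd, hB⟩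
    have hA' : D.Sat (k + h) A := hA.mono (by omega)
    have hcd : ∀ R ∈ D.classes (k + h) A, ∀ x ∈ R, ∀ y ∈ R, dist x y ≤ D.diamBd * r ^ (k + h) :=
      fun R hR x hx y hy => (D.dist_le_of_mem_classes hR hx hy).trans
        (le_mul_of_one_le_left (D.rpow_pos _).le hd1)
    have hsepA : ∀ R ∈ D.classes (k + h) A, ∀ R' ∈ D.classes (k + h) A, R ≠ R' → ∀ x ∈ R,
        ∀ y ∈ R', D.c * r ^ (k + h) ≤ dist x y := fun R hR R' hR' hne x hx y hy =>
      (D.sat_of_mem_classes hR).le_dist hx fun hy' =>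
        Set.disjoint_left.1 (D.disjoint_of_mem_classes hR hR' hne) hy' hy
    rcases hB with ⟨u, rfl, rfl⟩ | ⟨g, hg⟩
    · obtain ⟨hbV, hgQ, hg0⟩ := hgood _ A hne hA hd
      set bad := (D.classes (D.wt u + h) A).filter fun R => ¬ I.Good (D.wt u) h R with hbad
      set good := (D.classes (D.wt u + h) A).filter fun R => I.Good (D.wt u) h R with hgooddef
      obtain ⟨v⟩ : Nonempty (bad ↪ V) := Function.Embedding.nonempty_of_card_le
        (by simpa using hbV.le)
      let V' : Finset (List D.ι) := Finset.univ.image fun R : bad => (v R).1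
      have hvinj : Function.Injective fun R : bad => (v R).1 :=
        Subtype.val_injective.comp v.injective
      have hV'c : V'.card < V.card := by
        rw [Finset.card_image_of_injective _ hvinj]
        simpa using hbV
      have hV'V : V' ⊆ V := by
        intro w hw
        obtain ⟨R, -, rfl⟩ := Finset.mem_image.1 hw
        exact (v R).2
      obtain ⟨H, hH1, hH2, hH3⟩ := hJ₀ V' hV'V hV'c good.card hg0 hgQ
      let e : good ≃ Fin good.card := good.equivFin
      have hHF : ∀ i, H i ⊆ I.F \ ⋃ w ∈ V', D.S w '' I.F := fun i => hH1 ▸ subset_iUnion H i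
      have hsb : ∀ R : bad, D.Sat (D.wt u + (h + I.j)) (D.S (u ++ (v R).1) '' I.F) := fun R => by
        have := I.sat_image (u := u ++ (v R).1) le_rfl I.sat_F Subset.rfl
        rwa [wt_append, (hV _ (v R).2).1, add_assoc] at this
      have hsg : ∀ i, D.Sat (D.wt u + J) (D.S u '' H i) := fun i =>
        I.sat_image (by omega) ((hH3 i).2.mono (by omega)) ((hHF i).trans sdiff_subset)
      have hsplit : ∀ R : bad, D.S (u ++ (v R).1) '' I.F = D.S u '' (D.S (v R).1 '' I.F) := by
        intro R
        rw [image_image]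
        exact image_congr fun x _ => D.S_append _ _ x
      let b : bad ⊕ good → Set X :=
        Sum.elim (fun R => D.S (u ++ (v R).1) '' I.F) fun R => D.S u '' H (e R)
      have hbsat : ∀ i, D.Sat (D.wt u + J) (b i) := by
        rintro (R | R)
        · exact (hsb R).mono (by omega)
        · exact hsg _
      have hbdisj : ∀ i j, i ≠ j → Disjoint (b i) (b j) := by
        have hbg : ∀ (i : bad) (j : good), Disjoint (b (.inl i)) (b (.inr j)) := fun R R' => by
          simp only [b, Sum.elim_inl, Sum.elim_inr]
          rw [hsplit, disjoint_image_iff (D.injective_S u)]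
          rw [Set.disjoint_left]
          intro x hx hx'
          exact (hHF _ hx').2
            (mem_iUnion₂.2 ⟨_, Finset.mem_image.2 ⟨R, Finset.mem_univ _, rfl⟩, hx⟩)
        rintro (R | R) (R' | R') hne
        · refine I.disjoint_image_of_wt_eq ?_ ?_
          · rw [wt_append, wt_append, (hV _ (v R).2).1, (hV _ (v R').2).1]
          · intro he
            exact hne (congrArg Sum.inl (hvinj (List.append_cancel_left he)))
        · exact hbg R R'
        · exact (hbg R' R).symm
        · simp only [b, Sum.elim_inr]
          rw [disjoint_image_iff (D.injective_S u)]
          exact hH2 _ _ fun he => hne (congrArg Sum.inr (e.injective he))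
      refine ⟨bad ⊕ good, Sum.elim (fun R => R.1) fun R => R.1, b, ?_, ?_, ?_, ?_, ?_⟩
      · rw [iUnion_sum]
        conv_lhs => rw [← hA'.biUnion_classes]
        ext x
        simp only [mem_union, mem_iUnion, Sum.elim_inl, Sum.elim_inr]
        constructor
        · rintro ⟨R, hR, hx⟩
          by_cases hRg : I.Good (D.wt u) h R
          · exact Or.inr ⟨⟨R, Finset.mem_filter.2 ⟨hR, hRg⟩⟩, hx⟩
          · exact Or.inl ⟨⟨R, Finset.mem_filter.2 ⟨hR, hRg⟩⟩, hx⟩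
        · rintro (⟨R, hx⟩ | ⟨R, hx⟩)
          · exact ⟨R.1, (Finset.mem_filter.1 R.2).1, hx⟩
          · exact ⟨R.1, (Finset.mem_filter.1 R.2).1, hx⟩
      · rw [iUnion_sum]
        have h1 : ⋃ i, b (Sum.inr i) = D.S u '' (I.F \ ⋃ w ∈ V', D.S w '' I.F) := by
          rw [← hH1, image_iUnion]
          exact e.surjective.iUnion_comp fun i => D.S u '' H i
        have h2 : ⋃ i, b (Sum.inl i) = D.S u '' (⋃ w ∈ V', D.S w '' I.F) := by
          rw [image_iUnion₂]
          ext x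
          simp only [b, Sum.elim_inl, hsplit, mem_iUnion]
          constructor
          · rintro ⟨R, hx⟩
            exact ⟨_, Finset.mem_image.2 ⟨R, Finset.mem_univ _, rfl⟩, hx⟩
          · rintro ⟨w, hw, hx⟩
            obtain ⟨R, -, rfl⟩ := Finset.mem_image.1 hw
            exact ⟨R, hx⟩
        rw [h1, h2, ← image_union, union_sdiff_cancel]
        exact iUnion₂_subset fun w hw => (hV w (hV'V hw)).2
      · have hmem : ∀ i : bad ⊕ good, Sum.elim (fun R : bad => R.1) (fun R : good => R.1) i ∈
            D.classes (D.wt u + h) A := by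
          rintro (R | R)
          · exact (Finset.mem_filter.1 R.2).1
          · exact (Finset.mem_filter.1 R.2).1
        have hinj : Function.Injective
            (Sum.elim (fun R : bad => R.1) (fun R : good => R.1)) := by
          rintro (R | R) (R' | R') he
          · exact congrArg Sum.inl (Subtype.ext he)
          · have he : R.1 = R'.1 := he
            exact absurd (he ▸ (Finset.mem_filter.1 R'.2).2) (Finset.mem_filter.1 R.2).2
          · have he : R.1 = R'.1 := he
            exact absurd (he ▸ (Finset.mem_filter.1 R.2).2) (Finset.mem_filter.1 R'.2).2
          · exact congrArg Sum.inr (Subtype.ext he)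
        intro i j hij x hx y hy
        exact (hcle _ h (by omega)).trans
          (hsepA _ (hmem i) _ (hmem j) (fun he => hij (hinj he)) x hx y hy)
      · intro i j hij x hx y hy
        refine (hcle _ J le_rfl).trans ((hbsat i).le_dist hx fun hy' => ?_)
        exact Set.disjoint_left.1 (hbdisj i j hij) hy' hy
      · rintro (R | R)
        · have hR := (Finset.mem_filter.1 R.2).1
          refine ⟨D.nonempty_of_mem_classes hR, D.sat_of_mem_classes hR, hcd _ hR,
            Or.inl ⟨u ++ (v R).1, ?_, rfl⟩⟩
          rw [wt_append, (hV _ (v R).2).1]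
        · obtain ⟨hR, u', h1, h2, h3⟩ := Finset.mem_filter.1 R.2
          refine ⟨D.nonempty_of_mem_classes hR, D.sat_of_mem_classes hR, hcd _ hR, Or.inr ?_⟩
          have hRimg : (D.S u') '' (D.S u' ⁻¹' R.1) = R.1 :=
            image_preimage_eq_of_subset (h3.trans (image_subset_range _ _))
          have hpre : D.Sat (D.wt u + h - D.wt u') (D.S u' ⁻¹' R.1) := by
            refine Sat.preimage ?_
            rw [Nat.add_sub_cancel' h2]
            exact D.sat_of_mem_classes hR
          obtain ⟨x, hx⟩ := D.nonempty_of_mem_classes hR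
          obtain ⟨y, -, hyx⟩ := h3 hx
          obtain ⟨g₀, hg₀⟩ := hbl (D.S u' ⁻¹' R.1) (H (e R)) (hpre.mono (by omega))
            ⟨y, by rw [mem_preimage, hyx]; exact hx⟩
            (fun z hz => by
              obtain ⟨z', hz', he⟩ := h3 hz
              rwa [← D.injective_S u' he])
            ((hH3 _).2.mono (by omega)) (hH3 _).1 ((hHF _).trans sdiff_subset)
          obtain ⟨g', hg'⟩ := exists_isBiLip_image h1 h2 (by linarith) hg₀
          rw [hRimg] at hg'
          exact ⟨g', hg'⟩
    · have hsub : ∀ R : D.classes (k + h) A, R.1 ⊆ A := fun R => hA'.subset_of_mem_classes R.2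
      have hL' : 1 / L * (D.c * r ^ (k + h)) ≥ D.c * r ^ J / L * r ^ k := by
        have h3 := mul_le_mul_of_nonneg_left (D.rpow_le (by omega : k + h ≤ k + J)) hc0.le
        rw [pow_add r k J] at h3
        have h4 := mul_le_mul_of_nonneg_left h3 (one_div_pos.2 hL0).le
        calc D.c * r ^ J / L * r ^ k = 1 / L * (D.c * (r ^ k * r ^ J)) := by ring
          _ ≤ _ := h4
      refine ⟨D.classes (k + h) A, fun R => R.1, fun R => g '' R.1, ?_, ?_, ?_, ?_, ?_⟩
      · conv_lhs => rw [← hA'.biUnion_classes]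
        exact biUnion_eq_iUnion _ _
      · rw [← image_iUnion, ← hg.bijOn.image_eq]
        congr 1
        conv_lhs => rw [← hA'.biUnion_classes]
        exact biUnion_eq_iUnion _ _
      · intro i j hij x hx y hy
        exact (hcle _ h (by omega)).trans
          (hsepA _ i.2 _ j.2 (fun he => hij (Subtype.ext he)) x hx y hy)
      · rintro i j hij _ ⟨x, hx, rfl⟩ _ ⟨y, hy, rfl⟩
        have h1 := hsepA _ i.2 _ j.2 (fun he => hij (Subtype.ext he)) x hx y hy
        have h2 := h1.trans (hg.le_mul x (hsub i hx) y (hsub j hy))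
        refine hL'.le.trans ?_
        rw [one_div, inv_mul_le_iff₀ hL0]
        exact h2
      · intro R
        refine ⟨D.nonempty_of_mem_classes R.2, D.sat_of_mem_classes R.2, hcd _ R.2,
          Or.inr ⟨g, (hg.bijOn.injOn.mono (hsub R)).bijOn_image, ?_, ?_⟩⟩
        · exact fun x hx y hy => hg.le_mul x (hsub R hx) y (hsub R hy)
        · exact fun x hx y hy => hg.mul_le x (hsub R hx) y (hsub R hy)
  have h0 : R 0 univ I.F := by
    refine ⟨univ_nonempty, D.sat_univ 0, fun x _ y _ => ?_, Or.inl ⟨[], rfl, (image_id _).symm⟩⟩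
    simpa using D.dist_le_diamBd x y
  obtain ⟨φ, hφ⟩ := hS.exists_isBiLip D.r_pos D.r_lt_one hh
    (div_pos (mul_pos hc0 (D.rpow_pos J)) hL0) (mul_pos (by linarith) hL0) h0
  exact hφ.lipEquiv

end

end SimSys

/-! ### Transport between families with finitely many values -/

lemma exists_subset_card_filter {ι : Type*} {V : Finset ℝ} {s : Finset ι} {α : ι → ℝ}
    {n : V → ℕ} (hn : ∀ v, n v ≤ (s.filter fun i => α i = v).card) :
    ∃ s₀ ⊆ s, s₀.card = ∑ v, n v ∧ ∑ i ∈ s₀, α i = ∑ v, n v * (v : ℝ) := by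
  classical
  choose u hu hc using fun v => Finset.exists_subset_card_eq (hn v)
  have hd : Set.PairwiseDisjoint (↑(Finset.univ : Finset V)) u := by
    intro v _ w _ hvw
    rw [Function.onFun, Finset.disjoint_left]
    intro i hi hi'
    have h1 := (Finset.mem_filter.1 (hu v hi)).2
    have h2 := (Finset.mem_filter.1 (hu w hi')).2
    exact hvw (Subtype.ext (h1.symm.trans h2))
  refine ⟨Finset.univ.biUnion u, ?_, ?_, ?_⟩
  · exact Finset.biUnion_subset.2 fun v _ => (hu v).trans (Finset.filter_subset _ _)
  · rw [Finset.card_biUnion hd]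
    exact Finset.sum_congr rfl fun v _ => hc v
  · rw [Finset.sum_biUnion hd]
    refine Finset.sum_congr rfl fun v _ => ?_
    rw [Finset.sum_congr rfl (g := fun _ => (v : ℝ)), Finset.sum_const, hc, nsmul_eq_mul]
    intro i hi
    exact (Finset.mem_filter.1 (hu v hi)).2

lemma sum_card_filter {ι : Type*} {V : Finset ℝ} {s : Finset ι} {α : ι → ℝ}
    (hα : ∀ i ∈ s, α i ∈ V) : ∑ v : V, (s.filter fun i => α i = v).card = s.card ∧
      ∑ v : V, (s.filter fun i => α i = v).card * (v : ℝ) = ∑ i ∈ s, α i := by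
  classical
  constructor
  · rw [Finset.card_eq_sum_card_fiberwise (f := α) (t := V) fun i hi => hα i hi]
    exact Finset.sum_coe_sort V fun v => (s.filter fun i => α i = v).card
  · rw [← Finset.sum_fiberwise_of_maps_to hα, ← Finset.sum_coe_sort V]
    refine Finset.sum_congr rfl fun v _ => ?_
    rw [← nsmul_eq_mul, ← Finset.sum_const]
    exact Finset.sum_congr rfl fun i hi => (Finset.mem_filter.1 hi).2.symm

/-- Families with values in fixed finite sets and equal sums contain subfamilies of bounded size
with equal sums. -/
lemma exists_card_le_of_sum_eq (V V' : Finset ℝ) : ∃ Q : ℕ, ∀ (ι ι' : Type) (s : Finset ι)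
    (t : Finset ι') (α : ι → ℝ) (β : ι' → ℝ), (∀ i ∈ s, α i ∈ V) → (∀ j ∈ t, β j ∈ V') →
    ∑ i ∈ s, α i = ∑ j ∈ t, β j → s.Nonempty → ∃ s₀ ⊆ s, ∃ t₀ ⊆ t, s₀.Nonempty ∧ s₀.card ≤ Q ∧
      t₀.card ≤ Q ∧ ∑ i ∈ s₀, α i = ∑ j ∈ t₀, β j := by
  classical
  by_contra! hcon
  choose ι ι' s t α β hα hβ hs hne hbad using hcon
  let f : ℕ → V ⊕ V' → ℕ := fun Q => Sum.elim
    (fun v => ((s Q).filter fun i => α Q i = v).card)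
    (fun v => ((t Q).filter fun i => β Q i = v).card)
  obtain ⟨g, hg⟩ :=
    (Set.isPWO_of_wellQuasiOrderedLE (univ : Set (V ⊕ V' → ℕ))).exists_monotone_subseq (f := f)
      fun _ => mem_univ _
  set Q := g 0
  have hQ : Q ≤ g 0 := le_rfl
  set n := (s Q).card + (t Q).card
  have hle : f Q ≤ f (g n) := hg (Nat.zero_le n)
  have hgn : n ≤ g n := g.strictMono.le_apply
  obtain ⟨h1, h2⟩ := sum_card_filter (hα Q)
  obtain ⟨h3, h4⟩ := sum_card_filter (hβ Q)
  obtain ⟨s₀, hs₀, hc, hsum⟩ := exists_subset_card_filter (α := α (g n))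
    (n := fun v => ((s Q).filter fun i => α Q i = v).card) fun v => hle (Sum.inl v)
  obtain ⟨t₀, ht₀, hc', hsum'⟩ := exists_subset_card_filter (α := β (g n))
    (n := fun v => ((t Q).filter fun i => β Q i = v).card) fun v => hle (Sum.inr v)
  rw [h1] at hc
  rw [h3] at hc'
  rw [h2] at hsum
  rw [h4] at hsum'
  refine hbad (g n) s₀ hs₀ t₀ ht₀ ?_ ?_ ?_ ?_
  · rw [← Finset.card_pos, hc]
    exact (hne Q).card_pos
  · omega
  · omega
  · rw [hsum, hsum', hs Q]

/-- Uniform refinements for families of bounded size. -/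
lemma exists_finite_refinement (G : AddSubgroup ℝ) (V V' : Finset ℝ)
    (hV : ∀ v ∈ V, 0 ≤ v ∧ v ∈ G) (hV' : ∀ v ∈ V', 0 ≤ v ∧ v ∈ G) (Q : ℕ) :
    ∃ Y : Finset ℝ, (∀ y ∈ Y, 0 ≤ y ∧ y ∈ G) ∧
      ∀ (ι ι' : Type) (s : Finset ι) (t : Finset ι') (α : ι → ℝ) (β : ι' → ℝ),
        (∀ i ∈ s, α i ∈ V) → (∀ j ∈ t, β j ∈ V') → ∑ i ∈ s, α i = ∑ j ∈ t, β j →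
        s.card ≤ Q → t.card ≤ Q → ∃ z : ι → ι' → ℝ,
          (∀ i ∈ s, ∀ j ∈ t, z i j ∈ Y) ∧
          (∀ i ∈ s, ∑ j ∈ t, z i j = α i) ∧ ∀ j ∈ t, ∑ i ∈ s, z i j = β j := by
  classical
  have key : ∀ c : (q : Fin (Q + 1)) × (q' : Fin (Q + 1)) × (Fin q → V) × (Fin q' → V'),
      ∃ z : Fin c.1 → Fin c.2.1 → ℝ, (∀ i j, 0 ≤ z i j ∧ z i j ∈ G) ∧
        (∑ i, (c.2.2.1 i : ℝ) = ∑ j, (c.2.2.2 j : ℝ) →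
          (∀ i, ∑ j, z i j = c.2.2.1 i) ∧ ∀ j, ∑ i, z i j = c.2.2.2 j) := by
    rintro ⟨q, q', a, b⟩
    by_cases hab : ∑ i, (a i : ℝ) = ∑ j, (b j : ℝ)
    · obtain ⟨z, h1, h2, h3⟩ := exists_common_refinement G Finset.univ (fun i => (a i : ℝ))
        (fun j => (b j : ℝ)) (fun i _ => hV _ (a i).2) (fun j => hV' _ (b j).2) hab
      exact ⟨z, fun i j => h1 i (Finset.mem_univ i) j,
        fun _ => ⟨fun i => h2 i (Finset.mem_univ i), h3⟩⟩
    · exact ⟨fun _ _ => 0, fun _ _ => ⟨le_rfl, G.zero_mem⟩, fun h => absurd h hab⟩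
  choose z hz hz' using key
  let Y : Finset ℝ := Finset.univ.biUnion fun c => Finset.univ.biUnion fun i =>
    Finset.univ.image fun j => z c i j
  have hY : ∀ y, y ∈ Y ↔ ∃ c i j, z c i j = y := by simp [Y]
  refine ⟨Y, fun y hy => ?_, fun ι ι' s t α β hα hβ hab hs ht => ?_⟩
  · obtain ⟨c, i, j, rfl⟩ := (hY y).1 hy
    exact hz c i j
  · let q : Fin (Q + 1) := ⟨s.card, by omega⟩
    let q' : Fin (Q + 1) := ⟨t.card, by omega⟩
    let e : s ≃ Fin q := s.equivFin
    let e' : t ≃ Fin q' := t.equivFin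
    let a : Fin q → V := fun i => ⟨α (e.symm i), hα _ (e.symm i).2⟩
    let b : Fin q' → V' := fun i => ⟨β (e'.symm i), hβ _ (e'.symm i).2⟩
    have hsum : ∑ i, (a i : ℝ) = ∑ j, (b j : ℝ) := by
      rw [← Finset.sum_coe_sort s, ← Finset.sum_coe_sort t] at hab
      rw [← e.sum_comp, ← e'.sum_comp]
      simpa [a, b] using hab
    obtain ⟨h1, h2⟩ := hz' ⟨q, q', a, b⟩ hsum
    let z' : ι → ι' → ℝ := fun i j => if h : i ∈ s ∧ j ∈ t then
      z ⟨q, q', a, b⟩ (e ⟨i, h.1⟩) (e' ⟨j, h.2⟩) else 0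
    have hz'' : ∀ (i : s) (j : t), z' i j = z ⟨q, q', a, b⟩ (e i) (e' j) := fun i j => by
      simp [z']
    refine ⟨z', fun i hi j hj => ?_, fun i hi => ?_, fun j hj => ?_⟩
    · rw [hz'' ⟨i, hi⟩ ⟨j, hj⟩]
      exact (hY _).2 ⟨_, _, _, rfl⟩
    · have := h1 (e ⟨i, hi⟩)
      rw [← e'.sum_comp] at this
      rw [← Finset.sum_coe_sort t]
      simp only [hz'' ⟨i, hi⟩]
      rw [this]
      simp [a]
    · have := h2 (e' ⟨j, hj⟩)
      rw [← e.sum_comp] at this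
      rw [← Finset.sum_coe_sort s]
      simp only [fun i : s => hz'' i ⟨j, hj⟩]
      rw [this]
      simp [b]

/-- Families with values in fixed finite sets and equal sums have a common refinement with values
in a fixed finite set and rows and columns of bounded size. -/
lemma exists_transport (G : AddSubgroup ℝ) (V V' : Finset ℝ)
    (hV : ∀ v ∈ V, 0 < v ∧ v ∈ G) (hV' : ∀ v ∈ V', 0 < v ∧ v ∈ G) :
    ∃ (Q : ℕ) (Y : Finset ℝ), (∀ y ∈ Y, 0 < y ∧ y ∈ G) ∧
      ∀ (ι ι' : Type) (s : Finset ι) (t : Finset ι') (α : ι → ℝ) (β : ι' → ℝ),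
        (∀ i ∈ s, α i ∈ V) → (∀ j ∈ t, β j ∈ V') → ∑ i ∈ s, α i = ∑ j ∈ t, β j →
        ∃ z : ι → ι' → ℝ, (∀ i ∈ s, ∀ j ∈ t, z i j ≠ 0 → z i j ∈ Y) ∧
          (∀ i ∈ s, ∑ j ∈ t, z i j = α i) ∧ (∀ j ∈ t, ∑ i ∈ s, z i j = β j) ∧
          (∀ i ∈ s, (t.filter fun j => z i j ≠ 0).card ≤ Q) ∧
          ∀ j ∈ t, (s.filter fun i => z i j ≠ 0).card ≤ Q := by
  classical
  obtain ⟨Q, hQ⟩ := exists_card_le_of_sum_eq V V'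
  obtain ⟨Y, hY, hYz⟩ := exists_finite_refinement G V V' (fun v hv => ⟨(hV v hv).1.le, (hV v hv).2⟩)
    (fun v hv => ⟨(hV' v hv).1.le, (hV' v hv).2⟩) Q
  refine ⟨Q, Y.filter (· ≠ 0), fun y hy => ?_, fun ι ι' s => ?_⟩
  · obtain ⟨h1, h2⟩ := Finset.mem_filter.1 hy
    exact ⟨(hY y h1).1.lt_of_ne' h2, (hY y h1).2⟩
  induction s using Finset.strongInduction with
  | H s ih =>
    intro t α β hα hβ hab
    rcases s.eq_empty_or_nonempty with rfl | hne
    · have ht : t = ∅ := by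
        by_contra h
        have := Finset.sum_pos (fun j hj => (hV' _ (hβ j hj)).1) (Finset.nonempty_iff_ne_empty.2 h)
        rw [← hab, Finset.sum_empty] at this
        exact lt_irrefl _ this
      subst ht
      exact ⟨fun _ _ => 0, by simp⟩
    · obtain ⟨s₀, hs₀, t₀, ht₀, hne₀, hsc, htc, hab₀⟩ := hQ ι ι' s t α β hα hβ hab hne
      obtain ⟨z₀, h1, h2, h3⟩ := hYz ι ι' s₀ t₀ α β (fun i hi => hα i (hs₀ hi))
        (fun j hj => hβ j (ht₀ hj)) hab₀ hsc htc
      have hab₁ : ∑ i ∈ s \ s₀, α i = ∑ j ∈ t \ t₀, β j := by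
        have h4 := Finset.sum_sdiff (f := α) hs₀
        have h5 := Finset.sum_sdiff (f := β) ht₀
        linarith
      obtain ⟨z₁, k1, k2, k3, k4, k5⟩ := ih (s \ s₀) (Finset.sdiff_ssubset hs₀ hne₀) (t \ t₀) α β
        (fun i hi => hα i (Finset.mem_sdiff.1 hi).1) (fun j hj => hβ j (Finset.mem_sdiff.1 hj).1)
        hab₁
      let z : ι → ι' → ℝ := fun i j =>
        if i ∈ s₀ then (if j ∈ t₀ then z₀ i j else 0) else (if j ∈ t₀ then 0 else z₁ i j)
      refine ⟨z, fun i hi j hj => ?_, fun i hi => ?_, fun j hj => ?_, fun i hi => ?_,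
        fun j hj => ?_⟩
      · by_cases h : i ∈ s₀ <;> by_cases h' : j ∈ t₀ <;> simp only [z, h, h', if_true, if_false]
        · intro h0
          exact Finset.mem_filter.2 ⟨h1 i h j h', h0⟩
        · simp
        · simp
        · exact k1 i (Finset.mem_sdiff.2 ⟨hi, h⟩) j (Finset.mem_sdiff.2 ⟨hj, h'⟩)
      · rw [← Finset.sum_sdiff ht₀]
        by_cases h : i ∈ s₀
        · rw [Finset.sum_eq_zero, zero_add, ← h2 i h]
          · exact Finset.sum_congr rfl fun j hj => by simp [z, h, hj]
          · intro j hj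
            simp [z, h, (Finset.mem_sdiff.1 hj).2]
        · rw [add_comm, Finset.sum_eq_zero, zero_add, ← k2 i (Finset.mem_sdiff.2 ⟨hi, h⟩)]
          · exact Finset.sum_congr rfl fun j hj => by simp [z, h, (Finset.mem_sdiff.1 hj).2]
          · intro j hj
            simp [z, h, hj]
      · rw [← Finset.sum_sdiff hs₀]
        by_cases h : j ∈ t₀
        · rw [Finset.sum_eq_zero, zero_add, ← h3 j h]
          · exact Finset.sum_congr rfl fun i hi => by simp [z, h, hi]
          · intro i hi
            simp [z, h, (Finset.mem_sdiff.1 hi).2]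
        · rw [add_comm, Finset.sum_eq_zero, zero_add, ← k3 j (Finset.mem_sdiff.2 ⟨hj, h⟩)]
          · exact Finset.sum_congr rfl fun i hi => by simp [z, h, (Finset.mem_sdiff.1 hi).2]
          · intro i hi
            simp [z, h, hi]
      · by_cases h : i ∈ s₀
        · refine (Finset.card_le_card fun j hj => ?_).trans htc
          by_contra h'
          simp [z, h, h'] at hj
        · refine (Finset.card_le_card fun j hj => ?_).trans (k4 i (Finset.mem_sdiff.2 ⟨hi, h⟩))
          have h' : j ∉ t₀ := fun h' => by simp [z, h, h'] at hj
          simpa [z, h, h'] using hj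
      · by_cases h : j ∈ t₀
        · refine (Finset.card_le_card fun i hi => ?_).trans hsc
          by_contra h'
          simp [z, h, h'] at hi
        · refine (Finset.card_le_card fun i hi => ?_).trans (k5 j (Finset.mem_sdiff.2 ⟨hj, h⟩))
          have h' : i ∉ s₀ := fun h' => by simp [z, h, h'] at hi
          simpa [z, h, h'] using hi

lemma exists_mul_le_one_le_mul {p u v : ℝ} (hp0 : 0 < p) (hp1 : p < 1) (hv : 0 ≤ v) (huv : v < u) :
    ∃ K ∈ Zring p, K * v ≤ 1 ∧ 1 ≤ K * u := by
  have hu : 0 < u := hv.trans_lt huv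
  obtain ⟨n, hn⟩ := exists_pow_lt_of_lt_one
    (div_pos (sub_pos.2 huv) (by positivity : 0 < u * (v + 1))) hp1
  have hpn : 0 < p ^ n := pow_pos hp0 n
  rw [lt_div_iff₀ (by positivity)] at hn
  have h1 := Nat.le_ceil (1 / (u * p ^ n))
  have h2 := Nat.ceil_lt_add_one (a := 1 / (u * p ^ n)) (by positivity)
  set N := ⌈1 / (u * p ^ n)⌉₊
  refine ⟨N * p ^ n, Subring.mul_mem _ (natCast_mem _ _) (Subring.pow_mem _ (mem_Zring_self p) _),
    ?_, ?_⟩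
  · have h3 : (N : ℝ) * p ^ n * u ≤ 1 + p ^ n * u := by
      have h4 : (N : ℝ) * (u * p ^ n) ≤ (1 / (u * p ^ n) + 1) * (u * p ^ n) :=
        mul_le_mul_of_nonneg_right h2.le (by positivity)
      rw [add_mul, one_div, inv_mul_cancel₀ (by positivity)] at h4
      linarith
    have h5 : (N : ℝ) * p ^ n * u * v ≤ u := by nlinarith
    have h6 : u * (N * p ^ n * v) ≤ u * 1 := by linarith
    exact le_of_mul_le_mul_left h6 hu
  · rw [div_le_iff₀ (by positivity)] at h1
    linarith

/-- A positive combination of positive elements can be rewritten with nonnegative coefficients. -/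
lemma exists_nonneg_coeff {p : ℝ} (hp0 : 0 < p) (hp1 : p < 1) {q : ℕ} {c x : Fin q → ℝ}
    (hc : ∀ j, c j ∈ Zring p) (hx : ∀ j, x j ∈ Zring p) (hx0 : ∀ j, 0 ≤ x j)
    (hpos : 0 < ∑ j, c j * x j) :
    ∃ z : Fin q → ℝ, (∀ j, 0 ≤ z j ∧ z j ∈ Zring p) ∧ ∑ j, z j * x j = ∑ j, c j * x j := by
  have hmax : ∀ t ∈ Zring p, max t 0 ∈ Zring p := fun t ht => by
    rcases max_choice t 0 with h | h <;> rw [h]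
    exacts [ht, Subring.zero_mem _]
  have hcp : ∀ j, max (c j) 0 ∈ Zring p := fun j => hmax _ (hc j)
  have hcn : ∀ j, max (-c j) 0 ∈ Zring p := fun j => hmax _ (Subring.neg_mem _ (hc j))
  set u := ∑ j, max (c j) 0 * x j with hu
  set v := ∑ j, max (-c j) 0 * x j with hv
  have huZ : u ∈ Zring p := Subring.sum_mem _ fun j _ => Subring.mul_mem _ (hcp j) (hx j)
  have hvZ : v ∈ Zring p := Subring.sum_mem _ fun j _ => Subring.mul_mem _ (hcn j) (hx j)
  have huv : u - v = ∑ j, c j * x j := by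
    rw [hu, hv, ← Finset.sum_sub_distrib]
    refine Finset.sum_congr rfl fun j _ => ?_
    rw [← sub_mul]
    congr 1
    rcases le_total (c j) 0 with h | h
    · rw [max_eq_right h, max_eq_left (by linarith)]; ring
    · rw [max_eq_left h, max_eq_right (by linarith)]; ring
  have hv0 : 0 ≤ v := Finset.sum_nonneg fun j _ => mul_nonneg (le_max_right _ _) (hx0 j)
  obtain ⟨K, hK, hKv, hKu⟩ := exists_mul_le_one_le_mul hp0 hp1 hv0 (u := u) (by linarith)
  refine ⟨fun j => (1 - K * v) * max (c j) 0 + (K * u - 1) * max (-c j) 0, fun j => ⟨?_, ?_⟩, ?_⟩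
  · exact add_nonneg (mul_nonneg (by linarith) (le_max_right _ _))
      (mul_nonneg (by linarith) (le_max_right _ _))
  · exact Subring.add_mem _ (Subring.mul_mem _ (Subring.sub_mem _ (Subring.one_mem _)
      (Subring.mul_mem _ hK hvZ)) (hcp j)) (Subring.mul_mem _ (Subring.sub_mem _
      (Subring.mul_mem _ hK huZ) (Subring.one_mem _)) (hcn j))
  · have : ∀ j, ((1 - K * v) * max (c j) 0 + (K * u - 1) * max (-c j) 0) * x j =
        (1 - K * v) * (max (c j) 0 * x j) + (K * u - 1) * (max (-c j) 0 * x j) := fun j => by ring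
    simp only [this]
    rw [Finset.sum_add_distrib, ← Finset.mul_sum, ← Finset.mul_sum, ← hu, ← hv, ← huv]
    ring

namespace SimSys

variable {X : Type*} [MetricSpace X] [MeasurableSpace X] {r p : ℝ} {D : SimSys X r p}

/-- A generator of the measures of clopen subsets of an island, with the representation of its
multiples by measures. -/
structure Island.Gen (I : D.Island) where
  a : ℝ
  a_pos : 0 < a
  exists_eq : ∀ A, IsClopen A → A ⊆ I.F → ∃ y ∈ Zring p, D.m A = a * y
  q : ℕ
  T : Fin q → Set X
  T_clopen : ∀ j, IsClopen (T j)
  T_subset : ∀ j, T j ⊆ I.F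
  T_nonempty : ∀ j, (T j).Nonempty
  repr : ∀ y ∈ Zring p, 0 < y → ∃ E, ∀ e, E ≤ e → ∃ N : Fin q → ℕ → ℕ,
    a * y = ∑ j, ∑ i ∈ Finset.range D.l, N j i * p ^ (e + i) * D.m (T j)

variable [BorelSpace X] [CompactSpace X] [TotallyDisconnectedSpace X]

lemma Island.nonempty_gen [Nonempty X] (I : D.Island) (hPID : IsPrincipalIdealRing (Zring p)) :
    Nonempty I.Gen := by
  have hZ : ∀ A, IsClopen A → D.m A ∈ Zring p := fun A hA => by
    obtain ⟨n, hn⟩ := D.exists_sat_of_isClopen hA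
    exact (hn n le_rfl).mem_Zring
  set s : Set (Zring p) := {x | ∃ A, IsClopen A ∧ A ⊆ I.F ∧ A.Nonempty ∧ (x : ℝ) = D.m A} with hs
  obtain ⟨g, hg⟩ := (hPID.principal (Ideal.span s)).principal
  have hmem : ∀ x ∈ s, ∃ y : Zring p, x = y * g := fun x hx => by
    have : x ∈ Submodule.span (Zring p) {g} := by
      rw [← hg]; exact Ideal.subset_span hx
    obtain ⟨y, hy⟩ := Submodule.mem_span_singleton.1 this
    exact ⟨y, hy.symm⟩
  have hF0 := I.sat_F.m_pos I.nonempty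
  have hFs : (⟨D.m I.F, hZ _ I.isClopen⟩ : Zring p) ∈ s :=
    ⟨I.F, I.isClopen, Subset.rfl, I.nonempty, rfl⟩
  have hg0 : g ≠ 0 := by
    rintro rfl
    obtain ⟨y, hy⟩ := hmem _ hFs
    rw [mul_zero] at hy
    have := congrArg (Subtype.val) hy
    exact hF0.ne' this
  obtain ⟨a, ha, hspan, hdiv⟩ : ∃ a : Zring p, 0 < (a : ℝ) ∧ a ∈ Ideal.span s ∧
      ∀ x ∈ s, ∃ y : Zring p, x = y * a := by
    have hgs : g ∈ Ideal.span s := by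
      have : g ∈ Submodule.span (Zring p) {g} := Submodule.mem_span_singleton_self g
      rw [← hg] at this
      exact this
    have hg0' : (g : ℝ) ≠ 0 := fun h => hg0 (Subtype.ext h)
    rcases lt_or_gt_of_ne hg0' with h | h
    · refine ⟨-g, by push_cast; linarith, neg_mem hgs, fun x hx => ?_⟩
      obtain ⟨y, rfl⟩ := hmem x hx
      exact ⟨-y, by ring⟩
    · exact ⟨g, h, hgs, hmem⟩
  obtain ⟨q, c, x, hcx⟩ := Submodule.mem_span_set'.1 hspan
  choose T hT1 hT2 hT3 hT4 using fun j => (x j).2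
  have hcx' : ∑ j, (c j : ℝ) * D.m (T j) = a := by
    rw [← hcx]
    push_cast
    exact Finset.sum_congr rfl fun j _ => by rw [← hT4 j]; rfl
  refine ⟨⟨a, ha, fun A hA hAF => ?_, q, T, hT1, hT2, hT3, fun y hy hy0 => ?_⟩⟩
  · rcases A.eq_empty_or_nonempty with rfl | hne
    · exact ⟨0, Subring.zero_mem _, by simp [D.m_empty]⟩
    · obtain ⟨y, hy⟩ := hdiv ⟨D.m A, hZ A hA⟩ ⟨A, hA, hAF, hne, rfl⟩
      refine ⟨y, y.2, ?_⟩
      have := congrArg Subtype.val hy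
      rw [mul_comm]
      exact this
  · obtain ⟨z, hz, hzx⟩ := exists_nonneg_coeff D.p_pos D.p_lt_one (fun j => (c j).2)
      (fun j => hZ _ (hT1 j)) (fun j => D.m_nonneg (T j)) (by rw [hcx']; exact ha)
    have hev : ∀ j, ∀ᶠ e in Filter.atTop, ∃ N : ℕ → ℕ,
        y * z j = ∑ i ∈ Finset.range D.l, N i * p ^ (e + i) := fun j => by
      rcases (hz j).1.eq_or_lt with h | h
      · exact Filter.Eventually.of_forall fun e => ⟨fun _ => 0, by simp [← h]⟩
      · exact exists_nat_repr D.lam_pos D.lam_le D.exists_lam_eq D.gcd_lam D.p_pos D.sum_p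
          (Subring.mul_mem _ hy (hz j).2) (mul_pos hy0 h)
    obtain ⟨E, hE⟩ := Filter.eventually_atTop.1 (Filter.eventually_all.2 hev)
    refine ⟨E, fun e he => ?_⟩
    choose N hN using hE e he
    refine ⟨N, ?_⟩
    rw [← hcx', ← hzx, Finset.sum_mul]
    refine Finset.sum_congr rfl fun j _ => ?_
    rw [← Finset.sum_mul, ← hN j]
    ring

/-! #### Packing copies -/

lemma exists_words_cyl_subset (D : SimSys X r p) : ∃ (δ : ℝ) (E₀ : ℕ), 0 < δ ∧
    ∀ (K : ℕ) (Z : Set X), D.Sat K Z → ∀ E, E₀ ≤ E → ∃ V : Finset (List D.ι),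
      (∀ v ∈ V, D.wt v = K + E ∧ D.cyl v ⊆ Z) ∧ δ * D.m Z ≤ V.card * p ^ (K + E) := by
  classical
  obtain ⟨δ, J, hδ, hJ⟩ := exists_card_exactWords_ge D.lam_pos D.lam_le D.exists_lam_eq D.gcd_lam
    D.p_pos D.sum_p
  refine ⟨δ, D.n₀ + D.l + J, hδ, fun K Z hZ E hE => ?_⟩
  set F := (cutSet D.lam (K + D.n₀)).filter fun w => D.cyl w ⊆ Z with hF
  have hFw : ∀ w ∈ F, IsCut D.lam w (K + D.n₀) ∧ D.cyl w ⊆ Z := fun w hw =>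
    ⟨(mem_cutSet D.lam_pos).1 (Finset.mem_filter.1 hw).1, (Finset.mem_filter.1 hw).2⟩
  let G : List D.ι → Finset (List D.ι) := fun w =>
    (exactWords D.lam (K + E - D.wt w)).image (w ++ ·)
  have hd : Set.PairwiseDisjoint (↑F) G := by
    intro w hw w' hw' hne
    rw [Function.onFun, Finset.disjoint_left]
    intro v hv hv'
    obtain ⟨t, -, rfl⟩ := Finset.mem_image.1 hv
    obtain ⟨t', -, ht'⟩ := Finset.mem_image.1 hv'
    have hp : w <+: w' ∨ w' <+: w := by
      refine isPrefix_total (List.prefix_append w t) ?_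
      rw [← ht']
      exact List.prefix_append w' t'
    have h1 := (hFw w hw).1
    have h2 := (hFw w' hw').1
    rcases hp with h | h
    · exact hne (h1.eq_of_prefix_of_isCut h2 h)
    · exact hne (h2.eq_of_prefix_of_isCut h1 h).symm
  have hwt : ∀ w ∈ F, D.wt w < K + D.n₀ + D.l := fun w hw => D.cut_wt_lt (hFw w hw).1
  refine ⟨F.biUnion G, fun v hv => ?_, ?_⟩
  · obtain ⟨w, hw, hv⟩ := Finset.mem_biUnion.1 hv
    obtain ⟨t, ht, rfl⟩ := Finset.mem_image.1 hv
    have ht := (mem_exactWords D.lam_pos).1 ht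
    have := hwt w hw
    refine ⟨?_, (D.cyl_append_subset _ _).trans (hFw w hw).2⟩
    rw [wt_append, show D.wt t = K + E - D.wt w from ht]
    omega
  · rw [Finset.card_biUnion hd, hZ.m_eq, Finset.mul_sum, Nat.cast_sum, Finset.sum_mul]
    refine Finset.sum_le_sum fun w hw => ?_
    have h1 := hwt w hw
    rw [Finset.card_image_of_injective _ (List.append_right_injective _)]
    have h2 := hJ (K + E - D.wt w) (by omega)
    have h3 := mul_le_mul_of_nonneg_right h2 (D.ppow_pos (D.wt w)).le
    rwa [mul_assoc, ← pow_add, Nat.sub_add_cancel (by omega)] at h3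

lemma Island.exists_copies (I : D.Island) {Z : Set X} {W j₀ L : ℕ} (hj₀ : I.j ≤ j₀)
    {V : Finset (List D.ι)} (hV : ∀ v ∈ V, D.wt v = W ∧ D.cyl v ⊆ Z) {J : Type} [Fintype J]
    (hJ : Fintype.card J ≤ V.card) (w : J → List D.ι) (hw : ∀ j, D.wt (w j) ≤ L) (T : J → Set X)
    (hT : ∀ j, D.Sat j₀ (T j) ∧ T j ⊆ I.F) :
    ∃ B ⊆ Z, D.Sat (W + L + j₀) B ∧ D.m B = ∑ j, p ^ (W + D.wt (w j)) * D.m (T j) := by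
  classical
  obtain ⟨g⟩ : Nonempty (J ↪ V) := Function.Embedding.nonempty_of_card_le (by simpa using hJ)
  let u : J → List D.ι := fun j => (g j).1 ++ w j
  have hwt : ∀ j, D.wt (u j) = W + D.wt (w j) := fun j => by
    rw [wt_append, (hV _ (g j).2).1]
  have hsat : ∀ j, D.Sat (W + L + j₀) (D.S (u j) '' T j) := fun j => by
    refine (I.sat_image hj₀ (hT j).1 (hT j).2).mono ?_
    rw [hwt]
    have := hw j
    omega
  refine ⟨⋃ j ∈ (Finset.univ : Finset J), D.S (u j) '' T j, ?_, ?_, ?_⟩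
  · refine iUnion₂_subset fun j _ => ?_
    refine (image_subset_range _ _).trans ((D.cyl_append_subset _ _).trans (hV _ (g j).2).2)
  · exact Sat.biUnion (s := (↑(Finset.univ : Finset J) : Set J)) fun j _ => hsat j
  · rw [D.m_biUnion]
    · refine Finset.sum_congr rfl fun j _ => ?_
      rw [I.m_image _ (hT j).1.isClosed (hT j).2, hwt]
    · intro i _ j _ hij
      refine Disjoint.mono (image_mono (hT i).2) (image_mono (hT j).2) ?_
      have hne : (g i).1 ≠ (g j).1 := fun h => hij (g.injective (Subtype.ext h))
      have key : ∀ i j, (g i).1 ≠ (g j).1 → ¬ u i <+: u j := by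
        intro i j hne hp
        have hc : ∀ i, IsCut D.lam (g i).1 W := fun i => by
          have := isCut_wordWt D.lam_pos (g i).1
          rwa [show wordWt D.lam (g i).1 = W from (hV _ (g i).2).1] at this
        have h1 : (g i).1 <+: u j := (List.prefix_append _ _).trans hp
        rcases isPrefix_total h1 (List.prefix_append (g j).1 (w j)) with h | h
        · exact hne ((hc i).eq_of_prefix_of_isCut (hc j) h)
        · exact hne ((hc j).eq_of_prefix_of_isCut (hc i) h).symm
      exact I.disjoint_image (key i j hne) (key j i hne.symm)
    · exact fun j _ => (hsat j).measurableSet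

end SimSys

namespace SimSys

variable {X : Type*} [MetricSpace X] [MeasurableSpace X] {r p : ℝ} {D : SimSys X r p}
variable [BorelSpace X] [CompactSpace X] [TotallyDisconnectedSpace X]

lemma exists_gap (D : SimSys X r p) (Y : Finset ℝ) : ∃ δ : ℝ, 0 < δ ∧ ∀ (k : ℕ) (A : Set X),
    D.Sat k A → ∀ y ∈ Y, p ^ k * y < D.m A → p ^ k * δ ≤ D.m A - p ^ k * y := by
  set Γ : Set ℝ := {x | ∃ N : ℕ → ℕ, x = ∑ i ∈ Finset.range D.l, N i * p ^ (D.n₀ + i)}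
  have hfin : (⋃ y ∈ Y, (fun x => x - y) '' {x | x ≤ y + 1 ∧ x ∈ Γ}).Finite :=
    Y.finite_toSet.biUnion fun y _ =>
      (finite_nat_combinations_le (fun i => p ^ (D.n₀ + i)) (fun i => D.ppow_pos _) (y + 1)).image _
  obtain ⟨δ, hδ, h⟩ := (hfin.subset (sep_subset _ fun x => 0 < x)).exists_pos_le
    (η := fun x => x) fun x hx => hx.2
  refine ⟨min δ 1, lt_min hδ one_pos, fun k A hA y hy hlt => ?_⟩
  obtain ⟨N, hN⟩ := hA.m_eq_comb
  have hk := D.ppow_pos k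
  set s := ∑ i ∈ Finset.range D.l, (N i : ℝ) * p ^ (D.n₀ + i) with hs
  rw [hN] at hlt ⊢
  rw [← mul_sub]
  refine mul_le_mul_of_nonneg_left ?_ hk.le
  have hys := lt_of_mul_lt_mul_left hlt hk.le
  by_cases h1 : s ≤ y + 1
  · refine (min_le_left _ _).trans (h (s - y) ⟨mem_iUnion₂.2 ⟨y, hy, s, ⟨h1, N, hs⟩, rfl⟩, ?_⟩)
    linarith
  · exact (min_le_right _ _).trans (by linarith)

namespace Island.Gen

variable {I : D.Island} (G : I.Gen)

lemma exists_level : ∃ j₀, I.j ≤ j₀ ∧ ∀ j, D.Sat j₀ (G.T j) := by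
  choose n hn using fun j => D.exists_sat_of_isClopen (G.T_clopen j)
  refine ⟨I.j + ∑ j, n j, by omega, fun j => hn j _ ?_⟩
  have := Finset.single_le_sum (f := n) (fun i _ => Nat.zero_le _) (Finset.mem_univ j)
  omega

lemma exists_pos_le_m : ∃ δ : ℝ, 0 < δ ∧ ∀ j, δ ≤ D.m (G.T j) := by
  obtain ⟨j₀, -, h⟩ := G.exists_level
  exact ⟨p ^ (j₀ + D.n₀ + D.l), D.ppow_pos _, fun j => (h j).le_m (G.T_nonempty j)⟩

/-- A set of large measure contains one of any measure in a prescribed finite set. -/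
lemma exists_subset (Y : Finset ℝ) (hY : ∀ y ∈ Y, 0 < y ∧ y ∈ Zring p) :
    ∃ h : ℕ, ∀ (k : ℕ) (A : Set X), D.Sat k A → A ⊆ I.F → ∀ y ∈ Y,
      p ^ k * (G.a * y) ≤ D.m A → ∃ A' ⊆ A, D.Sat (k + h) A' ∧ D.m A' = p ^ k * (G.a * y) := by
  classical
  obtain ⟨δ₀, hδ₀, hgap⟩ := D.exists_gap (Y.image fun y => G.a * y)
  obtain ⟨M, hM, hMm⟩ := D.exists_m_le 1
  obtain ⟨δ, E₀, hδ, hwords⟩ := D.exists_words_cyl_subset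
  obtain ⟨J, hJ⟩ := exists_word_of_gcd D.gcd_lam
  choose! wd hwd using hJ
  obtain ⟨μ₀, hμ₀, hT⟩ := G.exists_pos_le_m
  obtain ⟨j₀, hj₀, hTs⟩ := G.exists_level
  have ha := G.a_pos
  obtain ⟨n, hn⟩ := exists_pow_lt_of_lt_one
    (div_pos (mul_pos (mul_pos (mul_pos hδ hδ₀) hμ₀) (D.ppow_pos (J + D.l))) hM) D.p_lt_one
  rw [lt_div_iff₀ hM] at hn
  set Γ : Set ℝ := {x | ∃ N : ℕ → ℕ, x = ∑ i ∈ Finset.range D.l, N i * p ^ (D.n₀ + i)}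
  set Y' : Set ℝ := {t | (0 < t ∧ t ∈ Zring p) ∧ ∃ y ∈ Y, ∃ s ∈ Γ, t = y / p ^ n - s / G.a} with hY'
  have hfin : Y'.Finite := by
    have : (⋃ y ∈ Y, (fun s => y / p ^ n - s / G.a) ''
        {s | s ≤ y / p ^ n * G.a ∧ s ∈ Γ}).Finite :=
      Y.finite_toSet.biUnion fun y _ => (finite_nat_combinations_le
        (fun i => p ^ (D.n₀ + i)) (fun i => D.ppow_pos _) (y / p ^ n * G.a)).image _
    refine this.subset ?_
    rintro t ⟨⟨ht, -⟩, y, hy, s, hs, rfl⟩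
    refine mem_iUnion₂.2 ⟨y, hy, s, ⟨?_, hs⟩, rfl⟩
    rw [← div_le_iff₀ ha]
    linarith
  obtain ⟨E, hE⟩ := hfin.exists_forall_le (P := fun t e => ∃ N : Fin G.q → ℕ → ℕ,
    G.a * t = ∑ j, ∑ i ∈ Finset.range D.l, N j i * p ^ (e + i) * D.m (G.T j))
    fun t ht => G.repr t ht.1.2 ht.1.1
  set e := E + J + E₀ with he
  refine ⟨n + e + D.l + j₀, fun k A hA hAF y hy hle => ?_⟩
  rcases hle.eq_or_lt with heq | hlt
  · exact ⟨A, Subset.rfl, hA.mono (by omega), heq.symm⟩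
  have hA' : D.Sat (k + n) A := hA.mono (by omega)
  obtain ⟨A₁, ⟨hA₁, hA₁A, hA₁m⟩, hmax⟩ := Set.exists_max_image
    {B | D.Sat (k + n) B ∧ B ⊆ A ∧ D.m B < p ^ k * (G.a * y)} D.m
    ((D.finite_sat (k + n)).subset fun B hB => hB.1)
    ⟨∅, D.sat_empty _, empty_subset _, by
      rw [D.m_empty]; exact mul_pos (D.ppow_pos k) (mul_pos ha (hY y hy).1)⟩
  set Z := A \ A₁ with hZ
  have hZs : D.Sat (k + n) Z := hA'.diff hA₁
  have hZm : D.m Z = D.m A - D.m A₁ := D.m_diff hA₁A hA₁.measurableSet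
  have hZm' : p ^ k * δ₀ ≤ D.m Z := by
    have := hgap k A hA _ (Finset.mem_image_of_mem _ hy) hlt
    linarith
  set ρ := p ^ k * (G.a * y) - D.m A₁ with hρ
  have hkn := D.ppow_pos (k + n)
  have hρM : ρ ≤ M * p ^ (k + n) := by
    have hZne : Z.Nonempty := by
      by_contra hne
      rw [Set.not_nonempty_iff_eq_empty.1 hne, D.m_empty] at hZm'
      exact absurd hZm' (not_le.2 (mul_pos (D.ppow_pos k) hδ₀))
    obtain ⟨x, hx⟩ := hZne
    set R := D.cls (k + n) x
    have hR := D.sat_cls (k + n) x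
    have hRZ : R ⊆ Z := hZs.cls_subset hx
    have hRm := hR.m_pos ⟨x, D.mem_cls_self _ _⟩
    have hRM : D.m R ≤ M * p ^ (k + n) := hMm _ _ hR.measurableSet fun u hu v hv => by
      rw [one_mul]; exact D.dist_le_of_mem_cls hu hv
    have hU : D.m (A₁ ∪ R) = D.m A₁ + D.m R :=
      D.m_union (Set.disjoint_left.2 fun z hz hz' => (hRZ hz').2 hz) hR.measurableSet
    by_contra! hcon
    have := hmax (A₁ ∪ R) ⟨hA₁.union hR, union_subset hA₁A (hRZ.trans sdiff_subset), by
      rw [hU]; linarith⟩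
    linarith
  set t := ρ / (G.a * p ^ (k + n)) with ht
  have htρ : p ^ (k + n) * (G.a * t) = ρ := by
    rw [ht]
    field_simp
  have htY : t ∈ Y' := by
    obtain ⟨N, hN⟩ := hA₁.m_eq_comb
    obtain ⟨y₁, hy₁, hm₁⟩ := G.exists_eq A₁ hA₁.isClopen (hA₁A.trans hAF)
    have hp := D.p_pos.ne'
    have hinv := inv_mem_Zring D.lam_pos D.sum_p
    refine ⟨⟨div_pos (by linarith) (mul_pos ha hkn), ?_⟩, y, hy, _, ⟨N, rfl⟩, ?_⟩
    · have : t = y * p⁻¹ ^ n - y₁ * p⁻¹ ^ (k + n) := by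
        rw [ht, hρ, hm₁, inv_pow, inv_pow, pow_add]
        have h1 := D.p_pos
        field_simp
      rw [this]
      exact Subring.sub_mem _ (Subring.mul_mem _ (hY y hy).2 (Subring.pow_mem _ hinv _))
        (Subring.mul_mem _ hy₁ (Subring.pow_mem _ hinv _))
    · have h1 := D.p_pos
      rw [ht, hρ, hN, pow_add]
      field_simp
  obtain ⟨N, hN⟩ := hE t htY e (by omega)
  obtain ⟨V, hV, hVc⟩ := hwords (k + n) Z hZs (e - J) (by omega)
  have hat : G.a * t ≤ M := by
    rw [← htρ, mul_comm M] at hρM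
    exact le_of_mul_le_mul_left hρM hkn
  have hcard : ∑ j, ∑ i ∈ Finset.range D.l, N j i ≤ V.card := by
    have h1 : (∑ j, ∑ i ∈ Finset.range D.l, N j i : ℕ) * (p ^ (e + D.l) * μ₀) ≤ M := by
      refine le_trans ?_ hat
      rw [hN]
      push_cast
      rw [Finset.sum_mul]
      refine Finset.sum_le_sum fun j _ => ?_
      rw [Finset.sum_mul]
      refine Finset.sum_le_sum fun i hi => ?_
      rw [mul_assoc]
      refine mul_le_mul_of_nonneg_left (mul_le_mul (D.ppow_le ?_) (hT j) hμ₀.le (D.ppow_pos _).le)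
        (Nat.cast_nonneg _)
      have := Finset.mem_range.1 hi
      omega
    have h2 := (mul_le_mul_of_nonneg_left hZm' hδ.le).trans hVc
    have h3 : p ^ (k + n + (e - J)) * p ^ J = p ^ k * p ^ n * p ^ e := by
      rw [← pow_add, ← pow_add, ← pow_add]
      congr 1
      omega
    have h4 := mul_le_mul_of_nonneg_right h2 (D.ppow_pos J).le
    rw [mul_assoc (V.card : ℝ), h3] at h4
    have h5 := mul_le_mul_of_nonneg_right h1 (D.ppow_pos n).le
    rw [pow_add] at h5 hn
    set c := (∑ j, ∑ i ∈ Finset.range D.l, N j i : ℕ)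
    have hk := D.ppow_pos k
    have hl := D.ppow_pos D.l
    have h6 : δ * δ₀ * p ^ J ≤ V.card * (p ^ n * p ^ e) := by
      refine le_of_mul_le_mul_left (a := p ^ k) ?_ hk
      linarith
    have h7 : (c : ℝ) * (p ^ n * p ^ e) ≤ δ * δ₀ * p ^ J := by
      refine le_of_mul_le_mul_left (a := μ₀ * p ^ D.l) ?_ (mul_pos hμ₀ hl)
      linarith
    have h8 := le_of_mul_le_mul_right (h7.trans h6) (mul_pos (D.ppow_pos n) (D.ppow_pos e))
    exact_mod_cast h8
  let Jt : Type := (j : Fin G.q) × (i : Fin D.l) × Fin (N j i)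
  have hJc : Fintype.card Jt ≤ V.card := by
    refine le_trans (le_of_eq ?_) hcard
    simp only [Jt, Fintype.card_sigma, Fintype.card_fin]
    exact Finset.sum_congr rfl fun j _ => Fin.sum_univ_eq_sum_range (fun i => N j i) D.l
  have hwt : ∀ i, D.wt (wd (J + i)) = J + i := fun i => hwd (J + i) (by omega)
  obtain ⟨B, hBZ, hBs, hBm⟩ := I.exists_copies (L := J + D.l) hj₀ hV hJc
    (fun c => wd (J + c.2.1)) (fun c => by rw [hwt]; have := c.2.1.2; omega) (fun c => G.T c.1)
    (fun c => ⟨hTs c.1, G.T_subset c.1⟩)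
  have hBs' : D.Sat (k + (n + e + D.l + j₀)) B := hBs.mono (by omega)
  refine ⟨A₁ ∪ B, union_subset hA₁A (hBZ.trans sdiff_subset),
    (hA₁.mono (by omega)).union hBs', ?_⟩
  rw [D.m_union (Set.disjoint_left.2 fun z hz hz' => (hBZ hz').2 hz) hBs'.measurableSet]
  suffices D.m B = ρ by rw [this]; ring
  rw [hBm, ← htρ, hN, Fintype.sum_sigma, Finset.mul_sum]
  refine Finset.sum_congr rfl fun j _ => ?_
  rw [Fintype.sum_sigma, Finset.mul_sum, ← Fin.sum_univ_eq_sum_range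
    (fun i => p ^ (k + n) * (N j i * p ^ (e + i) * D.m (G.T j)))]
  refine Finset.sum_congr rfl fun i _ => ?_
  simp only [hwt]
  rw [Finset.sum_const, Finset.card_univ, Fintype.card_fin, nsmul_eq_mul,
    show k + n + (e - J) + (J + (i : ℕ)) = (k + n) + (e + i) by omega, pow_add p (k + n)]
  ring

/-- A set whose measure is a sum of prescribed values splits accordingly. -/
lemma exists_split (Q : ℕ) (Y : Finset ℝ) (hY : ∀ y ∈ Y, 0 < y ∧ y ∈ Zring p) :
    ∃ h₀ : ℕ, ∀ h, h₀ ≤ h → ∀ (k : ℕ) (A : Set X), D.Sat k A → A ⊆ I.F →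
      ∀ (ι : Type) (s : Finset ι) (y : ι → ℝ), s.card ≤ Q → (∀ i ∈ s, y i ∈ Y) →
      D.m A = p ^ k * (G.a * ∑ i ∈ s, y i) →
      ∃ B : ι → Set X, (∀ i ∈ s, D.Sat (k + h) (B i) ∧ D.m (B i) = p ^ k * (G.a * y i)) ∧
        (∀ i ∈ s, ∀ j ∈ s, i ≠ j → Disjoint (B i) (B j)) ∧ ⋃ i ∈ s, B i = A := by
  classical
  induction Q generalizing Y with
  | zero =>
    refine ⟨0, fun h _ k A hA hAF ι s y hs hy hm => ⟨fun _ => ∅, ?_⟩⟩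
    have : s = ∅ := Finset.card_eq_zero.1 (Nat.le_zero.1 hs)
    subst this
    have hA0 : A = ∅ := by
      by_contra hne
      have := hA.m_pos (nonempty_iff_ne_empty.2 hne)
      rw [hm] at this
      simp at this
    simp [hA0]
  | succ Q ih =>
    obtain ⟨h₁, hh₁⟩ := G.exists_subset Y hY
    have hinv := inv_mem_Zring D.lam_pos D.sum_p
    obtain ⟨h₂, hh₂⟩ := ih (Y.image fun y => y * p⁻¹ ^ h₁) fun y' hy' => by
      obtain ⟨y, hy, rfl⟩ := Finset.mem_image.1 hy'
      exact ⟨mul_pos (hY y hy).1 (pow_pos (inv_pos.2 D.p_pos) _),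
        Subring.mul_mem _ (hY y hy).2 (Subring.pow_mem _ hinv _)⟩
    refine ⟨h₁ + h₂, fun h hh k A hA hAF ι s y hs hy hm => ?_⟩
    rcases s.eq_empty_or_nonempty with rfl | ⟨i₀, hi₀⟩
    · have hA0 : A = ∅ := by
        by_contra hne
        have := hA.m_pos (nonempty_iff_ne_empty.2 hne)
        rw [hm] at this
        simp at this
      exact ⟨fun _ => ∅, by simp [hA0]⟩
    have hk := D.ppow_pos k
    have hsum := Finset.add_sum_erase s y hi₀
    obtain ⟨A', hA'A, hA's, hA'm⟩ := hh₁ k A hA hAF (y i₀) (hy _ hi₀) (by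
      rw [hm, ← hsum]
      refine mul_le_mul_of_nonneg_left (mul_le_mul_of_nonneg_left ?_ G.a_pos.le) hk.le
      have := Finset.sum_nonneg fun i (hi : i ∈ s.erase i₀) =>
        (hY _ (hy i (Finset.mem_of_mem_erase hi))).1.le
      linarith)
    have hp := D.p_pos.ne'
    have hpp : p ^ h₁ * p⁻¹ ^ h₁ = 1 := by rw [← mul_pow, mul_inv_cancel₀ hp, one_pow]
    have hscale : ∀ u, p ^ (k + h₁) * (G.a * (u * p⁻¹ ^ h₁)) = p ^ k * (G.a * u) := fun u => by
      rw [pow_add]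
      calc _ = p ^ k * (G.a * u) * (p ^ h₁ * p⁻¹ ^ h₁) := by ring
        _ = _ := by rw [hpp, mul_one]
    obtain ⟨B, hB1, hB2, hB3⟩ := hh₂ (h - h₁) (by omega) (k + h₁) (A \ A')
      ((hA.mono (by omega)).diff hA's)
      (sdiff_subset.trans hAF) ι (s.erase i₀) (fun i => y i * p⁻¹ ^ h₁)
      (by rw [Finset.card_erase_of_mem hi₀]; omega)
      (fun i hi => Finset.mem_image_of_mem _ (hy i (Finset.mem_of_mem_erase hi)))
      (by
        rw [← Finset.sum_mul, hscale, D.m_diff hA'A hA's.measurableSet, hm, hA'm, ← hsum]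
        ring)
    have hBA : ∀ i ∈ s.erase i₀, Disjoint A' (B i) := fun i hi => by
      rw [Set.disjoint_left]
      intro x hx hx'
      have : x ∈ A \ A' := hB3 ▸ mem_iUnion₂.2 ⟨i, hi, hx'⟩
      exact this.2 hx
    have hne : ∀ i ∈ s, i ≠ i₀ → i ∈ s.erase i₀ := fun i hi h => Finset.mem_erase.2 ⟨h, hi⟩
    refine ⟨Function.update B i₀ A', fun i hi => ?_, fun i hi j hj hij => ?_, ?_⟩
    · by_cases h0 : i = i₀
      · subst h0
        rw [Function.update_self]
        exact ⟨hA's.mono (by omega), hA'm⟩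
      · rw [Function.update_of_ne h0]
        obtain ⟨b1, b2⟩ := hB1 i (hne i hi h0)
        refine ⟨b1.mono (by omega), ?_⟩
        rw [b2, hscale]
    · by_cases h0 : i = i₀
      · subst h0
        rw [Function.update_self, Function.update_of_ne hij.symm]
        exact hBA j (hne j hj hij.symm)
      · by_cases h1 : j = i₀
        · subst h1
          rw [Function.update_self, Function.update_of_ne h0]
          exact (hBA i (hne i hi h0)).symm
        · rw [Function.update_of_ne h0, Function.update_of_ne h1]
          exact hB2 i (hne i hi h0) j (hne j hj h1) hij
    · rw [← Finset.insert_erase hi₀, Finset.set_biUnion_insert_update _ (Finset.notMem_erase i₀ s),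
        hB3, union_sdiff_cancel hA'A]

end Island.Gen
end SimSys

/-! ### Comparison of islands of two systems -/

namespace SimSys.Island.Gen

section OneSystem

variable {X : Type*} [MetricSpace X] [MeasurableSpace X] {r p : ℝ} {D : SimSys X r p}
variable [BorelSpace X] [CompactSpace X] [TotallyDisconnectedSpace X] [Nonempty X]
variable {I : D.Island} (G : I.Gen)

lemma exists_values : ∃ V : Finset ℝ, (∀ v ∈ V, 0 < v ∧ v ∈ Zring p) ∧
    ∀ k A, D.Sat k A → A ⊆ I.F → ∀ R ∈ D.classes k A, D.m R / (p ^ k * G.a) ∈ V := by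
  obtain ⟨M, hM, hMm⟩ := D.exists_m_le 1
  have ha := G.a_pos
  set Γ : Set ℝ := {x | x ≤ M ∧ ∃ N : ℕ → ℕ, x = ∑ i ∈ Finset.range D.l, N i * p ^ (D.n₀ + i)}
    with hΓ
  have hfin : ((fun x => x / G.a) '' Γ).Finite :=
    (finite_nat_combinations_le (fun i => p ^ (D.n₀ + i)) (fun i => D.ppow_pos _) M).image _
  have hfin' : {v | (0 < v ∧ v ∈ Zring p) ∧ v ∈ (fun x => x / G.a) '' Γ}.Finite :=
    hfin.subset fun v hv => hv.2
  refine ⟨hfin'.toFinset, fun v hv => ((hfin'.mem_toFinset).1 hv).1,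
    fun k A hA hAF R hR => (hfin'.mem_toFinset).2 ?_⟩
  have hk := D.ppow_pos k
  have hRs := D.sat_of_mem_classes hR
  have hpos := hRs.m_pos (D.nonempty_of_mem_classes hR)
  obtain ⟨y, hy, hm⟩ := G.exists_eq R hRs.isClopen ((hA.subset_of_mem_classes hR).trans hAF)
  obtain ⟨N, hN⟩ := hRs.m_eq_comb
  have hp := D.p_pos
  refine ⟨⟨div_pos hpos (mul_pos hk ha), ?_⟩, _, ⟨?_, N, rfl⟩, ?_⟩
  · have : D.m R / (p ^ k * G.a) = y * p⁻¹ ^ k := by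
      rw [hm, inv_pow]
      field_simp
    rw [this]
    exact Subring.mul_mem _ hy (Subring.pow_mem _ (inv_mem_Zring D.lam_pos D.sum_p) _)
  · have := hMm k R hRs.measurableSet fun u hu v hv => by
      rw [one_mul]; exact D.dist_le_of_mem_classes hR hu hv
    rw [hN, mul_comm M] at this
    exact le_of_mul_le_mul_left this hk
  · simp only
    rw [hN]
    field_simp

/-- Simultaneous splitting of all classes of a saturated set. -/
lemma exists_pieces (Q : ℕ) (Y : Finset ℝ) (hY : ∀ y ∈ Y, 0 < y ∧ y ∈ Zring p) :
    ∃ h₀ : ℕ, ∀ h, h₀ ≤ h → ∀ (k : ℕ) (A : Set X), D.Sat k A → A ⊆ I.F →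
      ∀ (J : Type) (t : Finset J) (z : Set X → J → ℝ),
      (∀ R ∈ D.classes k A, ∀ j ∈ t, z R j ≠ 0 → z R j ∈ Y) →
      (∀ R ∈ D.classes k A, ∑ j ∈ t, z R j = D.m R / (p ^ k * G.a)) →
      (∀ R ∈ D.classes k A, (t.filter fun j => z R j ≠ 0).card ≤ Q) →
      ∃ b : Set X → J → Set X,
        (∀ R ∈ D.classes k A, ∀ j ∈ t, z R j ≠ 0 → D.Sat (k + h) (b R j) ∧ b R j ⊆ R ∧
          (b R j).Nonempty ∧ D.m (b R j) = p ^ k * (G.a * z R j)) ∧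
        (∀ R ∈ D.classes k A, ∀ j ∈ t, z R j ≠ 0 → ∀ R' ∈ D.classes k A, ∀ j' ∈ t, z R' j' ≠ 0 →
          (R, j) ≠ (R', j') → Disjoint (b R j) (b R' j')) ∧
        ∀ x ∈ A, ∃ R ∈ D.classes k A, ∃ j ∈ t, z R j ≠ 0 ∧ x ∈ b R j := by
  obtain ⟨h₀, hsplit⟩ := G.exists_split Q Y hY
  refine ⟨h₀, fun h hh k A hA hAF J t z hzY hsum hcard => ?_⟩
  have hk := D.ppow_pos k
  have ha := G.a_pos
  have key : ∀ R, ∃ B : J → Set X, R ∈ D.classes k A →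
      (∀ j ∈ t.filter fun j => z R j ≠ 0,
        D.Sat (k + h) (B j) ∧ D.m (B j) = p ^ k * (G.a * z R j)) ∧
      (∀ i ∈ t.filter fun j => z R j ≠ 0, ∀ j ∈ t.filter fun j => z R j ≠ 0, i ≠ j →
        Disjoint (B i) (B j)) ∧
      ⋃ j ∈ t.filter fun j => z R j ≠ 0, B j = R := fun R => by
    by_cases hR : R ∈ D.classes k A
    · obtain ⟨B, hB⟩ := hsplit h hh k R (D.sat_of_mem_classes hR)
        ((hA.subset_of_mem_classes hR).trans hAF) J (t.filter fun j => z R j ≠ 0) (z R)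
        (hcard R hR) (fun j hj => hzY R hR j (Finset.mem_filter.1 hj).1 (Finset.mem_filter.1 hj).2)
        (by
          rw [Finset.sum_filter_ne_zero, hsum R hR]
          field_simp)
      exact ⟨B, fun _ => hB⟩
    · exact ⟨fun _ => ∅, fun h => absurd h hR⟩
  choose b hb using key
  have hbR : ∀ R ∈ D.classes k A, ∀ j ∈ t, z R j ≠ 0 → b R j ⊆ R := fun R hR j hj hz => by
    have := (hb R hR).2.2
    conv_rhs => rw [← this]
    exact subset_biUnion_of_mem (u := fun j => b R j) (Finset.mem_filter.2 ⟨hj, hz⟩)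
  refine ⟨b, fun R hR j hj hz => ?_, fun R hR j hj hz R' hR' j' hj' hz' hne => ?_,
    fun x hx => ?_⟩
  · obtain ⟨h1, h2⟩ := (hb R hR).1 j (Finset.mem_filter.2 ⟨hj, hz⟩)
    refine ⟨h1, hbR R hR j hj hz, ?_, h2⟩
    by_contra hne
    rw [Set.not_nonempty_iff_eq_empty.1 hne, D.m_empty] at h2
    exact (mul_pos hk (mul_pos ha (hY _ (hzY R hR j hj hz)).1)).ne h2
  · by_cases hRR : R = R'
    · subst hRR
      refine (hb R hR).2.1 j (Finset.mem_filter.2 ⟨hj, hz⟩) j' (Finset.mem_filter.2 ⟨hj', hz'⟩) ?_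
      rintro rfl
      exact hne rfl
    · exact (D.disjoint_of_mem_classes hR hR' hRR).mono (hbR R hR j hj hz) (hbR R' hR' j' hj' hz')
  · rw [← hA.biUnion_classes] at hx
    obtain ⟨R, hR, hxR⟩ := mem_iUnion₂.1 hx
    rw [← (hb R hR).2.2] at hxR
    obtain ⟨j, hj, hxj⟩ := mem_iUnion₂.1 hxR
    exact ⟨R, hR, j, (Finset.mem_filter.1 hj).1, (Finset.mem_filter.1 hj).2, hxj⟩

end OneSystem

variable {X X' : Type} [MetricSpace X] [MeasurableSpace X] [MetricSpace X'] [MeasurableSpace X']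
  {r p : ℝ} {D : SimSys X r p} {D' : SimSys X' r p}
variable [BorelSpace X] [CompactSpace X] [TotallyDisconnectedSpace X]
  [BorelSpace X'] [CompactSpace X'] [TotallyDisconnectedSpace X'] [Nonempty X] [Nonempty X']
variable {I : D.Island} {I' : D'.Island} (G : I.Gen) (G' : I'.Gen)

/-- Pairs of saturated subsets of two islands with the same normalized measure. -/
structure Matched (C : ℝ) (k : ℕ) (A : Set X) (B : Set X') : Prop where
  sat : D.Sat k A
  sat' : D'.Sat k B
  subset : A ⊆ I.F
  subset' : B ⊆ I'.F
  nonempty : A.Nonempty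
  nonempty' : B.Nonempty
  dist_le : ∀ x ∈ A, ∀ y ∈ A, dist x y ≤ C * r ^ k
  dist_le' : ∀ x ∈ B, ∀ y ∈ B, dist x y ≤ C * r ^ k
  m_eq : D.m A / G.a = D'.m B / G'.a

lemma exists_matched : ∃ C k A B, Matched G G' C k A B := by
  have ha := G.a_pos
  have ha' := G'.a_pos
  have hF := I.sat_F.m_pos I.nonempty
  have hF' := I'.sat_F.m_pos I'.nonempty
  obtain ⟨K, hK⟩ := exists_pow_lt_of_lt_one
    (lt_min (div_pos hF ha) (div_pos hF' ha')) D.p_lt_one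
  rw [lt_min_iff, lt_div_iff₀ ha, lt_div_iff₀ ha'] at hK
  have hY : ∀ y ∈ ({p ^ K} : Finset ℝ), 0 < y ∧ y ∈ Zring p := fun y hy => by
    rw [Finset.mem_singleton.1 hy]
    exact ⟨D.ppow_pos K, Subring.pow_mem _ (mem_Zring_self p) K⟩
  obtain ⟨h, hh⟩ := G.exists_subset _ hY
  obtain ⟨h', hh'⟩ := G'.exists_subset _ hY
  set k := I.j + I'.j
  have hk1 : p ^ k ≤ 1 := pow_le_one₀ D.p_pos.le D.p_lt_one.le
  have hbd : ∀ {a m : ℝ}, 0 < a → p ^ K * a < m → p ^ k * (a * p ^ K) ≤ m := fun {a m} h0 h1 => by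
    have h2 : 0 < a * p ^ K := mul_pos h0 (D.ppow_pos K)
    have := mul_le_mul_of_nonneg_right hk1 h2.le
    linarith
  obtain ⟨A, hAF, hA, hAm⟩ := hh k I.F (I.sat_F.mono (by omega)) Subset.rfl _
    (Finset.mem_singleton_self _) (hbd ha hK.1)
  obtain ⟨B, hBF, hB, hBm⟩ := hh' k I'.F (I'.sat_F.mono (by omega)) Subset.rfl _
    (Finset.mem_singleton_self _) (hbd ha' hK.2)
  have hr := D.rpow_pos (k + h + h')
  have hd := D.one_le_diamBd
  have hd' := D'.one_le_diamBd
  have hne : A.Nonempty := by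
    by_contra hne
    rw [Set.not_nonempty_iff_eq_empty.1 hne, D.m_empty] at hAm
    exact (mul_pos (D.ppow_pos k) (mul_pos ha (D.ppow_pos K))).ne hAm
  have hne' : B.Nonempty := by
    by_contra hne
    rw [Set.not_nonempty_iff_eq_empty.1 hne, D'.m_empty] at hBm
    exact (mul_pos (D.ppow_pos k) (mul_pos ha' (D.ppow_pos K))).ne hBm
  refine ⟨(D.diamBd + D'.diamBd) / r ^ (k + h + h'), k + h + h', A, B, hA.mono (by omega),
    hB.mono (by omega), hAF, hBF, hne, hne', fun x _ y _ => ?_, fun x _ y _ => ?_, ?_⟩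
  · rw [div_mul_cancel₀ _ hr.ne']
    linarith [D.dist_le_diamBd x y]
  · rw [div_mul_cancel₀ _ hr.ne']
    linarith [D'.dist_le_diamBd x y]
  · rw [hAm, hBm]
    field_simp

lemma exists_isSplitting : ∃ h c, 0 < h ∧ 0 < c ∧ ∀ C, (r ^ h)⁻¹ ≤ C →
    IsSplitting (Matched G G' C) r c C h := by
  classical
  have ha := G.a_pos
  have ha' := G'.a_pos
  obtain ⟨V, hV, hVm⟩ := G.exists_values
  obtain ⟨V', hV', hVm'⟩ := G'.exists_values
  obtain ⟨Q, Y, hY, htr⟩ := exists_transport (Zring p).toAddSubgroup V V' hV hV'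
  obtain ⟨h₁, hh₁⟩ := G.exists_pieces Q Y hY
  obtain ⟨h₂, hh₂⟩ := G'.exists_pieces Q Y hY
  set h := h₁ + h₂ + 1 with hh
  have hrh := D.rpow_pos h
  refine ⟨h, min D.c D'.c * r ^ h, by omega, mul_pos (lt_min D.c_pos D'.c_pos) hrh,
    fun C hC => ⟨fun k A B H => ⟨H.sat.isClosed, H.sat'.isClosed⟩,
    fun k A B H => ⟨H.nonempty, H.nonempty'⟩, fun k A B H => H.dist_le,
    fun k A B H => H.dist_le', fun k A B H => ?_⟩⟩
  have hk := D.ppow_pos k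
  obtain ⟨z, hz1, hz2, hz3, hz4, hz5⟩ := htr (Set X) (Set X') (D.classes k A) (D'.classes k B)
    (fun R => D.m R / (p ^ k * G.a)) (fun R => D'.m R / (p ^ k * G'.a))
    (hVm k A H.sat H.subset) (hVm' k B H.sat' H.subset') (by
      rw [← Finset.sum_div, ← Finset.sum_div, ← H.sat.m_eq_sum_classes,
        ← H.sat'.m_eq_sum_classes, mul_comm, mul_comm _ G'.a, ← div_div, ← div_div, H.m_eq])
  obtain ⟨b, hb1, hb2, hb3⟩ := hh₁ h (by omega) k A H.sat H.subset (Set X') (D'.classes k B) z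
    hz1 hz2 hz4
  obtain ⟨b', hb1', hb2', hb3'⟩ := hh₂ h (by omega) k B H.sat' H.subset' (Set X) (D.classes k A)
    (fun R' R => z R R') (fun R' hR' R hR => hz1 R hR R' hR') hz3 hz5
  have hsep : ∀ {c₀ : ℝ}, min D.c D'.c ≤ c₀ →
      min D.c D'.c * r ^ h * r ^ k ≤ c₀ * r ^ (k + h) := fun {c₀} hc => by
    rw [mul_assoc, ← pow_add, add_comm h]
    exact mul_le_mul_of_nonneg_right hc (D.rpow_pos _).le
  have hdiam : r ^ k ≤ C * r ^ (k + h) := by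
    have := mul_le_mul_of_nonneg_right hC (D.rpow_pos (k + h)).le
    refine le_trans (le_of_eq ?_) this
    rw [pow_add r k h, mul_comm (r ^ k), inv_mul_cancel_left₀ hrh.ne']
  refine ⟨{q : Set X × Set X' // q.1 ∈ D.classes k A ∧ q.2 ∈ D'.classes k B ∧ z q.1 q.2 ≠ 0},
    fun q => b q.1.1 q.1.2, fun q => b' q.1.2 q.1.1, ?_, ?_, ?_, ?_, ?_⟩
  · refine Subset.antisymm (fun x hx => ?_) (iUnion_subset fun q => ?_)
    · obtain ⟨R, hR, R', hR', hz, hx⟩ := hb3 x hx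
      exact mem_iUnion.2 ⟨⟨(R, R'), hR, hR', hz⟩, hx⟩
    · exact (hb1 _ q.2.1 _ q.2.2.1 q.2.2.2).2.1.trans (H.sat.subset_of_mem_classes q.2.1)
  · refine Subset.antisymm (fun x hx => ?_) (iUnion_subset fun q => ?_)
    · obtain ⟨R', hR', R, hR, hz, hx⟩ := hb3' x hx
      exact mem_iUnion.2 ⟨⟨(R, R'), hR, hR', hz⟩, hx⟩
    · exact (hb1' _ q.2.2.1 _ q.2.1 q.2.2.2).2.1.trans (H.sat'.subset_of_mem_classes q.2.2.1)
  · intro q q' hne x hx y hy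
    refine (hsep (min_le_left _ _)).trans
      ((hb1 _ q.2.1 _ q.2.2.1 q.2.2.2).1.le_dist hx fun hy' => ?_)
    exact Set.disjoint_left.1 (hb2 _ q.2.1 _ q.2.2.1 q.2.2.2 _ q'.2.1 _ q'.2.2.1 q'.2.2.2
      fun e => hne (Subtype.ext e)) hy' hy
  · intro q q' hne x hx y hy
    refine (hsep (min_le_right _ _)).trans
      ((hb1' _ q.2.2.1 _ q.2.1 q.2.2.2).1.le_dist hx fun hy' => ?_)
    exact Set.disjoint_left.1 (hb2' _ q.2.2.1 _ q.2.1 q.2.2.2 _ q'.2.2.1 _ q'.2.1 q'.2.2.2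
      fun e => hne (Subtype.ext (Prod.ext (congrArg Prod.snd e) (congrArg Prod.fst e)))) hy' hy
  · intro q
    obtain ⟨c1, c2, c3, c4⟩ := hb1 _ q.2.1 _ q.2.2.1 q.2.2.2
    obtain ⟨d1, d2, d3, d4⟩ := hb1' _ q.2.2.1 _ q.2.1 q.2.2.2
    refine ⟨c1, d1, c2.trans ((H.sat.subset_of_mem_classes q.2.1).trans H.subset),
      d2.trans ((H.sat'.subset_of_mem_classes q.2.2.1).trans H.subset'), c3, d3,
      fun x hx y hy => (D.dist_le_of_mem_classes q.2.1 (c2 hx) (c2 hy)).trans hdiam,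
      fun x hx y hy => (D'.dist_le_of_mem_classes q.2.2.1 (d2 hx) (d2 hy)).trans hdiam, ?_⟩
    rw [c4, d4]
    field_simp

lemma Matched.mono {C C' : ℝ} (hC : C ≤ C') {k : ℕ} {A : Set X} {B : Set X'}
    (H : Matched G G' C k A B) : Matched G G' C' k A B :=
  { H with
    dist_le := fun x hx y hy => (H.dist_le x hx y hy).trans
      (mul_le_mul_of_nonneg_right hC (D.rpow_pos k).le)
    dist_le' := fun x hx y hy => (H.dist_le' x hx y hy).trans
      (mul_le_mul_of_nonneg_right hC (D.rpow_pos k).le) }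

end SimSys.Island.Gen

/-- Two self-similar systems with the same parameters are Lipschitz equivalent if the ring
generated by the measure root is principal. -/
theorem SimSys.lipEquiv_univ_univ {X X' : Type} [MetricSpace X] [MeasurableSpace X] [MetricSpace X']
    [MeasurableSpace X'] [BorelSpace X] [CompactSpace X] [TotallyDisconnectedSpace X]
    [BorelSpace X'] [CompactSpace X'] [TotallyDisconnectedSpace X'] [Nonempty X] [Nonempty X']
    {r p : ℝ} (D : SimSys X r p) (D' : SimSys X' r p) (hPID : IsPrincipalIdealRing (Zring p)) :
    LipEquiv (univ : Set X) (univ : Set X') := by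
  obtain ⟨I⟩ := D.nonempty_island
  obtain ⟨I'⟩ := D'.nonempty_island
  obtain ⟨G⟩ := I.nonempty_gen hPID
  obtain ⟨G'⟩ := I'.nonempty_gen hPID
  obtain ⟨C, k, A, B, hAB⟩ := Island.Gen.exists_matched G G'
  obtain ⟨h, c, hh, hc, H⟩ := Island.Gen.exists_isSplitting G G'
  have hrh := inv_pos.2 (D.rpow_pos h)
  obtain ⟨φ, hφ⟩ := (H _ (le_max_right C _)).exists_isBiLip D.r_pos D.r_lt_one hh hc
    (hrh.trans_le (le_max_right C _)) (hAB.mono G G' (le_max_left C _))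
  exact (((I.lipEquiv_univ.trans
    (I.lipEquiv_of_isClopen hAB.sat.isClopen hAB.nonempty hAB.subset).symm).trans hφ.lipEquiv).trans
    (I'.lipEquiv_of_isClopen hAB.sat'.isClopen hAB.nonempty' hAB.subset')).trans
    I'.lipEquiv_univ.symm

/-! ### Bounded overlaps under the open set condition -/

lemma surjective_of_dist_eq_mul {E : Type*} [NormedAddCommGroup E] [InnerProductSpace ℝ E]
    [FiniteDimensional ℝ E] {g : E → E} {ρ : ℝ} (hρ : 0 < ρ)
    (hg : ∀ x y, dist (g x) (g y) = ρ * dist x y) : Function.Surjective g := by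
  have hiso : Isometry fun x => g (ρ⁻¹ • x) := Isometry.of_dist_eq fun x y => by
    rw [hg, dist_smul₀, Real.norm_of_nonneg (inv_pos.2 hρ).le, mul_inv_cancel_left₀ hρ.ne']
  set φ := hiso.affineIsometryOfStrictConvexSpace with hφ
  have hinj : Function.Injective φ.linear := φ.linearIsometry.injective
  have hsurj : Function.Surjective φ.linear := LinearMap.injective_iff_surjective.1 hinj
  intro y
  obtain ⟨x, hx⟩ := (AffineMap.linear_surjective_iff φ.toAffineMap).1 hsurj y
  exact ⟨ρ⁻¹ • x, hx⟩

lemma exists_card_le_of_separated {E : Type*} [PseudoMetricSpace E] [ProperSpace E] (x₀ : E)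
    (R : ℝ) {δ : ℝ} (hδ : 0 < δ) : ∃ M : ℕ, ∀ {κ : Type} (s : Finset κ) (u : κ → E),
      (∀ w ∈ s, dist (u w) x₀ ≤ R) → (∀ w ∈ s, ∀ w' ∈ s, w ≠ w' → δ ≤ dist (u w) (u w')) →
      s.card ≤ M := by
  obtain ⟨t, -, ht, hcov⟩ := (isCompact_closedBall x₀ R).finite_cover_balls (half_pos hδ)
  refine ⟨ht.toFinset.card, fun {κ} s u hs hsep => ?_⟩
  have : ∀ w, ∃ c, w ∈ s → c ∈ t ∧ dist (u w) c < δ / 2 := fun w => by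
    by_cases hw : w ∈ s
    · obtain ⟨c, hc, hcw⟩ := mem_iUnion₂.1 (hcov (mem_closedBall.2 (hs w hw)))
      exact ⟨c, fun _ => ⟨hc, hcw⟩⟩
    · exact ⟨x₀, fun h => absurd h hw⟩
  choose c hc using this
  refine Finset.card_le_card_of_injOn c (fun w hw => ht.mem_toFinset.2 (hc w hw).1) ?_
  intro w hw w' hw' heq
  by_contra hne
  have h1 := (hc w hw).2
  have h2 := (hc w' hw').2
  rw [← heq, dist_comm] at h2
  have h3 := dist_triangle (u w) (c w) (u w')
  linarith [hsep w hw w' hw' hne]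

namespace IFS

variable {d : ℕ} {S : IFS d} {r : ℝ} {lam : S.ι → ℕ}

lemma dist_wordMap (hlam : ∀ i, S.r i = r ^ lam i) (w : List S.ι)
    (x y : EuclideanSpace ℝ (Fin d)) :
    dist (wordMap S.f w x) (wordMap S.f w y) = r ^ wordWt lam w * dist x y := by
  induction w with
  | nil => simp [wordMap]
  | cons i w ih =>
    rw [wordWt_cons, pow_add, mul_assoc, ← ih, ← hlam, ← S.sim]
    rfl

lemma wordMap_image_subset {O : Set (EuclideanSpace ℝ (Fin d))} (hO : ∀ i, S.f i '' O ⊆ O)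
    (w : List S.ι) : wordMap S.f w '' O ⊆ O := by
  induction w with
  | nil => simp [wordMap]
  | cons i w ih =>
    rw [wordMap, image_comp]
    exact (image_mono ih).trans (hO i)

lemma OSCSet.disjoint {O : Set (EuclideanSpace ℝ (Fin d))} (hO : S.OSCSet O) {u v : List S.ι}
    (h : ¬ u <+: v) (h' : ¬ v <+: u) : Disjoint (wordMap S.f u '' O) (wordMap S.f v '' O) := by
  obtain ⟨-, -, -, hsub, hdisj⟩ := hO
  induction u generalizing v with
  | nil => exact absurd ⟨_, rfl⟩ h
  | cons i u ih =>
    cases v with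
    | nil => exact absurd ⟨_, rfl⟩ h'
    | cons j v =>
      rw [wordMap, wordMap, image_comp, image_comp]
      by_cases hij : i = j
      · subst hij
        refine (disjoint_image_iff ?_).2 (ih ?_ ?_)
        · intro x y hxy
          have := S.sim i x y
          rw [hxy, dist_self] at this
          exact dist_eq_zero.1 ((mul_eq_zero.1 this.symm).resolve_left (S.r_pos i).ne')
        · exact fun hp => h ((List.prefix_cons_inj i).2 hp)
        · exact fun hp => h' ((List.prefix_cons_inj i).2 hp)
      · exact (hdisj i j hij).mono (image_mono (wordMap_image_subset hsub u))
          (image_mono (wordMap_image_subset hsub v))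

lemma OSC.exists_overlap (hS : S.OSC) (hr0 : 0 < r) (hr1 : r < 1)
    (hlam : ∀ i, S.r i = r ^ lam i) {K : Set (EuclideanSpace ℝ (Fin d))}
    (hK : Bornology.IsBounded K) (C : ℝ) :
    ∃ M : ℕ, ∀ (k : ℕ) (x : EuclideanSpace ℝ (Fin d)) (s : Finset (List S.ι)),
      (∀ w ∈ s, IsCut lam w k ∧ ∃ y ∈ K, dist (wordMap S.f w y) x ≤ C * r ^ k) → s.card ≤ M := by
  obtain ⟨O, hO⟩ := hS
  obtain ⟨⟨o, ho⟩, hopen, -⟩ := id hO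
  obtain ⟨a, ha, hball⟩ := Metric.isOpen_iff.1 hopen o ho
  obtain ⟨B, hB⟩ := hK.subset_closedBall o
  set l := Finset.univ.sup lam + 1 with hl
  obtain ⟨M, hM⟩ := exists_card_le_of_separated (0 : EuclideanSpace ℝ (Fin d)) (B + C)
    (mul_pos ha (pow_pos hr0 l))
  refine ⟨M, fun k x s hs => ?_⟩
  have hrk := pow_pos hr0 k
  refine hM s (fun w => (r ^ k)⁻¹ • (wordMap S.f w o - x)) (fun w hw => ?_)
    fun w hw w' hw' hne => ?_
  · obtain ⟨hcut, y, hy, hd⟩ := hs w hw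
    have h1 : dist (wordMap S.f w o) (wordMap S.f w y) ≤ r ^ k * B := by
      rw [dist_wordMap hlam, dist_comm]
      exact mul_le_mul (pow_le_pow_of_le_one hr0.le hr1.le hcut.le_wordWt) (hB hy) dist_nonneg
        hrk.le
    have h2 := dist_triangle (wordMap S.f w o) (wordMap S.f w y) x
    rw [dist_zero_right, norm_smul, norm_inv, Real.norm_of_nonneg hrk.le, ← dist_eq_norm,
      inv_mul_le_iff₀ hrk]
    linarith
  · rw [dist_smul₀, norm_inv, Real.norm_of_nonneg hrk.le, dist_sub_right, le_inv_mul_iff₀ hrk]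
    by_contra! hlt
    have hdis := hO.disjoint (fun hp => hne ((hs w hw).1.eq_of_prefix_of_isCut (hs w' hw').1 hp))
      (fun hp => hne ((hs w' hw').1.eq_of_prefix_of_isCut (hs w hw).1 hp).symm)
    have hwt : r ^ (k + l) ≤ r ^ wordWt lam w' :=
      pow_le_pow_of_le_one hr0.le hr1.le
        ((hs w' hw').1.wordWt_lt (fun i =>
            (Finset.le_sup (f := lam) (Finset.mem_univ i)).trans (Nat.le_succ _))
          (Nat.succ_pos _)).le
    obtain ⟨z, hz⟩ := surjective_of_dist_eq_mul (pow_pos hr0 _) (dist_wordMap hlam w')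
      (wordMap S.f w o)
    have hzO : z ∈ O := by
      refine hball ?_
      rw [← hz, dist_wordMap hlam] at hlt
      have h1 : r ^ wordWt lam w' * dist z o < r ^ wordWt lam w' * a := by
        refine hlt.trans_le ?_
        rw [pow_add] at hwt
        have := mul_le_mul_of_nonneg_right hwt ha.le
        linarith
      exact mem_ball.2 (lt_of_mul_lt_mul_left h1 (pow_pos hr0 _).le)
    exact Set.disjoint_left.1 hdis ⟨o, ho, rfl⟩ ⟨z, hzO, hz⟩

end IFS

/-! ### Invariant measures -/

section InvariantMeasure

/-- Prepend a letter to a sequence. -/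
def seqCons {ι : Type*} (i : ι) (y : ℕ → ι) : ℕ → ι
  | 0 => i
  | n + 1 => y n

lemma measurable_seqCons {ι : Type*} [MeasurableSpace ι] :
    Measurable fun q : ι × (ℕ → ι) => seqCons q.1 q.2 := by
  refine measurable_pi_lambda _ fun n => ?_
  cases n with
  | zero => exact measurable_fst
  | succ n => exact (measurable_pi_apply n).comp measurable_snd

lemma map_seqCons_infinitePi {ι : Type*} [MeasurableSpace ι] (P : Measure ι)
    [IsProbabilityMeasure P] :
    (P.prod (Measure.infinitePi fun _ : ℕ => P)).map (fun q => seqCons q.1 q.2) =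
      Measure.infinitePi fun _ : ℕ => P := by
  classical
  refine Measure.eq_infinitePi _ fun s t ht => ?_
  obtain ⟨N, hN⟩ := s.exists_nat_subset_range
  set t' : ℕ → Set ι := fun n => if n ∈ s then t n else univ with ht'
  have ht'm : ∀ n, MeasurableSet (t' n) := fun n => by
    simp only [ht']
    split_ifs
    exacts [ht n, .univ]
  have hpi : Set.pi (s : Set ℕ) t = Set.pi (Finset.range (N + 1) : Set ℕ) t' := by
    ext x
    simp only [Set.mem_pi, Finset.mem_coe, ht']
    refine ⟨fun h n _ => ?_, fun h n hn => ?_⟩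
    · split_ifs with hn
      exacts [h n hn, mem_univ _]
    · have := h n (Finset.range_subset_range.2 (Nat.le_succ N) (hN hn))
      rwa [if_pos hn] at this
  have hpre : (fun q : ι × (ℕ → ι) => seqCons q.1 q.2) ⁻¹'
      Set.pi (Finset.range (N + 1) : Set ℕ) t' =
      t' 0 ×ˢ Set.pi (Finset.range N : Set ℕ) fun n => t' (n + 1) := by
    ext ⟨i, y⟩
    simp only [mem_preimage, Set.mem_pi, Finset.mem_coe, Finset.mem_range, mem_prod]
    refine ⟨fun h => ⟨h 0 (by omega), fun n hn => h (n + 1) (by omega)⟩, fun h n hn => ?_⟩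
    cases n with
    | zero => exact h.1
    | succ n => exact h.2 n (by omega)
  rw [hpi, Measure.map_apply measurable_seqCons
    (.pi (Finset.countable_toSet _) fun n _ => ht'm n), hpre, Measure.prod_prod,
    Measure.infinitePi_pi _ fun n _ => ht'm (n + 1), mul_comm,
    ← Finset.prod_range_succ' (fun n => P (t' n)) N]
  rw [← Finset.prod_subset (hN.trans (Finset.range_subset_range.2 (Nat.le_succ N)))]
  · exact Finset.prod_congr rfl fun n hn => by simp [ht', hn]
  · intro n _ hn
    simp [ht', hn]

variable {ι X : Type*} [MetricSpace X] (f : ι → X → X) (x₀ : X)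

/-- Finite approximations of the coding map. -/
def codeApprox : ℕ → (ℕ → ι) → X
  | 0, _ => x₀
  | n + 1, y => f (y 0) (codeApprox n fun k => y (k + 1))

lemma measurable_codeApprox [MeasurableSpace X] [BorelSpace X] [MeasurableSpace ι] [Countable ι]
    [DiscreteMeasurableSpace ι] (hf : ∀ i, Measurable (f i)) (n : ℕ) :
    Measurable (codeApprox f x₀ n) := by
  induction n with
  | zero => exact measurable_const
  | succ n ih =>
    have h1 : Measurable fun q : ι × X => f q.1 q.2 := measurable_from_prod_countable_right hf
    have h2 : Measurable fun y : ℕ → ι => fun k => y (k + 1) :=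
      measurable_pi_lambda _ fun k => measurable_pi_apply _
    exact h1.comp ((measurable_pi_apply 0).prodMk (ih.comp h2))

variable {f} {ρ : ℝ}

lemma dist_codeApprox_le (hρ : 0 ≤ ρ) (hf : ∀ i x y, dist (f i x) (f i y) ≤ ρ * dist x y)
    {B : ℝ} (hB : ∀ x y : X, dist x y ≤ B) (n : ℕ) (y : ℕ → ι) :
    dist (codeApprox f x₀ n y) (codeApprox f x₀ (n + 1) y) ≤ B * ρ ^ n := by
  induction n generalizing y with
  | zero => simpa using hB _ _
  | succ n ih =>
    refine (hf _ _ _).trans ?_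
    rw [pow_succ, ← mul_assoc, mul_comm]
    exact mul_le_mul_of_nonneg_right (ih _) hρ

theorem exists_invariant_measure {ι : Type} [Fintype ι] {f : ι → X → X} [CompactSpace X]
    [Nonempty X] [MeasurableSpace X] [BorelSpace X] {v : ι → ℝ} (hv : ∀ i, 0 ≤ v i)
    (hsum : ∑ i, v i = 1) (hρ : 0 ≤ ρ) (hρ1 : ρ < 1)
    (hf : ∀ i x y, dist (f i x) (f i y) ≤ ρ * dist x y) :
    ∃ μ : Measure X, IsProbabilityMeasure μ ∧
      ∀ A, MeasurableSet A → μ.real A = ∑ i, v i * μ.real (f i ⁻¹' A) := by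
  let _ : MeasurableSpace ι := ⊤
  obtain ⟨x₀⟩ := ‹Nonempty X›
  have hcont : ∀ i, Continuous (f i) := fun i =>
    (LipschitzWith.of_dist_le_mul (K := ⟨ρ, hρ⟩) (hf i)).continuous
  have hlim : ∀ y : ℕ → ι, ∃ x, Filter.Tendsto (fun n => codeApprox f x₀ n y) Filter.atTop
      (nhds x) := fun y =>
    cauchySeq_tendsto_of_complete (cauchySeq_of_le_geometric ρ _ hρ1 fun n =>
      dist_codeApprox_le x₀ hρ hf (fun a b => dist_le_diam_of_mem isCompact_univ.isBounded
        (mem_univ a) (mem_univ b)) n y)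
  choose Φ hΦ using hlim
  have hΦm : Measurable Φ := measurable_of_tendsto_metrizable
    (fun n => measurable_codeApprox f x₀ (fun i => (hcont i).measurable) n)
    (tendsto_pi_nhds.2 hΦ)
  have hcons : ∀ i y, Φ (seqCons i y) = f i (Φ y) := fun i y =>
    tendsto_nhds_unique ((Filter.tendsto_add_atTop_iff_nat 1).2 (hΦ (seqCons i y)))
      (((hcont i).tendsto _).comp (hΦ y))
  set P : Measure ι := ∑ i, ENNReal.ofReal (v i) • Measure.dirac i with hP
  have : IsProbabilityMeasure P := ⟨by
    simp only [hP, Measure.coe_finsetSum, Finset.sum_apply, Measure.smul_apply, measure_univ,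
      smul_eq_mul, mul_one]
    rw [← ENNReal.ofReal_sum_of_nonneg fun i _ => hv i, hsum, ENNReal.ofReal_one]⟩
  set π := Measure.infinitePi fun _ : ℕ => P with hπ
  have hprob : IsProbabilityMeasure (π.map Φ) :=
    Measure.isProbabilityMeasure_map hΦm.aemeasurable
  refine ⟨π.map Φ, hprob, fun A hA => ?_⟩
  have key : (π.map Φ) A = ∑ i, ENNReal.ofReal (v i) * (π.map Φ) (f i ⁻¹' A) := by
    have hpre : MeasurableSet ((fun q : ι × (ℕ → ι) => seqCons q.1 q.2) ⁻¹' (Φ ⁻¹' A)) :=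
      measurable_seqCons (hΦm hA)
    rw [Measure.map_apply hΦm hA, hπ, ← map_seqCons_infinitePi P,
      Measure.map_apply measurable_seqCons (hΦm hA), Measure.prod_apply hpre, hP,
      lintegral_finsetSum_measure]
    refine Finset.sum_congr rfl fun i _ => ?_
    rw [lintegral_smul_measure, lintegral_dirac, map_seqCons_infinitePi P,
      Measure.map_apply hΦm ((hcont i).measurable hA), smul_eq_mul]
    congr 2
    ext y
    simp [hcons]
  rw [measureReal_def, key, ENNReal.toReal_sum fun i _ =>
    ENNReal.mul_ne_top ENNReal.ofReal_ne_top (measure_ne_top _ _)]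
  refine Finset.sum_congr rfl fun i _ => ?_
  rw [ENNReal.toReal_mul, ENNReal.toReal_ofReal (hv i), measureReal_def]

end InvariantMeasure

/-! ### The dimension of a self-similar system -/

namespace SimSys

variable {X : Type*} [MetricSpace X] [MeasurableSpace X] {r p : ℝ}
  [BorelSpace X] [CompactSpace X] [TotallyDisconnectedSpace X]

lemma logb_pos (D : SimSys X r p) : 0 < Real.logb r p :=
  Real.logb_pos_of_base_lt_one D.r_pos D.r_lt_one D.p_pos D.p_lt_one

lemma rpow_pow_logb (D : SimSys X r p) (n : ℕ) : (r ^ n) ^ Real.logb r p = p ^ n := by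
  rw [← Real.rpow_natCast, ← Real.rpow_mul D.r_pos.le, mul_comm, Real.rpow_mul D.r_pos.le,
    Real.rpow_logb D.r_pos D.r_lt_one.ne D.p_pos, Real.rpow_natCast]

lemma hausdorffMeasure_univ_ne_top (D : SimSys X r p) [Nonempty X] :
    μH[Real.logb r p] (univ : Set X) ≠ ⊤ := by
  have hB := one_pos.trans_le D.one_le_diamBd
  set s := Real.logb r p with hs
  have hs0 : 0 < s := D.logb_pos
  have hdiam : ∀ w, ediam (D.cyl w) ≤ ENNReal.ofReal (D.diamBd * r ^ D.wt w) := fun w =>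
    ediam_le fun x hx y hy => by
      rw [edist_dist]
      exact ENNReal.ofReal_le_ofReal (D.dist_le_of_mem_cyl hx hy)
  refine ne_top_of_le_ne_top (ENNReal.ofReal_ne_top (r := D.diamBd ^ s))
    ((Measure.hausdorffMeasure_le_liminf_sum (β := ℕ) (ι := fun n => {w // w ∈ cutSet D.lam n})
      s univ (l := Filter.atTop) (fun n => ENNReal.ofReal (D.diamBd * r ^ n)) ?_
      (fun n w => D.cyl w.1) (Filter.Eventually.of_forall fun n w => ?_)
      (Filter.Eventually.of_forall fun n x _ => ?_)).trans
      ((Filter.liminf_le_liminf (Filter.Eventually.of_forall fun n => ?_)).trans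
        (Filter.liminf_const (ENNReal.ofReal (D.diamBd ^ s))).le))
  · have := (tendsto_pow_atTop_nhds_zero_of_lt_one D.r_pos.le D.r_lt_one).const_mul D.diamBd
    rw [mul_zero] at this
    simpa using ENNReal.tendsto_ofReal this
  · refine (hdiam w.1).trans (ENNReal.ofReal_le_ofReal (mul_le_mul_of_nonneg_left ?_ hB.le))
    exact D.rpow_le (D.cut_le_wt ((mem_cutSet D.lam_pos).1 w.2))
  · obtain ⟨w, hw, hx⟩ := D.exists_cut_mem n x
    exact mem_iUnion.2 ⟨⟨w, (mem_cutSet D.lam_pos).2 hw⟩, hx⟩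
  · calc ∑ w : {w // w ∈ cutSet D.lam n}, ediam (D.cyl w.1) ^ s
        ≤ ∑ w : {w // w ∈ cutSet D.lam n}, ENNReal.ofReal (D.diamBd ^ s * p ^ D.wt w.1) := by
          refine Finset.sum_le_sum fun w _ => ?_
          refine (ENNReal.rpow_le_rpow (hdiam w.1) hs0.le).trans (le_of_eq ?_)
          rw [ENNReal.ofReal_rpow_of_nonneg (mul_nonneg hB.le (D.rpow_pos _).le) hs0.le,
            Real.mul_rpow hB.le (D.rpow_pos _).le, D.rpow_pow_logb]
      _ = ENNReal.ofReal (D.diamBd ^ s) := by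
          rw [← ENNReal.ofReal_sum_of_nonneg fun w _ =>
            mul_nonneg (Real.rpow_nonneg hB.le s) (D.ppow_pos _).le, ← Finset.mul_sum,
            Finset.sum_coe_sort (cutSet D.lam n) (fun w => p ^ D.wt w),
            sum_cutSet_pow D.lam_pos D.sum_p, mul_one]

lemma exists_measure_le (D : SimSys X r p) : ∃ K : ℝ, 0 < K ∧ ∀ A : Set X, ediam A ≤ 1 →
    D.μ A ≤ ENNReal.ofReal K * ediam A ^ Real.logb r p := by
  obtain ⟨M, hM, hMm⟩ := D.exists_m_le 1
  have hp := D.p_pos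
  have hs0 := D.logb_pos
  set s := Real.logb r p with hs
  refine ⟨M / p, div_pos hM hp, fun A hA => ?_⟩
  have htop : ediam A ≠ ⊤ := ne_top_of_le_ne_top ENNReal.one_ne_top hA
  have hbdd : Bornology.IsBounded (closure A) := isCompact_univ.isBounded.subset (subset_univ _)
  have hδ : ediam A = ENNReal.ofReal (diam A) := (ENNReal.ofReal_toReal htop).symm
  have hδ1 : diam A ≤ 1 := by
    rw [hδ] at hA
    exact ENNReal.ofReal_le_one.1 hA
  have hk : ∀ k : ℕ, diam A ≤ r ^ k → D.m (closure A) ≤ M * p ^ k := fun k hk =>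
    hMm k _ isClosed_closure.measurableSet fun x hx y hy => by
      rw [one_mul]
      exact (dist_le_diam_of_mem hbdd hx hy).trans ((diam_closure A).le.trans hk)
  have hmA : D.μ A ≤ ENNReal.ofReal (D.m (closure A)) := by
    rw [m, ofReal_measureReal]
    exact measure_mono subset_closure
  refine hmA.trans ?_
  rw [hδ, ENNReal.ofReal_rpow_of_nonneg diam_nonneg hs0.le,
    ← ENNReal.ofReal_mul (div_pos hM hp).le]
  refine ENNReal.ofReal_le_ofReal ?_
  rcases (diam_nonneg (s := A)).eq_or_lt with h0 | h0
  · have hlim := (tendsto_pow_atTop_nhds_zero_of_lt_one hp.le D.p_lt_one).const_mul M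
    rw [mul_zero] at hlim
    refine (ge_of_tendsto' hlim fun k => hk k ?_).trans
      (mul_nonneg (div_pos hM hp).le (Real.rpow_nonneg diam_nonneg s))
    rw [← h0]
    exact (D.rpow_pos k).le
  · obtain ⟨k, hk1, hk2⟩ := exists_nat_pow_near_of_lt_one h0 hδ1 D.r_pos D.r_lt_one
    refine (hk k hk2).trans ?_
    have h1 := Real.rpow_le_rpow (D.rpow_pos (k + 1)).le hk1.le hs0.le
    rw [D.rpow_pow_logb] at h1
    calc M * p ^ k = M / p * p ^ (k + 1) := by rw [pow_succ]; field_simp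
      _ ≤ _ := mul_le_mul_of_nonneg_left h1 (div_pos hM hp).le

lemma hausdorffMeasure_univ_ne_zero (D : SimSys X r p) : μH[Real.logb r p] (univ : Set X) ≠ 0 := by
  obtain ⟨K, hK, hKm⟩ := D.exists_measure_le
  have hK0 : ENNReal.ofReal K ≠ 0 := (ENNReal.ofReal_pos.2 hK).ne'
  have h := Measure.le_hausdorffMeasure (Real.logb r p) ((ENNReal.ofReal K)⁻¹ • D.μ) 1 one_pos
    fun A hA => by
      rw [Measure.smul_apply, smul_eq_mul]
      refine (mul_le_mul_right (hKm A hA) _).trans (le_of_eq ?_)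
      rw [← mul_assoc, ENNReal.inv_mul_cancel hK0 ENNReal.ofReal_ne_top, one_mul]
  have h1 := h univ
  rw [Measure.smul_apply, measure_univ, smul_eq_mul, mul_one] at h1
  exact ((ENNReal.inv_pos.2 ENNReal.ofReal_ne_top).trans_le h1).ne'

theorem dimH_univ (D : SimSys X r p) [Nonempty X] :
    dimH (univ : Set X) = ENNReal.ofReal (Real.logb r p) := by
  have hs : ((Real.logb r p).toNNReal : ℝ) = Real.logb r p :=
    Real.coe_toNNReal _ D.logb_pos.le
  have h1 := D.hausdorffMeasure_univ_ne_top
  have h2 := D.hausdorffMeasure_univ_ne_zero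
  rw [← hs] at h1 h2
  exact dimH_of_hausdorffMeasure_ne_zero_ne_top h2 h1

end SimSys

/-! ### From iterated function systems to self-similar systems -/

lemma exists_sum_pow_eq_one {ι : Type*} [Fintype ι] [Nontrivial ι] {lam : ι → ℕ}
    (hlam : ∀ i, 0 < lam i) : ∃ t : ℝ, 0 < t ∧ t < 1 ∧ ∑ i, t ^ lam i = 1 := by
  have hcont : Continuous fun t : ℝ => ∑ i, t ^ lam i := by fun_prop
  have hcard : (1 : ℝ) < Fintype.card ι := by exact_mod_cast Fintype.one_lt_card
  have h0 : ∑ i, (0 : ℝ) ^ lam i = 0 :=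
    Finset.sum_eq_zero fun i _ => zero_pow (hlam i).ne'
  have h1 : ∑ i, (1 : ℝ) ^ lam i = Fintype.card ι := by simp
  obtain ⟨t, ht, hsum⟩ := intermediate_value_Icc zero_le_one hcont.continuousOn
    (show (1 : ℝ) ∈ Icc (∑ i, (0 : ℝ) ^ lam i) (∑ i, (1 : ℝ) ^ lam i) by
      rw [h0, h1]
      exact ⟨zero_le_one, hcard.le⟩)
  refine ⟨t, ht.1.lt_of_ne ?_, ht.2.lt_of_ne ?_, hsum⟩
  · rintro rfl
    simp only [h0] at hsum
    exact zero_ne_one hsum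
  · rintro rfl
    simp only [h1] at hsum
    exact hcard.ne' hsum

lemma lipEquiv_univ_subtype {X : Type*} [MetricSpace X] (E : Set X) :
    LipEquiv (univ : Set E) E :=
  ⟨Subtype.val, 1, le_rfl, ⟨fun x _ => x.2, Subtype.val_injective.injOn,
    fun x hx => ⟨⟨x, hx⟩, mem_univ _, rfl⟩⟩, fun x _ y _ => by simp [Subtype.dist_eq]⟩

namespace IFS

variable {d : ℕ} {S : IFS d} {E : Set (EuclideanSpace ℝ (Fin d))}

lemma isAttractor_attractor (h : S.attractor.Nonempty) : S.IsAttractor S.attractor := by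
  unfold attractor at h ⊢
  split_ifs at h ⊢ with hE
  · exact hE.choose_spec
  · exact absurd h not_nonempty_empty

namespace IsAttractor

lemma mapsTo (hE : S.IsAttractor E) (i : S.ι) : MapsTo (S.f i) E E := fun x hx => by
  rw [hE.2.2]
  exact mem_iUnion.2 ⟨i, x, hx, rfl⟩

/-- The maps of an iterated function system, restricted to its attractor. -/
def restrict (hE : S.IsAttractor E) (i : S.ι) : E → E := (hE.mapsTo i).restrict

lemma exists_restrict_eq (hE : S.IsAttractor E) (x : E) : ∃ i y, hE.restrict i y = x := by
  obtain ⟨i, y, hy, hyx⟩ := mem_iUnion.1 (hE.2.2.subset x.2)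
  exact ⟨i, ⟨y, hy⟩, Subtype.ext hyx⟩

lemma dist_restrict (hE : S.IsAttractor E) (i : S.ι) (x y : E) :
    dist (hE.restrict i x) (hE.restrict i y) = S.r i * dist x y :=
  S.sim i x y

lemma coe_wordMap_restrict (hE : S.IsAttractor E) (w : List S.ι) (x : E) :
    ((wordMap hE.restrict w x : E) : EuclideanSpace ℝ (Fin d)) = wordMap S.f w x := by
  induction w with
  | nil => rfl
  | cons i w ih => exact congrArg (S.f i) ih

lemma subsingleton_of_subsingleton [Subsingleton S.ι] (hE : S.IsAttractor E) :
    E.Subsingleton := by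
  intro x hx y hy
  obtain ⟨B, hB⟩ := Metric.isBounded_iff.1 hE.2.1.isBounded
  have hx' := hx
  rw [hE.2.2] at hx'
  obtain ⟨i, -⟩ := mem_iUnion.1 hx'
  have key : ∀ n : ℕ, ∀ x ∈ E, ∀ y ∈ E, dist x y ≤ S.r i ^ n * B := by
    intro n
    induction n with
    | zero => intro x hx y hy; simpa using hB hx hy
    | succ n ih =>
      intro x hx y hy
      rw [hE.2.2] at hx hy
      obtain ⟨j, u, hu, rfl⟩ := mem_iUnion.1 hx
      obtain ⟨k, v, hv, rfl⟩ := mem_iUnion.1 hy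
      obtain rfl := Subsingleton.elim i j
      obtain rfl := Subsingleton.elim i k
      rw [S.sim, pow_succ', mul_assoc]
      exact mul_le_mul_of_nonneg_left (ih u hu v hv) (S.r_pos i).le
  have hlim := (tendsto_pow_atTop_nhds_zero_of_lt_one (S.r_pos i).le (S.r_lt_one i)).mul_const B
  rw [zero_mul] at hlim
  exact dist_le_zero.1 (ge_of_tendsto' hlim fun n => key n x hx y hy)

/-- The attractor of an iterated function system with the open set condition and commensurable
ratios carries a self-similar system. -/
lemma exists_simSys (hE : S.IsAttractor E) (hS : S.OSC) {p r : ℝ} {lam : S.ι → ℕ} (hr0 : 0 < r)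
    (hr1 : r < 1) (hlam0 : ∀ i, 0 < lam i) (hlam : ∀ i, S.r i = r ^ lam i)
    (hgcd : Finset.univ.gcd lam = 1) (hp0 : 0 < p) (hp1 : p < 1) (hsum : ∑ i, p ^ lam i = 1) :
    Nonempty (SimSys E r p) := by
  have := isCompact_iff_compactSpace.1 hE.2.1
  have := hE.1.to_subtype
  obtain ⟨μ, hμ, hinv⟩ := exists_invariant_measure (f := hE.restrict)
    (fun i => (pow_pos hp0 (lam i)).le) hsum hr0.le hr1 fun i x y => by
      rw [hE.dist_restrict, hlam]
      exact mul_le_mul_of_nonneg_right (pow_le_of_le_one hr0.le hr1.le (hlam0 i).ne') dist_nonneg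
  exact ⟨{
    ι := S.ι
    fin := S.fin
    lam := lam
    lam_pos := hlam0
    gcd_lam := hgcd
    r_pos := hr0
    r_lt_one := hr1
    p_pos := hp0
    p_lt_one := hp1
    sum_p := hsum
    f := hE.restrict
    dist_f := fun i x y => by rw [hE.dist_restrict, hlam]
    cover := hE.exists_restrict_eq
    μ := μ
    prob := hμ
    inv := hinv
    overlap := fun C => by
      obtain ⟨M, hM⟩ := hS.exists_overlap hr0 hr1 hlam hE.2.1.isBounded C
      refine ⟨M, fun k x s hs => hM k x s fun w hw => ⟨(hs w hw).1, ?_⟩⟩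
      obtain ⟨y, hy⟩ := (hs w hw).2
      refine ⟨y, y.2, ?_⟩
      rwa [← hE.coe_wordMap_restrict] }⟩

end IsAttractor

lemma MemTOECpr.nonempty_simSys {p r : ℝ} (hS : S.MemTOECpr p r) (hp1 : p < 1) :
    S.IsAttractor S.attractor ∧ Nonempty (SimSys S.attractor r p) := by
  obtain ⟨⟨hosc, -, htd⟩, ⟨hr0, hr1, lam, hlam0, hlam, hgcd⟩, hp⟩ := hS
  have hdim : S.hdim ≠ 0 := fun h => by
    rw [h, Real.rpow_zero] at hp
    exact hp1.ne hp
  have hdim' : dimH S.attractor ≠ 0 := fun h =>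
    hdim (by rw [IFS.hdim, h, ENNReal.toReal_zero])
  have hE := isAttractor_attractor (S := S) (nonempty_iff_ne_empty.2 fun h =>
    hdim' (by rw [h, dimH_empty]))
  have : Nontrivial S.ι := by
    by_contra hι
    have := not_nontrivial_iff_subsingleton.1 hι
    exact hdim' hE.subsingleton_of_subsingleton.dimH_zero
  obtain ⟨q, hq0, hq1, hsum⟩ := exists_sum_pow_eq_one hlam0
  obtain ⟨D⟩ := hE.exists_simSys hosc hr0 hr1 hlam0 hlam hgcd hq0 hq1 hsum
  have := isCompact_iff_compactSpace.1 hE.2.1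
  have := hE.1.to_subtype
  have := totallyDisconnectedSpace_subtype_iff.2 htd
  have hD := D.dimH_univ
  rw [← isometry_subtype_coe.dimH_image, image_univ, Subtype.range_coe] at hD
  have hpq : p = q := by
    rw [hp, IFS.hdim, hD, ENNReal.toReal_ofReal D.logb_pos.le, Real.rpow_logb hr0 hr1.ne hq0]
  exact ⟨hE, hpq ▸ ⟨D⟩⟩

end IFS

/-- **Theorem.** If `S, T ∈ TOEC(p,r)` and `ℤ[p]` is a principal ideal domain, then
`E_S` and `E_T` are Lipschitz equivalent. -/
theorem lipEquiv_of_isPrincipalIdealRing {d d' : ℕ} (p r : ℝ)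
    (hp0 : 0 < p) (hp1 : p < 1) (hr0 : 0 < r) (hr1 : r < 1)
    (S : IFS d) (T : IFS d') (hS : S.MemTOECpr p r) (hT : T.MemTOECpr p r)
    (hPID : IsPrincipalIdealRing (Zring p)) :
    LipEquiv S.attractor T.attractor := by
  obtain ⟨hE, ⟨D⟩⟩ := hS.nonempty_simSys hp1
  obtain ⟨hE', ⟨D'⟩⟩ := hT.nonempty_simSys hp1
  have := isCompact_iff_compactSpace.1 hE.2.1
  have := isCompact_iff_compactSpace.1 hE'.2.1
  have := hE.1.to_subtype
  have := hE'.1.to_subtype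
  have := totallyDisconnectedSpace_subtype_iff.2 hS.1.2.2
  have := totallyDisconnectedSpace_subtype_iff.2 hT.1.2.2
  exact ((lipEquiv_univ_subtype S.attractor).symm.trans (D.lipEquiv_univ_univ D' hPID)).trans
    (lipEquiv_univ_subtype T.attractor)

end
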